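/- Let S be a compact, orientable, two-dimensional embedded C^∞ submanifold of ℝ³ without boundary. There is a constant c > 0 depending only on S (in particular independent of z₀) such that for every z₀ ∈ S the approximate Green's function g̃ satisfies, for every C¹ function w : S → ℝ, | a(g̃, w) − w(z₀) | ≤ c ( ∫_S w² )^{1/2}, where a(v,w) = ∫_S (⟨∇_S v, ∇_S w⟩ + v w). -/

import Mathlib

open MeasureTheory Metric
open scoped RealInnerProductSpace ENNReal NNReal

noncomputable section

/-- Ambient Euclidean space `ℝ³`. -/
abbrev E3 : Type := EuclideanSpace ℝ (Fin 3)

/-- The tangential gradient of `w : E3 → ℝ` along the set `A` at `x`, with values projected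
onto the subspace `P`: the orthogonal projection onto `P` of the Riesz representative of the
derivative of `w` within `A` at `x`. -/
def tGrad (A : Set E3) (P : Submodule ℝ E3) (w : E3 → ℝ) (x : E3) : E3 :=
  (Submodule.orthogonalProjectionOnto P ((InnerProductSpace.toDual ℝ E3).symm (fderivWithin ℝ w A x)) : E3)

/-- A compact, orientable, two-dimensional embedded `C^∞` submanifold of `ℝ³` without boundary,
described by a global smooth unit normal field `n` and local smooth regular defining functions. -/
structure SmoothSurface where
  S : Set E3
  n : E3 → E3
  compact : IsCompact S
  nonempty : S.Nonempty
  localLevel : ∀ x ∈ S, ∃ U : Set E3, ∃ F : E3 → ℝ, IsOpen U ∧ x ∈ U ∧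
    ContDiff ℝ (⊤ : ℕ∞) F ∧ S ∩ U = {y ∈ U | F y = 0} ∧
    (∀ y ∈ U, gradient F y ≠ 0) ∧
    (∀ y, y ∈ S ∩ U → ∃ t : ℝ, gradient F y = t • n y)
  n_unit : ∀ x ∈ S, ‖n x‖ = 1
  n_smooth : ∃ U : Set E3, IsOpen U ∧ S ⊆ U ∧ ContDiffOn ℝ (⊤ : ℕ∞) n U

namespace SmoothSurface

variable (Srf : SmoothSurface)

/-- The tangent plane of `S` at `x`, as the orthogonal complement of the normal. -/
def tangent (x : E3) : Submodule ℝ E3 := (ℝ ∙ Srf.n x)ᗮ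

/-- The tangential gradient `∇_S w` on the surface. -/
def grad (w : E3 → ℝ) (x : E3) : E3 := tGrad Srf.S (Srf.tangent x) w x

/-- The bilinear form `a(v,w) = ∫_S (⟨∇_S v, ∇_S w⟩ + v w)` (w.r.t. 2-dimensional
Hausdorff measure on `S`). -/
def aForm (v w : E3 → ℝ) : ℝ :=
  ∫ x in Srf.S, (⟪Srf.grad v x, Srf.grad w x⟫ + v x * w x) ∂μH[2]

end SmoothSurface

/-- The (closed, flat) triangle with vertices `t.1, t.2.1, t.2.2`. -/
def triOf (t : E3 × E3 × E3) : Set E3 := convexHull ℝ {t.1, t.2.1, t.2.2}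

/-- The vertex set of a triangle. -/
def vertsOf (t : E3 × E3 × E3) : Set E3 := {t.1, t.2.1, t.2.2}

/-- The plane spanned by a triangle. -/
def planeOf (t : E3 × E3 × E3) : Set E3 := (affineSpan ℝ (vertsOf t) : Set E3)

/-- The direction (2-dimensional linear subspace) of the plane of a triangle. -/
def dirOf (t : E3 × E3 × E3) : Submodule ℝ E3 := (affineSpan ℝ (vertsOf t)).direction

/-- The triangle-wise tangential gradient `∇_{S_h} w` on the triangle `t`. -/
def gradTri (t : E3 × E3 × E3) (w : E3 → ℝ) (x : E3) : E3 := tGrad (triOf t) (dirOf t) w x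

/-- An admissible quasi-uniform triangulation `T_h` of the surface `Srf` with mesh parameter `h`
and quasi-uniformity constant `γ₀`, together with the nearest-point projection `a` defined on
a tubular neighbourhood `N` of the surface. -/
structure Triangulation (Srf : SmoothSurface) (γ₀ h : ℝ) where
  T : Finset (E3 × E3 × E3)
  a : E3 → E3
  N : Set E3
  T_nonempty : T.Nonempty
  indep : ∀ t ∈ T, AffineIndependent ℝ ![t.1, t.2.1, t.2.2]
  verts_on : ∀ t ∈ T, vertsOf t ⊆ Srf.S
  meet : ∀ t ∈ T, ∀ t' ∈ T, t ≠ t' →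
    triOf t ∩ triOf t' = ∅ ∨
    (∃ v, v ∈ vertsOf t ∩ vertsOf t' ∧ triOf t ∩ triOf t' = {v}) ∨
    (∃ v w, v ≠ w ∧ v ∈ vertsOf t ∩ vertsOf t' ∧ w ∈ vertsOf t ∩ vertsOf t' ∧
      triOf t ∩ triOf t' = segment ℝ v w)
  diam_le : ∀ t ∈ T, Metric.diam (triOf t) ≤ h
  disk : ∀ t ∈ T, ∃ y ∈ triOf t, closedBall y (γ₀ * h) ∩ planeOf t ⊆ triOf t
  N_open : IsOpen N
  S_sub : Srf.S ⊆ N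
  Sh_sub : (⋃ t ∈ T, triOf t) ⊆ N
  a_smooth : ContDiffOn ℝ (⊤ : ℕ∞) a N
  a_mem : ∀ x ∈ N, a x ∈ Srf.S
  a_nearest : ∀ x ∈ N, ∀ y ∈ Srf.S, dist x (a x) ≤ dist x y
  a_unique : ∀ x ∈ N, ∀ y ∈ Srf.S, dist x y = dist x (a x) → y = a x
  a_bij : Set.BijOn a (⋃ t ∈ T, triOf t) Srf.S

namespace Triangulation

variable {Srf : SmoothSurface} {γ₀ h : ℝ} (Tr : Triangulation Srf γ₀ h)

/-- The polyhedral surface `S_h`, the union of the triangles. -/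
def Sh : Set E3 := ⋃ t ∈ Tr.T, triOf t

/-- Membership in the finite element space `V_h` of continuous, piecewise affine functions
on `S_h` (as functions `E3 → ℝ`; only the values on `S_h` are relevant). -/
def IsVh (v : E3 → ℝ) : Prop :=
  ContinuousOn v Tr.Sh ∧
  ∀ t ∈ Tr.T, ∃ (L : E3 →ₗ[ℝ] ℝ) (c : ℝ), ∀ x ∈ triOf t, v x = L x + c


/-- The discrete bilinear form
`a_h(v,w) = ∫_{S_h} (⟨∇_{S_h} v, ∇_{S_h} w⟩ + v w)`, computed triangle by triangle. -/
def ahForm (v w : E3 → ℝ) : ℝ :=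
  ∑ t ∈ Tr.T, ∫ x in triOf t,
    (⟪gradTri t v x, gradTri t w x⟫ + v x * w x) ∂μH[2]

/-- The lift of a function on `S_h` to a function on `S` via the inverse of `a|_{S_h}`. -/
def liftS (w : E3 → ℝ) : E3 → ℝ := fun y => w (Function.invFunOn Tr.a Tr.Sh y)

/-- The lift of `f : S → ℝ` to `S_h` is `f ∘ a`. -/
def liftSh (f : E3 → ℝ) : E3 → ℝ := fun x => f (Tr.a x)

end Triangulation

/-- `f` is smooth in a neighbourhood of the set `A`. -/
def SmoothNear (f : E3 → ℝ) (A : Set E3) : Prop :=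
  ∃ V : Set E3, IsOpen V ∧ A ⊆ V ∧ ContDiffOn ℝ (⊤ : ℕ∞) f V

/-- `u` is the (weak, hence smooth) solution of `-Δ_S u + u = f` on the surface `Srf`. -/
def IsSolution (Srf : SmoothSurface) (f u : E3 → ℝ) : Prop :=
  SmoothNear u Srf.S ∧
  ∀ φ : E3 → ℝ, ContDiff ℝ (⊤ : ℕ∞) φ → Srf.aForm u φ = ∫ x in Srf.S, f x * φ x ∂μH[2]

/-- `uh` is the discrete Galerkin solution in `V_h` with data the lift `f ∘ a` of `f`. -/
def Triangulation.IsDiscreteSolution {Srf : SmoothSurface} {γ₀ h : ℝ}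
    (Tr : Triangulation Srf γ₀ h) (f uh : E3 → ℝ) : Prop :=
  Tr.IsVh uh ∧
  ∀ φh : E3 → ℝ, Tr.IsVh φh →
    Tr.ahForm uh φh = ∫ x in Tr.Sh, f (Tr.a x) * φh x ∂μH[2]

/-- Orthogonal projection onto the affine tangent plane of `S` at `z₀`. -/
def SmoothSurface.P0 (Srf : SmoothSurface) (z₀ : E3) (x : E3) : E3 :=
  z₀ + (Submodule.orthogonalProjectionOnto (Srf.tangent z₀) (x - z₀) : E3)

/-- `r(x) = ‖P₀(x) − z₀‖`, the distance of the tangential projection of `x` to `z₀`. -/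
def SmoothSurface.rfn (Srf : SmoothSurface) (z₀ : E3) (x : E3) : ℝ :=
  ‖Srf.P0 z₀ x - z₀‖

/-- The affine tangent plane `z₀ + T_{z₀}S`. -/
def SmoothSurface.tplane (Srf : SmoothSurface) (z₀ : E3) : Set E3 :=
  {x : E3 | x - z₀ ∈ Srf.tangent z₀}

/-- The disk `D = B₁₀₀(z₀)` in the affine tangent plane at `z₀`. -/
def SmoothSurface.disk100 (Srf : SmoothSurface) (z₀ : E3) : Set E3 :=
  Srf.tplane z₀ ∩ closedBall z₀ 100

/-- `r₁ > 0` is a graph radius for `S`: uniformly in `z₀ ∈ S`, the piece `B_{2r₁}(z₀) ∩ S`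
is a graph over the tangent plane at `z₀`, in particular `P₀` is injective on it. -/
def SmoothSurface.IsGraphRadius (Srf : SmoothSurface) (r₁ : ℝ) : Prop :=
  0 < r₁ ∧ r₁ ≤ 1 ∧ ∀ z₀ ∈ Srf.S, Set.InjOn (Srf.P0 z₀) (Srf.S ∩ closedBall z₀ (2 * r₁))

/-- `ζ` is an admissible smooth cutoff at `z₀`: supported in the ball of radius `3r₁/2`,
equal to `1` on the ball of radius `r₁`, with `C²`-bounds at most `Cζ` (uniform in `z₀`). -/
def IsCutoff (z₀ : E3) (r₁ Cζ : ℝ) (ζ : E3 → ℝ) : Prop :=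
  ContDiff ℝ (⊤ : ℕ∞) ζ ∧ tsupport ζ ⊆ closedBall z₀ (3 / 2 * r₁) ∧
  (∀ x ∈ closedBall z₀ r₁, ζ x = 1) ∧
  ∀ x : E3, |ζ x| + ‖fderiv ℝ ζ x‖ + ‖fderiv ℝ (fderiv ℝ ζ) x‖ ≤ Cζ

/-- `v` is the Neumann Green's function with pole `z₀` of `−Δ + 1` on the disk
`D = B₁₀₀(z₀)` in the tangent plane at `z₀`: it is smooth away from the pole, satisfies
`∫_D (⟨∇v, ∇φ⟩ + v φ) = φ(z₀)` for every smooth test function, and differs from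
`(1/2π) log‖· − z₀‖` by an `H²(D)`-function with norm at most `CG`. -/
def SmoothSurface.IsGreen (Srf : SmoothSurface) (z₀ : E3) (CG : ℝ) (v : E3 → ℝ) : Prop :=
  ContDiffOn ℝ (⊤ : ℕ∞) v (Srf.disk100 z₀ \ {z₀}) ∧
  (∀ φ : E3 → ℝ, ContDiff ℝ (⊤ : ℕ∞) φ →
    ∫ x in Srf.disk100 z₀,
      (⟪tGrad (Srf.disk100 z₀) (Srf.tangent z₀) v x,
        tGrad (Srf.disk100 z₀) (Srf.tangent z₀) φ x⟫ + v x * φ x) ∂μH[2] = φ z₀) ∧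
  (∫ x in Srf.disk100 z₀,
      ((v x - (1 / (2 * Real.pi)) * Real.log ‖x - z₀‖) ^ 2 +
        ‖fderivWithin ℝ (fun y => v y - (1 / (2 * Real.pi)) * Real.log ‖y - z₀‖)
            (Srf.disk100 z₀) x‖ ^ 2 +
        ‖fderivWithin ℝ
            (fun y => fderivWithin ℝ
              (fun y' => v y' - (1 / (2 * Real.pi)) * Real.log ‖y' - z₀‖)
              (Srf.disk100 z₀) y)
            (Srf.disk100 z₀) x‖ ^ 2) ∂μH[2]) ≤ CG

/-- The approximate Green's function `g̃(x) = ζ(x) v(P₀(x))` on `S`. -/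
def approxGreen (Srf : SmoothSurface) (z₀ : E3) (ζ v : E3 → ℝ) : E3 → ℝ :=
  fun x => ζ x * v (Srf.P0 z₀ x)

/-- The cut-off lifted logarithm `l̃(x) = ζ(x) log r(x)` on `S`. -/
def cutLog (Srf : SmoothSurface) (z₀ : E3) (ζ : E3 → ℝ) : E3 → ℝ :=
  fun x => ζ x * Real.log (Srf.rfn z₀ x)

/-- `lh` is the discrete (Galerkin) projection of the function `w` on `S`:
`a_h(lh, v_h) = a(w, V_h)` for all `v_h ∈ V_h`, where `V_h` is the lift of `v_h` to `S`. -/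
def Triangulation.IsDiscreteProjection {Srf : SmoothSurface} {γ₀ h : ℝ}
    (Tr : Triangulation Srf γ₀ h) (w lh : E3 → ℝ) : Prop :=
  Tr.IsVh lh ∧ ∀ vh : E3 → ℝ, Tr.IsVh vh → Tr.ahForm lh vh = Srf.aForm w (Tr.liftS vh)


namespace AG

lemma ode_flux_deriv (K : ℝ) (f g : ℝ → ℝ)
    (hfg : ∀ r ∈ Set.Ioo (0:ℝ) 100, HasDerivAt f (g r) r)
    (hI : ∀ r ∈ Set.Ioo (0:ℝ) 100,
      IntervalIntegrable (fun τ => (K/τ+τ) * f τ) volume r 100)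
    (hW : ∀ r ∈ Set.Ioo (0:ℝ) 100, r * g r = -∫ τ in r..100, (K/τ+τ) * f τ) :
    ∀ r ∈ Set.Ioo (0:ℝ) 100, HasDerivAt (fun r => r * g r) ((K/r+r) * f r) r := by
  intro r hr
  have hc : ∀ x ∈ Set.Ioo (0:ℝ) 100, ContinuousAt (fun τ => (K/τ+τ) * f τ) x := by
    intro x hx
    have := (hfg x hx).continuousAt
    have hx0 : x ≠ 0 := ne_of_gt hx.1
    fun_prop (disch := assumption)
  have hcO : ContinuousOn (fun τ => (K/τ+τ) * f τ) (Set.Ioo (0:ℝ) 100) :=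
    fun x hx => (hc x hx).continuousWithinAt
  have hd := intervalIntegral.integral_hasDerivAt_left (hI r hr)
    (hcO.stronglyMeasurableAtFilter isOpen_Ioo r hr) (hc r hr)
  have h2 := hd.neg
  rw [neg_neg] at h2
  refine h2.congr_of_eventuallyEq ?_
  filter_upwards [isOpen_Ioo.mem_nhds hr] with x hx
  exact hW x hx

lemma ode_energy (K : ℝ) (hK : 0 ≤ K) (f g : ℝ → ℝ)
    (hfg : ∀ r ∈ Set.Ioo (0:ℝ) 100, HasDerivAt f (g r) r)
    (hI : ∀ r ∈ Set.Ioo (0:ℝ) 100,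
      IntervalIntegrable (fun τ => (K/τ+τ) * f τ) volume r 100)
    (hW : ∀ r ∈ Set.Ioo (0:ℝ) 100, r * g r = -∫ τ in r..100, (K/τ+τ) * f τ)
    (hb : ∃ C, ∀ r ∈ Set.Ico (50:ℝ) 100, |f r| ≤ C) :
    ∀ r ∈ Set.Ioo (0:ℝ) 100, f r * (r * g r) ≤ 0 := by
  have hp := ode_flux_deriv K f g hfg hI hW
  have hE : ∀ r ∈ Set.Ioo (0:ℝ) 100, HasDerivAt (fun r => f r * (r * g r))
      (g r * (r * g r) + f r * ((K/r+r) * f r)) r := fun r hr => (hfg r hr).mul (hp r hr)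
  have hmono : MonotoneOn (fun r => f r * (r * g r)) (Set.Ioo (0:ℝ) 100) := by
    apply monotoneOn_of_deriv_nonneg (convex_Ioo _ _)
    · exact fun x hx => (hE x hx).continuousAt.continuousWithinAt
    · rw [interior_Ioo]; exact fun x hx => (hE x hx).differentiableAt.differentiableWithinAt
    · rw [interior_Ioo]; intro x hx
      rw [(hE x hx).deriv]
      have hx0 := hx.1
      have : g x * (x * g x) + f x * ((K/x+x) * f x) = x * (g x)^2 + (K/x+x) * (f x)^2 := by ring
      rw [this]; positivity
  intro r hr
  by_contra hneg
  push Not at hneg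
  obtain ⟨C, hC⟩ := hb
  have hlim : Filter.Tendsto (fun r => r * g r) (nhdsWithin 100 (Set.Iio 100)) (nhds 0) := by
    have hcont : ContinuousOn (fun x => ∫ τ in (100:ℝ)..x, (K/τ+τ) * f τ) (Set.uIcc 100 50) := by
      apply intervalIntegral.continuousOn_primitive_interval
      have := hI 50 (by norm_num)
      rw [intervalIntegrable_iff, Set.uIoc_of_le (by norm_num)] at this
      rw [Set.uIcc_of_ge (by norm_num)]
      rwa [integrableOn_Icc_iff_integrableOn_Ioc]
    have h1 := hcont 100 (by simp)
    rw [Set.uIcc_of_ge (by norm_num)] at h1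
    have h2 : Filter.Tendsto (fun x => ∫ τ in (100:ℝ)..x, (K/τ+τ) * f τ)
        (nhdsWithin 100 (Set.Iio 100)) (nhds 0) := by
      have := h1.tendsto
      simp only [intervalIntegral.integral_same] at this
      refine this.mono_left ?_
      rw [nhdsWithin_le_iff]
      have : Set.Ioo (50:ℝ) 100 ∈ nhdsWithin (100:ℝ) (Set.Iio 100) := Ioo_mem_nhdsLT (by norm_num)
      exact Filter.mem_of_superset this Set.Ioo_subset_Icc_self
    refine h2.congr' ?_
    have : Set.Ioo (50:ℝ) 100 ∈ nhdsWithin (100:ℝ) (Set.Iio 100) := Ioo_mem_nhdsLT (by norm_num)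
    filter_upwards [this] with x hx
    rw [hW x ⟨by linarith [hx.1], hx.2⟩, intervalIntegral.integral_symm]
  have hlim2 : Filter.Tendsto (fun r => |C| * |r * g r|) (nhdsWithin 100 (Set.Iio 100)) (nhds 0) := by
    simpa using (hlim.abs).const_mul |C|
  have hev := hlim2.eventually (gt_mem_nhds hneg)
  have h3 : Set.Ioo (max 50 r) 100 ∈ nhdsWithin (100:ℝ) (Set.Iio 100) :=
    Ioo_mem_nhdsLT (by simp [hr.2]; norm_num)
  obtain ⟨x, hx1, hx2⟩ := (hev.and h3).exists
  have hx50 : 50 < x := lt_of_le_of_lt (le_max_left _ _) hx2.1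
  have hxr : r < x := lt_of_le_of_lt (le_max_right _ _) hx2.1
  have h4 := hmono hr ⟨by linarith, hx2.2⟩ hxr.le
  have h5 : f x * (x * g x) ≤ |C| * |x * g x| := by
    calc f x * (x * g x) ≤ |f x * (x * g x)| := le_abs_self _
      _ = |f x| * |x * g x| := abs_mul _ _
      _ ≤ |C| * |x * g x| := by
        exact mul_le_mul_of_nonneg_right ((hC x ⟨hx50.le, hx2.2⟩).trans (le_abs_self _)) (abs_nonneg _)
  simp only at h4
  linarith

lemma ode_antitone_sq (f g : ℝ → ℝ)
    (hfg : ∀ r ∈ Set.Ioo (0:ℝ) 100, HasDerivAt f (g r) r)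
    (hE : ∀ r ∈ Set.Ioo (0:ℝ) 100, f r * (r * g r) ≤ 0) :
    AntitoneOn (fun r => (f r)^2) (Set.Ioo (0:ℝ) 100) := by
  have hd : ∀ r ∈ Set.Ioo (0:ℝ) 100, HasDerivAt (fun r => (f r)^2) (2 * f r * g r) r := by
    intro r hr; simpa using (hfg r hr).fun_pow 2
  apply antitoneOn_of_deriv_nonpos (convex_Ioo _ _)
  · exact fun x hx => (hd x hx).continuousAt.continuousWithinAt
  · rw [interior_Ioo]; exact fun x hx => (hd x hx).differentiableAt.differentiableWithinAt
  · rw [interior_Ioo]; intro x hx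
    rw [(hd x hx).deriv]
    have h1 := hE x hx
    have hx0 := hx.1
    have : f x * (x * g x) = x * (f x * g x) := by ring
    rw [this] at h1
    nlinarith [nonpos_of_mul_nonpos_right h1 hx0]

/-- sign constancy to the left of a positive point -/
lemma ode_pos_left (f g : ℝ → ℝ)
    (hfg : ∀ r ∈ Set.Ioo (0:ℝ) 100, HasDerivAt f (g r) r)
    (hE : ∀ r ∈ Set.Ioo (0:ℝ) 100, f r * (r * g r) ≤ 0)
    {r₀ : ℝ} (hr₀ : r₀ ∈ Set.Ioo (0:ℝ) 100) (hpos : 0 < f r₀) :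
    ∀ r ∈ Set.Ioc 0 r₀, f r₀ ≤ f r := by
  intro r hr
  have hanti := ode_antitone_sq f g hfg hE
  have hsub : Set.Icc r r₀ ⊆ Set.Ioo (0:ℝ) 100 := fun x hx =>
    ⟨lt_of_lt_of_le hr.1 hx.1, lt_of_le_of_lt hx.2 hr₀.2⟩
  have hsq : ∀ x ∈ Set.Icc r r₀, (f r₀)^2 ≤ (f x)^2 := fun x hx =>
    hanti (hsub hx) hr₀ hx.2
  have hfr : 0 < f r := by
    by_contra hneg
    push Not at hneg
    have hc : ContinuousOn f (Set.Icc r r₀) := fun x hx =>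
      (hfg x (hsub hx)).continuousAt.continuousWithinAt
    have := intermediate_value_Icc hr.2 hc
    obtain ⟨x, hx, hfx⟩ := this ⟨hneg, hpos.le⟩
    have := hsq x hx
    rw [hfx] at this
    nlinarith
  have := hsq r ⟨le_refl _, hr.2⟩
  exact le_of_sq_le_sq this hfr.le
where
  le_of_sq_le_sq {a b : ℝ} (h : a^2 ≤ b^2) (hb : 0 ≤ b) : a ≤ b := by nlinarith [abs_le_of_sq_le_sq h hb, le_abs_self a]

lemma ode_k_nonpos (k : ℕ) (hk : 1 ≤ k) (f g : ℝ → ℝ)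
    (hfg : ∀ r ∈ Set.Ioo (0:ℝ) 100, HasDerivAt f (g r) r)
    (hI : ∀ r ∈ Set.Ioo (0:ℝ) 100,
      IntervalIntegrable (fun τ => ((k:ℝ)^2/τ+τ) * f τ) volume r 100)
    (hW : ∀ r ∈ Set.Ioo (0:ℝ) 100, r * g r = -∫ τ in r..100, ((k:ℝ)^2/τ+τ) * f τ)
    (hb : ∃ C, ∀ r ∈ Set.Ico (50:ℝ) 100, |f r| ≤ C)
    (hIntg : IntegrableOn (fun r => r * g r - k * f r) (Set.Ioo 0 100)) :
    ∀ r ∈ Set.Ioo (0:ℝ) 100, f r ≤ 0 := by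
  intro r₀ hr₀
  by_contra hneg
  push Not at hneg
  have hp := ode_flux_deriv _ f g hfg hI hW
  have hE := ode_energy _ (by positivity) f g hfg hI hW hb
  have hpos := ode_pos_left f g hfg hE hr₀ hneg
  have hF : ∀ r ∈ Set.Ioo (0:ℝ) 100, HasDerivAt (fun r => r^k * (r * g r - k * f r))
      (r^(k+1) * f r) r := by
    intro r hr
    have h1 := (hasDerivAt_pow k r).mul ((hp r hr).sub ((hfg r hr).const_mul (k:ℝ)))
    convert! h1 using 1
    have hr0 : r ≠ 0 := ne_of_gt hr.1
    obtain ⟨j, rfl⟩ : ∃ j, k = j + 1 := ⟨k-1, by omega⟩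
    simp only [Nat.add_sub_cancel, Pi.sub_apply]
    field_simp
    ring
  have hsub : Set.Ioc 0 r₀ ⊆ Set.Ioo (0:ℝ) 100 := fun x hx => ⟨hx.1, lt_of_le_of_lt hx.2 hr₀.2⟩
  have hmono : MonotoneOn (fun r => r^k * (r * g r - k * f r)) (Set.Ioc 0 r₀) := by
    apply monotoneOn_of_deriv_nonneg (convex_Ioc _ _)
    · exact fun x hx => (hF x (hsub hx)).continuousAt.continuousWithinAt
    · rw [interior_Ioc]
      exact fun x hx => (hF x (hsub ⟨hx.1, hx.2.le⟩)).differentiableAt.differentiableWithinAt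
    · rw [interior_Ioc]; intro x hx
      rw [(hF x (hsub ⟨hx.1, hx.2.le⟩)).deriv]
      have := hpos x ⟨hx.1, hx.2.le⟩
      have hx0 := hx.1
      have hfx : 0 ≤ f x := by linarith
      positivity
  -- negative value at r₀
  have hr0 := hr₀.1
  have hc : r₀^k * (r₀ * g r₀ - k * f r₀) < 0 := by
    apply mul_neg_of_pos_of_neg (by positivity)
    have h1 := hE r₀ hr₀
    have h2 : r₀ * g r₀ ≤ 0 := by
      by_contra h; push Not at h; nlinarith [mul_pos hneg h]
    have h3 : (1:ℝ) ≤ k := by exact_mod_cast hk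
    nlinarith
  set c := -(r₀^k * (r₀ * g r₀ - k * f r₀)) with hcdef
  have hc0 : 0 < c := by linarith
  -- lower bound c' / r
  have hlow : ∀ r ∈ Set.Ioc 0 (min 1 r₀), c * r⁻¹ ≤ ‖r * g r - k * f r‖ := by
    intro r hr
    have hrr : r ∈ Set.Ioc 0 r₀ := ⟨hr.1, hr.2.trans (min_le_right _ _)⟩
    have hr1 : r ≤ 1 := hr.2.trans (min_le_left _ _)
    have h1 := hmono hrr ⟨hr0, le_refl _⟩ hrr.2
    simp only at h1
    have hr0' := hr.1
    have h2 : c ≤ r^k * ‖r * g r - k * f r‖ := by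
      have := neg_abs_le (r * g r - k * f r)
      rw [Real.norm_eq_abs]
      have h4 : r^k * (-|r * g r - k * f r|) ≤ r^k * (r * g r - k * f r) := by gcongr
      linarith
    have h3 : r^k ≤ r := by
      calc r^k ≤ r^1 := pow_le_pow_of_le_one hr0'.le hr1 hk
        _ = r := pow_one r
    have h5 : c ≤ r * ‖r * g r - k * f r‖ := h2.trans (by gcongr)
    rw [← div_eq_mul_inv, div_le_iff₀ hr0']
    linarith
  have hm : 0 < min 1 r₀ := lt_min one_pos hr0
  have hsub2 : Set.Ioc 0 (min 1 r₀) ⊆ Set.Ioo (0:ℝ) 100 := fun x hx =>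
    hsub ⟨hx.1, hx.2.trans (min_le_right _ _)⟩
  have hi2 : IntegrableOn (fun r : ℝ => c * r⁻¹) (Set.Ioc 0 (min 1 r₀)) := by
    refine Integrable.mono' (hIntg.mono_set hsub2).norm ?_ ?_
    · exact (measurable_inv.const_mul c).aestronglyMeasurable
    · filter_upwards [ae_restrict_mem measurableSet_Ioc] with r hr
      have := hlow r hr
      have h0 := hr.1
      rw [Real.norm_of_nonneg (by positivity)]
      exact this
  have hi3 : IntervalIntegrable (fun r : ℝ => r⁻¹) volume 0 (min 1 r₀) := by
    rw [intervalIntegrable_iff, Set.uIoc_of_le hm.le]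
    have := hi2.const_mul c⁻¹
    refine this.congr ?_
    filter_upwards with r
    field_simp
  rw [intervalIntegrable_inv_iff] at hi3
  rcases hi3 with h | h
  · linarith
  · exact h (by simp)

lemma ode_k_zero (k : ℕ) (hk : 1 ≤ k) (f g : ℝ → ℝ)
    (hfg : ∀ r ∈ Set.Ioo (0:ℝ) 100, HasDerivAt f (g r) r)
    (hI : ∀ r ∈ Set.Ioo (0:ℝ) 100,
      IntervalIntegrable (fun τ => ((k:ℝ)^2/τ+τ) * f τ) volume r 100)
    (hW : ∀ r ∈ Set.Ioo (0:ℝ) 100, r * g r = -∫ τ in r..100, ((k:ℝ)^2/τ+τ) * f τ)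
    (hb : ∃ C, ∀ r ∈ Set.Ico (50:ℝ) 100, |f r| ≤ C)
    (hIntg : IntegrableOn (fun r => r * g r - k * f r) (Set.Ioo 0 100)) :
    ∀ r ∈ Set.Ioo (0:ℝ) 100, f r = 0 := by
  intro r hr
  apply le_antisymm (ode_k_nonpos k hk f g hfg hI hW hb hIntg r hr)
  have := ode_k_nonpos k hk (fun x => - f x) (fun x => - g x)
    (fun r hr => (hfg r hr).neg)
    (fun r hr => by
      have := (hI r hr).neg
      convert! this using 1
      ext x; simp)
    (fun r hr => by
      have := hW r hr
      simp only [mul_neg, intervalIntegral.integral_neg]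
      rw [this])
    (by obtain ⟨C, hC⟩ := hb; exact ⟨C, by simpa using hC⟩)
    (by
      refine hIntg.neg.congr ?_
      filter_upwards with x
      simp; ring) r hr
  linarith

/-- the `k = 0` mode -/
lemma ode_zero (f g : ℝ → ℝ) (m : ℝ) (hm : 0 < m)
    (hfg : ∀ r ∈ Set.Ioo (0:ℝ) 100, HasDerivAt f (g r) r)
    (hI : IntegrableOn (fun τ => τ * f τ) (Set.Ioo 0 100))
    (hW : ∀ r ∈ Set.Ioo (0:ℝ) 100, r * g r = -∫ τ in r..100, τ * f τ)
    (hb : ∃ C, ∀ r ∈ Set.Ico (50:ℝ) 100, |f r| ≤ C)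
    (hM : ∫ τ in (0:ℝ)..100, τ * f τ = m) :
    (∀ r ∈ Set.Ioo (0:ℝ) 100, 0 ≤ f r) ∧
    (∀ r ∈ Set.Ioo (0:ℝ) 100, r * g r ≤ 0 ∧ -m ≤ r * g r) ∧
    (∀ r ∈ Set.Ioo (0:ℝ) 100, r^2 * f r ≤ 2 * m) ∧
    (∀ r ∈ Set.Ioo (0:ℝ) 100, HasDerivAt (fun r => r * g r) (r * f r) r) ∧
    Filter.Tendsto (fun r => r * g r) (nhdsWithin 0 (Set.Ioi 0)) (nhds (-m)) := by
  have hII : IntervalIntegrable (fun τ => τ * f τ) volume 0 100 := by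
    rw [intervalIntegrable_iff, Set.uIoc_of_le (by norm_num), integrableOn_Ioc_iff_integrableOn_Ioo]
    exact hI
  have hsubI : ∀ a ∈ Set.Icc (0:ℝ) 100, ∀ b ∈ Set.Icc (0:ℝ) 100,
      IntervalIntegrable (fun τ => τ * f τ) volume a b := by
    intro a ha b hb
    apply hII.mono_set
    rw [Set.uIcc_of_le (by norm_num : (0:ℝ) ≤ 100)]
    exact Set.uIcc_subset_Icc ha hb
  have hI' : ∀ r ∈ Set.Ioo (0:ℝ) 100,
      IntervalIntegrable (fun τ => (0/τ+τ) * f τ) volume r 100 := by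
    intro r hr
    simpa using hsubI r ⟨hr.1.le, hr.2.le⟩ 100 (by simp)
  have hW' : ∀ r ∈ Set.Ioo (0:ℝ) 100, r * g r = -∫ τ in r..100, (0/τ+τ) * f τ := by
    simpa using hW
  have hp : ∀ r ∈ Set.Ioo (0:ℝ) 100, HasDerivAt (fun r => r * g r) (r * f r) r := by
    simpa using ode_flux_deriv 0 f g hfg hI' hW'
  have hE := ode_energy 0 le_rfl f g hfg hI' hW' hb
  have hfn : ∀ r ∈ Set.Ioo (0:ℝ) 100, 0 ≤ f r := by
    -- if negative somewhere, then f ≤ 0 everywhere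
    intro r₀ hr₀
    by_contra hneg
    push Not at hneg
    have hnonpos : ∀ r ∈ Set.Ioo (0:ℝ) 100, f r ≤ 0 := by
      intro r hr
      by_contra h
      push Not at h
      rcases le_total r r₀ with hle | hle
      · have := ode_pos_left (fun x => - f x) (fun x => - g x) (fun r hr => (hfg r hr).neg)
          (fun r hr => by have := hE r hr; simpa using this) hr₀ (by simpa using hneg) r ⟨hr.1, hle⟩
        simp at this
        linarith
      · have := ode_pos_left f g hfg hE hr h r₀ ⟨hr₀.1, hle⟩
        linarith
    have : ∫ τ in (0:ℝ)..100, τ * f τ ≤ 0 := by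
      rw [intervalIntegral.integral_of_le (by norm_num), integral_Ioc_eq_integral_Ioo]
      apply setIntegral_nonpos measurableSet_Ioo
      intro x hx
      exact mul_nonpos_of_nonneg_of_nonpos hx.1.le (hnonpos x hx)
    linarith
  have hnn : ∀ a ∈ Set.Icc (0:ℝ) 100, ∀ b ∈ Set.Icc (0:ℝ) 100, a ≤ b →
      0 ≤ ∫ τ in a..b, τ * f τ := by
    intro a ha b hb hab
    rw [intervalIntegral.integral_of_le hab, integral_Ioc_eq_integral_Ioo]
    apply setIntegral_nonneg measurableSet_Ioo
    intro x hx
    have h0 : 0 < x := lt_of_le_of_lt ha.1 hx.1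
    exact mul_nonneg h0.le (hfn x ⟨h0, lt_of_lt_of_le hx.2 hb.2⟩)
  have hsplit : ∀ r ∈ Set.Ioo (0:ℝ) 100,
      (∫ τ in (0:ℝ)..r, τ * f τ) + (∫ τ in r..100, τ * f τ) = m := by
    intro r hr
    rw [← hM]
    exact intervalIntegral.integral_add_adjacent_intervals
      (hsubI 0 (by simp) r ⟨hr.1.le, hr.2.le⟩) (hsubI r ⟨hr.1.le, hr.2.le⟩ 100 (by simp))
  refine ⟨hfn, ?_, ?_, hp, ?_⟩
  · intro r hr
    have h1 := hW r hr
    have h2 := hsplit r hr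
    have h3 := hnn 0 (by simp) r ⟨hr.1.le, hr.2.le⟩ hr.1.le
    have h4 := hnn r ⟨hr.1.le, hr.2.le⟩ 100 (by simp) hr.2.le
    constructor <;> linarith
  · intro r hr
    have h2 := hsplit r hr
    have h4 := hnn r ⟨hr.1.le, hr.2.le⟩ 100 (by simp) hr.2.le
    have h5 : ∫ τ in (0:ℝ)..r, τ * f r ≤ ∫ τ in (0:ℝ)..r, τ * f τ := by
      apply intervalIntegral.integral_mono_on_of_le_Ioo hr.1.le
      · exact (continuous_id.mul continuous_const).intervalIntegrable _ _
      · exact hsubI 0 (by simp) r ⟨hr.1.le, hr.2.le⟩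
      · intro x hx
        have : f r ≤ f x := by
          rcases (hfn r hr).lt_or_eq with h | h
          · exact ode_pos_left f g hfg hE hr h x ⟨hx.1, hx.2.le⟩
          · rw [← h]; exact hfn x ⟨hx.1, hx.2.trans hr.2⟩
        have h0 := hx.1
        gcongr
    have h6 : ∫ τ in (0:ℝ)..r, τ * f r = r^2/2 * f r := by
      rw [intervalIntegral.integral_mul_const, integral_id]; ring
    rw [h6] at h5
    linarith
  · have hcont : ContinuousOn (fun x => ∫ τ in (0:ℝ)..x, τ * f τ) (Set.uIcc 0 100) := by
      apply intervalIntegral.continuousOn_primitive_interval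
      rw [Set.uIcc_of_le (by norm_num), integrableOn_Icc_iff_integrableOn_Ioo]
      exact hI
    have h1 := hcont 0 (by simp)
    rw [Set.uIcc_of_le (by norm_num)] at h1
    have h2 : Filter.Tendsto (fun x => ∫ τ in (0:ℝ)..x, τ * f τ)
        (nhdsWithin 0 (Set.Ioi 0)) (nhds 0) := by
      have := h1.tendsto
      simp only [intervalIntegral.integral_same] at this
      refine this.mono_left ?_
      rw [nhdsWithin_le_iff]
      have : Set.Ioo (0:ℝ) 100 ∈ nhdsWithin (0:ℝ) (Set.Ioi 0) := Ioo_mem_nhdsGT (by norm_num)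
      exact Filter.mem_of_superset this Set.Ioo_subset_Icc_self
    have h3 := h2.sub_const m
    rw [zero_sub] at h3
    refine h3.congr' ?_
    have : Set.Ioo (0:ℝ) 100 ∈ nhdsWithin (0:ℝ) (Set.Ioi 0) := Ioo_mem_nhdsGT (by norm_num)
    filter_upwards [this] with x hx
    rw [hW x hx]
    linarith [hsplit x hx]

end AG

namespace AG

def cis (θ : ℝ) : ℂ := Complex.exp (θ * Complex.I)

lemma cis_eq (θ : ℝ) : cis θ = Real.cos θ + Real.sin θ * Complex.I := by
  simp [cis, Complex.exp_mul_I]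

@[simp] lemma norm_cis (θ : ℝ) : ‖cis θ‖ = 1 := Complex.norm_exp_ofReal_mul_I θ

lemma hasDerivAt_cis (θ : ℝ) : HasDerivAt cis (Complex.I * cis θ) θ := by
  have h1 : HasDerivAt (fun θ : ℝ => (θ:ℂ) * Complex.I) (1 * Complex.I) θ :=
    (Complex.ofRealCLM.hasDerivAt).mul_const _
  have := h1.cexp
  unfold cis
  convert! this using 1
  ring

lemma continuous_cis : Continuous cis := by unfold cis; fun_prop

lemma cis_pi : cis Real.pi = cis (-Real.pi) := by
  rw [cis_eq, cis_eq]; simp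

/-- the punctured open disk -/
def pD : Set ℂ := ball 0 100 \ {0}

lemma isOpen_pD : IsOpen pD := isOpen_ball.sdiff isClosed_singleton

lemma mem_pD {r : ℝ} (hr : r ∈ Set.Ioo (0:ℝ) 100) (θ : ℝ) : (r:ℂ) * cis θ ∈ pD := by
  have h1 : ‖(r:ℂ) * cis θ‖ = r := by simp [abs_of_pos hr.1]
  constructor
  · rw [mem_ball_zero_iff, h1]; exact hr.2
  · intro h
    rw [Set.mem_singleton_iff] at h
    rw [h, norm_zero] at h1
    exact absurd h1.symm (ne_of_gt hr.1)

lemma continuous_polar : Continuous (fun p : ℝ × ℝ => (p.1:ℂ) * cis p.2) := by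
  have := continuous_cis
  fun_prop

lemma polar_cont {F : ℂ → ℝ} (hF : ContinuousOn F pD) :
    ContinuousOn (fun p : ℝ × ℝ => F (p.1 * cis p.2)) (Set.Ioo 0 100 ×ˢ Set.univ) :=
  hF.comp continuous_polar.continuousOn (fun p hp => mem_pD hp.1 p.2)

lemma polar_integral {F : ℂ → ℝ} (hF : ContinuousOn F pD) (hFi : IntegrableOn F (ball 0 100)) :
    IntegrableOn (fun p : ℝ × ℝ => p.1 * F (p.1 * cis p.2))
      (Set.Ioo 0 100 ×ˢ Set.Ioo (-Real.pi) Real.pi) ∧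
    ∫ y in ball 0 100, F y = ∫ r in Set.Ioo (0:ℝ) 100, ∫ θ in Set.Ioo (-Real.pi) Real.pi,
      r * F (r * cis θ) := by
  have hsymm : ∀ p : ℝ × ℝ, Complex.polarCoord.symm p = p.1 * cis p.2 := by
    intro p; rw [Complex.polarCoord_symm_apply, cis_eq]
  have hmem : ∀ p ∈ polarCoord.target, ((p.1:ℂ) * cis p.2 ∈ ball (0:ℂ) 100 ↔ p.1 < 100) := by
    intro p hp
    have : 0 < p.1 := hp.1
    simp [abs_of_pos this]
  have hset : polarCoord.target ∩ {p : ℝ × ℝ | p.1 < 100} =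
      Set.Ioo 0 100 ×ˢ Set.Ioo (-Real.pi) Real.pi := by
    ext p; simp [polarCoord_target]; tauto
  have hms : MeasurableSet {p : ℝ × ℝ | p.1 < 100} := measurableSet_lt measurable_fst measurable_const
  have hmt : MeasurableSet polarCoord.target := polarCoord.open_target.measurableSet
  have hmp : MeasurableSet (Set.Ioo (0:ℝ) 100 ×ˢ Set.Ioo (-Real.pi) Real.pi) :=
    measurableSet_Ioo.prod measurableSet_Ioo
  have hIntg : IntegrableOn (fun p : ℝ × ℝ => p.1 * F (p.1 * cis p.2))
      (Set.Ioo 0 100 ×ˢ Set.Ioo (-Real.pi) Real.pi) := by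
    constructor
    · apply ContinuousOn.aestronglyMeasurable _ hmp
      exact continuous_fst.continuousOn.mul
        ((polar_cont hF).mono (Set.prod_mono le_rfl (Set.subset_univ _)))
    · have h1 := hFi.2
      have h2 := Complex.lintegral_comp_polarCoord_symm
        ((ball (0:ℂ) 100).indicator (fun y => ‖F y‖ₑ))
      rw [lintegral_indicator measurableSet_ball] at h2
      rw [HasFiniteIntegral, ← h2] at h1
      refine lt_of_le_of_lt ?_ h1
      rw [← hset]
      rw [Set.inter_comm, ← setLIntegral_indicator hms]
      refine setLIntegral_mono' hmt ?_
      intro p hp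
      rw [hsymm]
      by_cases hp2 : p.1 < 100
      · rw [Set.indicator_of_mem (show p ∈ {p : ℝ × ℝ | p.1 < 100} from hp2),
          Set.indicator_of_mem ((hmem p hp).2 hp2), enorm_mul, smul_eq_mul]
        rw [Real.enorm_of_nonneg (le_of_lt hp.1)]
      · rw [Set.indicator_of_notMem (show p ∉ {p : ℝ × ℝ | p.1 < 100} from hp2)]
        exact zero_le
  refine ⟨hIntg, ?_⟩
  have h3 := Complex.integral_comp_polarCoord_symm ((ball (0:ℂ) 100).indicator F)
  rw [integral_indicator measurableSet_ball] at h3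
  rw [← h3]
  have h4 : ∫ p in polarCoord.target, p.1 • (ball (0:ℂ) 100).indicator F (Complex.polarCoord.symm p)
      = ∫ p in Set.Ioo (0:ℝ) 100 ×ˢ Set.Ioo (-Real.pi) Real.pi, p.1 * F (p.1 * cis p.2) := by
    rw [← hset, Set.inter_comm, ← Measure.restrict_restrict hms, ← integral_indicator hms]
    refine setIntegral_congr_fun hmt ?_
    intro p hp
    simp only [hsymm, smul_eq_mul]
    by_cases hp2 : p.1 < 100
    · rw [Set.indicator_of_mem (show p ∈ {p : ℝ × ℝ | p.1 < 100} from hp2),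
          Set.indicator_of_mem ((hmem p hp).2 hp2)]
    · rw [Set.indicator_of_notMem (show p ∉ {p : ℝ × ℝ | p.1 < 100} from hp2),
        Set.indicator_of_notMem (fun h => hp2 ((hmem p hp).1 h)), mul_zero]
  rw [h4]
  rw [Measure.volume_eq_prod, setIntegral_prod _ (by rw [← Measure.volume_eq_prod]; exact hIntg)]

lemma param_cont {Φ : ℝ → ℝ → ℝ}
    (h : ContinuousOn (fun p : ℝ × ℝ => Φ p.1 p.2) (Set.Ioo 0 100 ×ˢ Set.univ)) (a b : ℝ) :
    ContinuousOn (fun r => ∫ θ in a..b, Φ r θ) (Set.Ioo 0 100) := by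
  rw [continuousOn_iff_continuous_domRestrict]
  have : Continuous (Function.uncurry (fun (x : Set.Ioo (0:ℝ) 100) θ => Φ x θ)) := by
    have h2 : Continuous (fun q : Set.Ioo (0:ℝ) 100 × ℝ => ((q.1:ℝ), q.2)) := by fun_prop
    exact h.comp_continuous h2 (fun q => ⟨q.1.2, Set.mem_univ _⟩)
  exact intervalIntegral.continuous_parametric_intervalIntegral_of_continuous' this a b

lemma slice_cont {Φ : ℝ → ℝ → ℝ}
    (h : ContinuousOn (fun p : ℝ × ℝ => Φ p.1 p.2) (Set.Ioo 0 100 ×ˢ Set.univ))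
    {r : ℝ} (hr : r ∈ Set.Ioo (0:ℝ) 100) : Continuous (Φ r) :=
  h.comp_continuous (by fun_prop : Continuous (fun θ : ℝ => (r, θ))) (fun _ => ⟨hr, Set.mem_univ _⟩)

lemma param_deriv {Φ Φ' : ℝ → ℝ → ℝ}
    (h : ContinuousOn (fun p : ℝ × ℝ => Φ p.1 p.2) (Set.Ioo 0 100 ×ˢ Set.univ))
    (h' : ContinuousOn (fun p : ℝ × ℝ => Φ' p.1 p.2) (Set.Ioo 0 100 ×ˢ Set.univ))
    (hd : ∀ r ∈ Set.Ioo (0:ℝ) 100, ∀ θ, HasDerivAt (fun r => Φ r θ) (Φ' r θ) r) (a b : ℝ) :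
    ∀ r ∈ Set.Ioo (0:ℝ) 100,
      HasDerivAt (fun r => ∫ θ in a..b, Φ r θ) (∫ θ in a..b, Φ' r θ) r := by
  intro r hr
  obtain ⟨ε, hε, hball⟩ := Metric.isOpen_iff.1 isOpen_Ioo r hr
  have hsub : closedBall r (ε/2) ⊆ Set.Ioo (0:ℝ) 100 :=
    (closedBall_subset_ball (by linarith)).trans hball
  have hK : IsCompact (closedBall r (ε/2) ×ˢ Set.uIcc a b) :=
    (isCompact_closedBall _ _).prod isCompact_uIcc
  obtain ⟨C, hC⟩ := hK.exists_bound_of_continuousOn (h'.mono (Set.prod_mono hsub (Set.subset_univ _)))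
  refine (intervalIntegral.hasDerivAt_integral_of_dominated_loc_of_deriv_le
    (bound := fun _ => C) (s := closedBall r (ε/2)) (closedBall_mem_nhds _ (by linarith)) ?_ ?_ ?_ ?_ ?_ ?_).2
  · filter_upwards [isOpen_Ioo.mem_nhds hr] with x hx
    exact (slice_cont h hx).aestronglyMeasurable
  · exact (slice_cont h hr).intervalIntegrable _ _
  · exact (slice_cont h' hr).aestronglyMeasurable
  · filter_upwards with t ht x hx
    exact hC (x, t) ⟨hx, Set.uIoc_subset_uIcc ht⟩
  · exact intervalIntegrable_const
  · filter_upwards with t ht x hx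
    exact hd x (hsub hx) t

end AG

namespace AG

def mC (a : ℂ) (k : ℕ) (θ : ℝ) : ℝ := (a * cis θ ^ k).re
def mS (a : ℂ) (k : ℕ) (θ : ℝ) : ℝ := (a * cis θ ^ k).im

lemma hasDerivAt_mode (a : ℂ) (k : ℕ) (θ : ℝ) :
    HasDerivAt (fun θ => a * cis θ ^ k) (k * Complex.I * (a * cis θ ^ k)) θ := by
  have h := ((hasDerivAt_cis θ).fun_pow k).const_mul a
  convert! h using 1
  rcases k with _ | k
  · simp
  · simp only [Nat.add_sub_cancel, pow_succ]; push_cast; ring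

lemma hasDerivAt_mC (a : ℂ) (k : ℕ) (θ : ℝ) : HasDerivAt (mC a k) (-k * mS a k θ) θ := by
  have h := (Complex.reCLM.hasFDerivAt).comp_hasDerivAt θ (hasDerivAt_mode a k θ)
  convert! h using 1
  simp [mS, Complex.mul_re, Complex.mul_im]

lemma hasDerivAt_mS (a : ℂ) (k : ℕ) (θ : ℝ) : HasDerivAt (mS a k) (k * mC a k θ) θ := by
  have h := (Complex.imCLM.hasFDerivAt).comp_hasDerivAt θ (hasDerivAt_mode a k θ)
  convert! h using 1
  simp [mC, Complex.mul_re, Complex.mul_im]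

lemma continuous_mC (a : ℂ) (k : ℕ) : Continuous (mC a k) := by
  have := continuous_cis
  unfold mC; fun_prop
lemma continuous_mS (a : ℂ) (k : ℕ) : Continuous (mS a k) := by
  have := continuous_cis
  unfold mS; fun_prop
lemma abs_mC_le (a : ℂ) (k : ℕ) (θ : ℝ) : |mC a k θ| ≤ ‖a‖ := by
  refine (Complex.abs_re_le_norm _).trans ?_
  simp
lemma abs_mS_le (a : ℂ) (k : ℕ) (θ : ℝ) : |mS a k θ| ≤ ‖a‖ := by
  refine (Complex.abs_im_le_norm _).trans ?_
  simp
lemma mS_pi (a : ℂ) (k : ℕ) : mS a k Real.pi = mS a k (-Real.pi) := by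
  unfold mS; rw [cis_pi]

/-- standing hypotheses on the planar Green function -/
structure Green (u : ℂ → ℝ) (m0 : ℝ) : Prop where
  smooth : ContDiffOn ℝ (⊤ : ℕ∞) u pD
  int0 : IntegrableOn u (ball 0 100)
  int1 : IntegrableOn (fun y => fderiv ℝ u y 1) (ball 0 100)
  intI : IntegrableOn (fun y => fderiv ℝ u y Complex.I) (ball 0 100)
  bdd : ∃ C, ∀ y ∈ ball (0:ℂ) 100, 50 ≤ ‖y‖ → |u y| ≤ C
  weak : ∀ ψ : ℂ → ℝ, ContDiff ℝ (⊤ : ℕ∞) ψ →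
    ∫ y in ball 0 100, (fderiv ℝ u y 1 * fderiv ℝ ψ y 1 +
      fderiv ℝ u y Complex.I * fderiv ℝ ψ y Complex.I + u y * ψ y) = m0 * ψ 0

lemma mode_int {F : ℂ → ℝ} (hF : ContinuousOn F pD) (hFi : IntegrableOn F (ball 0 100))
    {b : ℝ → ℝ} (hb : Continuous b) {B : ℝ} (hB : ∀ θ, |b θ| ≤ B) :
    IntegrableOn (fun r : ℝ => ∫ θ in (-Real.pi)..Real.pi, r * F (r * cis θ) * b θ) (Set.Ioo 0 100) := by
  have h1 := (polar_integral hF hFi).1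
  have h2 : IntegrableOn (fun p : ℝ × ℝ => p.1 * F (p.1 * cis p.2) * b p.2)
      (Set.Ioo 0 100 ×ˢ Set.Ioo (-Real.pi) Real.pi) := by
    refine Integrable.mul_bdd (c := B) h1 ?_ ?_
    · exact (hb.comp continuous_snd).aestronglyMeasurable
    · exact Filter.Eventually.of_forall (fun p => hB p.2)
  rw [IntegrableOn, Measure.volume_eq_prod, ← Measure.prod_restrict] at h2
  have h3 := h2.integral_prod_left
  refine h3.congr (Filter.Eventually.of_forall ?_)
  intro r
  simp only []
  rw [intervalIntegral.integral_of_le (by linarith [Real.pi_pos]), integral_Ioc_eq_integral_Ioo]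

variable {u : ℂ → ℝ} {m0 : ℝ}

def dR (u : ℂ → ℝ) (y e : ℂ) : ℝ := fderiv ℝ u y e

lemma dR_cis (y : ℂ) (θ : ℝ) : fderiv ℝ u y (cis θ) =
    Real.cos θ * fderiv ℝ u y 1 + Real.sin θ * fderiv ℝ u y Complex.I := by
  have : cis θ = Real.cos θ • (1:ℂ) + Real.sin θ • Complex.I := by
    rw [cis_eq]; simp
  rw [this, map_add, map_smul, map_smul]; simp

lemma dR_Icis (y : ℂ) (θ : ℝ) : fderiv ℝ u y (Complex.I * cis θ) =
    -Real.sin θ * fderiv ℝ u y 1 + Real.cos θ * fderiv ℝ u y Complex.I := by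
  have : Complex.I * cis θ = (-Real.sin θ) • (1:ℂ) + Real.cos θ • Complex.I := by
    rw [cis_eq]; apply Complex.ext <;> simp
  rw [this, map_add, map_smul, map_smul]; simp

namespace Green

lemma diffAt (h : Green u m0) {y : ℂ} (hy : y ∈ pD) : DifferentiableAt ℝ u y :=
  (h.smooth.contDiffAt (isOpen_pD.mem_nhds hy)).differentiableAt (by simp)

lemma contD (h : Green u m0) (e : ℂ) : ContinuousOn (fun y => fderiv ℝ u y e) pD := by
  have := (h.smooth.continuousOn_fderiv_of_isOpen isOpen_pD (by simp))
  exact this.clm_apply continuousOn_const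

def f (_h : Green u m0) (a : ℂ) (k : ℕ) (r : ℝ) : ℝ :=
  ∫ θ in (-Real.pi)..Real.pi, u (r * cis θ) * mC a k θ
def g (_h : Green u m0) (a : ℂ) (k : ℕ) (r : ℝ) : ℝ :=
  ∫ θ in (-Real.pi)..Real.pi, fderiv ℝ u (r * cis θ) (cis θ) * mC a k θ

lemma snd_cont {b : ℝ → ℝ} (hb : Continuous b) :
  ContinuousOn (fun p : ℝ × ℝ => b p.2) (Set.Ioo 0 100 ×ˢ Set.univ) :=
  (hb.comp continuous_snd).continuousOn

lemma contu (h : Green u m0) : ContinuousOn u pD := h.smooth.continuousOn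

lemma cont_rad (h : Green u m0) : ContinuousOn (fun p : ℝ × ℝ => fderiv ℝ u (p.1 * cis p.2) (cis p.2))
    (Set.Ioo 0 100 ×ˢ Set.univ) := by
  simp_rw [dR_cis]
  exact ((snd_cont Real.continuous_cos).mul (polar_cont (h.contD 1))).add
    ((snd_cont Real.continuous_sin).mul (polar_cont (h.contD Complex.I)))

lemma cont_ang (h : Green u m0) : ContinuousOn (fun p : ℝ × ℝ => fderiv ℝ u (p.1 * cis p.2) (Complex.I * cis p.2))
    (Set.Ioo 0 100 ×ˢ Set.univ) := by
  simp_rw [dR_Icis]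
  exact ((snd_cont Real.continuous_sin.neg).mul (polar_cont (h.contD 1))).add
    ((snd_cont Real.continuous_cos).mul (polar_cont (h.contD Complex.I)))

lemma deriv_rad (h : Green u m0) {r : ℝ} (hr : r ∈ Set.Ioo (0:ℝ) 100) (θ : ℝ) :
    HasDerivAt (fun r : ℝ => u (r * cis θ)) (fderiv ℝ u (r * cis θ) (cis θ)) r := by
  have h1 : HasDerivAt (fun r : ℝ => (r:ℂ) * cis θ) (1 * cis θ) r :=
    (Complex.ofRealCLM.hasDerivAt).mul_const _
  rw [one_mul] at h1
  exact (h.diffAt (mem_pD hr θ)).hasFDerivAt.comp_hasDerivAt r h1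

lemma deriv_ang (h : Green u m0) {r : ℝ} (hr : r ∈ Set.Ioo (0:ℝ) 100) (θ : ℝ) :
    HasDerivAt (fun θ : ℝ => u (r * cis θ)) (r * fderiv ℝ u (r * cis θ) (Complex.I * cis θ)) θ := by
  have h1 : HasDerivAt (fun θ : ℝ => (r:ℂ) * cis θ) (r * (Complex.I * cis θ)) θ :=
    (hasDerivAt_cis θ).const_mul _
  have := (h.diffAt (mem_pD hr θ)).hasFDerivAt.comp_hasDerivAt θ h1
  convert! this using 1
  have : (r:ℂ) * (Complex.I * cis θ) = r • (Complex.I * cis θ) := by simp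
  rw [this, map_smul]; simp

lemma f_deriv (h : Green u m0) (a : ℂ) (k : ℕ) : ∀ r ∈ Set.Ioo (0:ℝ) 100, HasDerivAt (h.f a k) (h.g a k r) r := by
  apply param_deriv (Φ := fun r θ => u (r * cis θ) * mC a k θ)
    (Φ' := fun r θ => fderiv ℝ u (r * cis θ) (cis θ) * mC a k θ)
  · exact (polar_cont h.contu).mul (snd_cont (continuous_mC a k))
  · exact h.cont_rad.mul (snd_cont (continuous_mC a k))
  · intro r hr θ
    exact (h.deriv_rad hr θ).mul_const _

lemma g_cont (h : Green u m0) (a : ℂ) (k : ℕ) : ContinuousOn (h.g a k) (Set.Ioo 0 100) :=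
  param_cont (Φ := fun r θ => fderiv ℝ u (r * cis θ) (cis θ) * mC a k θ)
    (h.cont_rad.mul (snd_cont (continuous_mC a k))) _ _

lemma f_cont (h : Green u m0) (a : ℂ) (k : ℕ) : ContinuousOn (h.f a k) (Set.Ioo 0 100) :=
  fun r hr => (h.f_deriv a k r hr).continuousAt.continuousWithinAt

lemma ang_ibp (h : Green u m0) (a : ℂ) (k : ℕ) {r : ℝ} (hr : r ∈ Set.Ioo (0:ℝ) 100) :
    ∫ θ in (-Real.pi)..Real.pi, r * fderiv ℝ u (r * cis θ) (Complex.I * cis θ) * mS a k θ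
      = -k * h.f a k r := by
  have := intervalIntegral.integral_deriv_mul_eq_sub (a := -Real.pi) (b := Real.pi)
    (u := fun θ : ℝ => u (r * cis θ)) (v := mS a k)
    (u' := fun θ => r * fderiv ℝ u (r * cis θ) (Complex.I * cis θ)) (v' := fun θ => k * mC a k θ)
    (fun θ _ => h.deriv_ang hr θ) (fun θ _ => hasDerivAt_mS a k θ)
    ((continuous_const.mul (slice_cont (Φ := fun r θ => fderiv ℝ u (r * cis θ) (Complex.I * cis θ))
      h.cont_ang hr)).intervalIntegrable _ _)
    ((continuous_const.mul (continuous_mC a k)).intervalIntegrable _ _)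
  rw [intervalIntegral.integral_add] at this
  · rw [mS_pi, cis_pi, sub_self] at this
    rw [eq_neg_of_add_eq_zero_left this, Green.f, ← intervalIntegral.integral_neg,
      ← intervalIntegral.integral_const_mul]
    congr 1; ext θ; ring
  · exact ((continuous_const.mul (slice_cont (Φ := fun r θ => fderiv ℝ u (r * cis θ) (Complex.I * cis θ))
      h.cont_ang hr)).mul (continuous_mS a k)).intervalIntegrable _ _
  · exact ((slice_cont (Φ := fun r θ => u (r * cis θ)) (polar_cont h.contu) hr).mul
      (continuous_const.mul (continuous_mC a k))).intervalIntegrable _ _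

lemma int_rf (h : Green u m0) (a : ℂ) (k : ℕ) : IntegrableOn (fun r => r * h.f a k r) (Set.Ioo 0 100) := by
  refine (mode_int h.contu h.int0 (continuous_mC a k) (abs_mC_le a k)).congr
    (Filter.Eventually.of_forall ?_)
  intro r
  simp only [Green.f]
  rw [← intervalIntegral.integral_const_mul]
  congr 1; ext θ; ring

lemma abs_mul_le_of {x y B : ℝ} (hx : |x| ≤ 1) (hy : |y| ≤ B) : |x * y| ≤ B := by
  rw [abs_mul]
  calc |x| * |y| ≤ 1 * |y| := by gcongr
    _ ≤ B := by simpa using hy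

lemma int_rg (h : Green u m0) (a : ℂ) (k : ℕ) : IntegrableOn (fun r => r * h.g a k r) (Set.Ioo 0 100) := by
  have h1 := mode_int (h.contD 1) h.int1 (Real.continuous_cos.mul (continuous_mC a k))
    (fun θ => abs_mul_le_of (Real.abs_cos_le_one θ) (abs_mC_le a k θ))
  have h2 := mode_int (h.contD Complex.I) h.intI (Real.continuous_sin.mul (continuous_mC a k))
    (fun θ => abs_mul_le_of (Real.abs_sin_le_one θ) (abs_mC_le a k θ))
  refine (h1.add h2).congr_fun ?_ measurableSet_Ioo
  intro r hr
  simp only [Pi.add_apply, Green.g]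
  rw [← intervalIntegral.integral_const_mul, ← intervalIntegral.integral_add]
  · congr 1; ext θ; rw [dR_cis, Pi.mul_apply, Pi.mul_apply]; ring
  · exact ((continuous_const.mul (slice_cont (Φ := fun r θ => fderiv ℝ u (r * cis θ) 1)
      (polar_cont (h.contD 1)) hr)).mul
      (Real.continuous_cos.mul (continuous_mC a k))).intervalIntegrable _ _
  · exact ((continuous_const.mul (slice_cont (Φ := fun r θ => fderiv ℝ u (r * cis θ) Complex.I)
      (polar_cont (h.contD _)) hr)).mul
      (Real.continuous_sin.mul (continuous_mC a k))).intervalIntegrable _ _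

lemma int_kf (h : Green u m0) (a : ℂ) (k : ℕ) : IntegrableOn (fun r => k * h.f a k r) (Set.Ioo 0 100) := by
  have h1 := mode_int (h.contD 1) h.int1 (Real.continuous_sin.mul (continuous_mS a k))
    (fun θ => abs_mul_le_of (Real.abs_sin_le_one θ) (abs_mS_le a k θ))
  have h2 := mode_int (h.contD Complex.I) h.intI (Real.continuous_cos.mul (continuous_mS a k))
    (fun θ => abs_mul_le_of (Real.abs_cos_le_one θ) (abs_mS_le a k θ))
  refine (h1.sub h2).congr_fun ?_ measurableSet_Ioo
  intro r hr
  simp only [Pi.sub_apply]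
  have := h.ang_ibp a k hr
  have h3 : (k:ℝ) * h.f a k r = -(-k * h.f a k r) := by ring
  rw [h3, ← this, ← intervalIntegral.integral_neg, ← intervalIntegral.integral_sub]
  · congr 1; ext θ; rw [dR_Icis, Pi.mul_apply, Pi.mul_apply]; ring
  · exact ((continuous_const.mul (slice_cont (Φ := fun r θ => fderiv ℝ u (r * cis θ) 1)
      (polar_cont (h.contD 1)) hr)).mul
      (Real.continuous_sin.mul (continuous_mS a k))).intervalIntegrable _ _
  · exact ((continuous_const.mul (slice_cont (Φ := fun r θ => fderiv ℝ u (r * cis θ) Complex.I)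
      (polar_cont (h.contD _)) hr)).mul
      (Real.continuous_cos.mul (continuous_mS a k))).intervalIntegrable _ _

lemma f_bdd (h : Green u m0) (a : ℂ) (k : ℕ) : ∃ C, ∀ r ∈ Set.Ico (50:ℝ) 100, |h.f a k r| ≤ C := by
  obtain ⟨C, hC⟩ := h.bdd
  refine ⟨C * ‖a‖ * |Real.pi - -Real.pi|, fun r hr => ?_⟩
  rw [Green.f, ← Real.norm_eq_abs]
  refine intervalIntegral.norm_integral_le_of_norm_le_const ?_
  intro θ _
  have hn : ‖(r:ℂ) * cis θ‖ = r := by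
    simp [abs_of_nonneg (by linarith [hr.1] : (0:ℝ) ≤ r)]
  have := hC (r * cis θ) (by rw [mem_ball_zero_iff, hn]; exact hr.2) (by rw [hn]; exact hr.1)
  rw [Real.norm_eq_abs, abs_mul]
  exact mul_le_mul this (abs_mC_le a k θ) (abs_nonneg _) ((abs_nonneg _).trans this)

end Green
end AG

namespace AG

variable {u : ℂ → ℝ} {m0 : ℝ}

lemma rot_inv (A B : ℂ →L[ℝ] ℝ) (θ : ℝ) : A 1 * B 1 + A Complex.I * B Complex.I =
    A (cis θ) * B (cis θ) + A (Complex.I * cis θ) * B (Complex.I * cis θ) := by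
  have h1 : cis θ = Real.cos θ • (1:ℂ) + Real.sin θ • Complex.I := by
    rw [cis_eq]; simp
  have h2 : Complex.I * cis θ = (-Real.sin θ) • (1:ℂ) + Real.cos θ • Complex.I := by
    rw [cis_eq]; apply Complex.ext <;> simp
  rw [h1] at *
  rw [h2]
  simp only [map_add, map_smul, smul_eq_mul]
  have := Real.sin_sq_add_cos_sq θ
  linear_combination (-(A 1 * B 1) - A Complex.I * B Complex.I) * this

namespace Green

lemma weak_polar (h : Green u m0) (a : ℂ) (k : ℕ) (Ψ : ℂ → ℝ) (hΨ : ContDiff ℝ (⊤ : ℕ∞) Ψ)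
    (p p' : ℝ → ℝ)
    (h0 : ∀ r ∈ Set.Ioo (0:ℝ) 100, ∀ θ, Ψ (r * cis θ) = p r * mC a k θ)
    (h1 : ∀ r ∈ Set.Ioo (0:ℝ) 100, ∀ θ, fderiv ℝ Ψ (r * cis θ) (cis θ) = p' r * mC a k θ)
    (h2 : ∀ r ∈ Set.Ioo (0:ℝ) 100, ∀ θ, r * fderiv ℝ Ψ (r * cis θ) (Complex.I * cis θ)
      = p r * (-k * mS a k θ)) :
    ∫ r in Set.Ioo (0:ℝ) 100, (p' r * (r * h.g a k r) + ((k:ℝ)^2 / r + r) * h.f a k r * p r)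
      = m0 * Ψ 0 := by
  have hDc : ∀ e, Continuous (fun y => fderiv ℝ Ψ y e) := fun e =>
    (hΨ.continuous_fderiv (by simp)).clm_apply continuous_const
  have hbd : ∀ {F : ℂ → ℝ}, Continuous F → ∃ C, ∀ y ∈ ball (0:ℂ) 100, ‖F y‖ ≤ C := by
    intro F hF
    obtain ⟨C, hC⟩ := (isCompact_closedBall (0:ℂ) 100).exists_bound_of_continuousOn hF.continuousOn
    exact ⟨C, fun y hy => hC y (ball_subset_closedBall hy)⟩
  have hmul : ∀ {F G : ℂ → ℝ}, IntegrableOn F (ball 0 100) → Continuous G →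
      IntegrableOn (fun y => F y * G y) (ball 0 100) := by
    intro F G hF hG
    obtain ⟨C, hC⟩ := hbd hG
    refine Integrable.mul_bdd (c := C) hF hG.aestronglyMeasurable ?_
    filter_upwards [ae_restrict_mem measurableSet_ball] with y hy using hC y hy
  have hw := h.weak Ψ hΨ
  have hFc : ContinuousOn (fun y => fderiv ℝ u y 1 * fderiv ℝ Ψ y 1 +
      fderiv ℝ u y Complex.I * fderiv ℝ Ψ y Complex.I + u y * Ψ y) pD :=
    (((h.contD 1).mul (hDc 1).continuousOn).add ((h.contD _).mul (hDc _).continuousOn)).add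
      (h.contu.mul hΨ.continuous.continuousOn)
  have hFi : IntegrableOn (fun y => fderiv ℝ u y 1 * fderiv ℝ Ψ y 1 +
      fderiv ℝ u y Complex.I * fderiv ℝ Ψ y Complex.I + u y * Ψ y) (ball 0 100) :=
    ((hmul h.int1 (hDc 1)).add (hmul h.intI (hDc _))).add (hmul h.int0 hΨ.continuous)
  rw [(polar_integral hFc hFi).2] at hw
  rw [← hw]
  refine setIntegral_congr_fun measurableSet_Ioo ?_
  intro r hr
  simp only []
  rw [← integral_Ioc_eq_integral_Ioo, ← intervalIntegral.integral_of_le (by linarith [Real.pi_pos])]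
  have hr0 : r ≠ 0 := hr.1.ne'
  have e1 : ∀ θ, r * (fderiv ℝ u (r * cis θ) 1 * fderiv ℝ Ψ (r * cis θ) 1 +
      fderiv ℝ u (r * cis θ) Complex.I * fderiv ℝ Ψ (r * cis θ) Complex.I +
        u (r * cis θ) * Ψ (r * cis θ)) =
      (p' r * r) * (fderiv ℝ u (r * cis θ) (cis θ) * mC a k θ) +
      (-k * p r / r) * (r * fderiv ℝ u (r * cis θ) (Complex.I * cis θ) * mS a k θ) +
      (r * p r) * (u (r * cis θ) * mC a k θ) := by
    intro θ
    rw [rot_inv _ _ θ, h0 r hr, h1 r hr]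
    have := h2 r hr θ
    have h3 : fderiv ℝ Ψ (r * cis θ) (Complex.I * cis θ) = p r * (-k * mS a k θ) / r := by
      rw [← this]; field_simp
    rw [h3]; field_simp
  simp_rw [e1]
  have c1 := (slice_cont (Φ := fun r θ => fderiv ℝ u (r * cis θ) (cis θ)) h.cont_rad hr).mul
    (continuous_mC a k)
  have c2 := (continuous_const (y := r)).mul (slice_cont (Φ := fun r θ => fderiv ℝ u (r * cis θ) (Complex.I * cis θ))
      h.cont_ang hr) |>.mul (continuous_mS a k)
  have c3 := (slice_cont (Φ := fun r θ => u (r * cis θ)) (polar_cont h.contu) hr).mul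
      (continuous_mC a k)
  rw [intervalIntegral.integral_add, intervalIntegral.integral_add,
    intervalIntegral.integral_const_mul, intervalIntegral.integral_const_mul,
    intervalIntegral.integral_const_mul, h.ang_ibp a k hr]
  · simp only [Green.f, Green.g]
    field_simp
    ring
  · exact (continuous_const.mul c1).intervalIntegrable _ _
  · exact (continuous_const.mul c2).intervalIntegrable _ _
  · exact ((continuous_const.mul c1).add (continuous_const.mul c2)).intervalIntegrable _ _
  · exact (continuous_const.mul c3).intervalIntegrable _ _

lemma mass (h : Green u m0) : ∫ r in Set.Ioo (0:ℝ) 100, r * h.f 1 0 r = m0 := by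
  have := h.weak_polar 1 0 (fun _ => 1) contDiff_const (fun _ => 1) (fun _ => 0)
    (by intros; simp [mC]) (by intros; simp) (by intros; simp)
  simpa using this

lemma weak_mode (h : Green u m0) (a : ℂ) (k : ℕ) (ψ : ℝ → ℝ) (hψ : ContDiff ℝ (⊤ : ℕ∞) ψ)
    {δ : ℝ} (hδ : 0 < δ) (hψ0 : ∀ r < δ, ψ r = 0) :
    ∫ r in Set.Ioo (0:ℝ) 100, (deriv ψ r * (r * h.g a k r) + ((k:ℝ)^2 / r + r) * h.f a k r * ψ r)
      = 0 := by
  let Ψ : ℂ → ℝ := fun y => ψ ‖y‖ * (a * (y / (‖y‖ : ℂ)) ^ k).re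
  have hΨ : ContDiff ℝ (⊤ : ℕ∞) Ψ := by
    rw [contDiff_iff_contDiffAt]
    intro y
    by_cases hy : y = 0
    · have : Ψ =ᶠ[nhds y] fun _ => 0 := by
        rw [hy]
        filter_upwards [ball_mem_nhds (0:ℂ) hδ] with z hz
        rw [mem_ball_zero_iff] at hz
        simp [Ψ, hψ0 _ hz]
      exact contDiffAt_const.congr_of_eventuallyEq this
    · have hn : ContDiffAt ℝ (⊤ : ℕ∞) (fun y : ℂ => ‖y‖) y := contDiffAt_norm ℝ hy
      have hnC : ContDiffAt ℝ (⊤ : ℕ∞) (fun y : ℂ => (‖y‖ : ℂ)) y :=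
        Complex.ofRealCLM.contDiff.contDiffAt.comp y hn
      have hq : ContDiffAt ℝ (⊤ : ℕ∞) (fun y : ℂ => y / (‖y‖ : ℂ)) y :=
        by
        simp only [div_eq_mul_inv]
        exact contDiffAt_id.mul (hnC.inv (by simpa using hy))
      have hm : ContDiffAt ℝ (⊤ : ℕ∞) (fun y : ℂ => (a * (y / (‖y‖ : ℂ)) ^ k).re) y :=
        Complex.reCLM.contDiff.contDiffAt.comp y (contDiffAt_const.mul (hq.pow k))
      exact (hψ.contDiffAt.comp y hn).mul hm
  have hval : ∀ r : ℝ, 0 < r → ∀ θ : ℝ, Ψ (r * cis θ) = ψ r * mC a k θ := by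
    intro r hr θ
    have hn : ‖(r:ℂ) * cis θ‖ = r := by simp [abs_of_pos hr]
    have hr' : (r:ℂ) ≠ 0 := by exact_mod_cast hr.ne'
    simp only [Ψ, hn, mC]
    rw [mul_div_cancel_left₀ _ hr']
  have hdiff : Differentiable ℝ Ψ := hΨ.differentiable (by simp)
  have := h.weak_polar a k Ψ hΨ ψ (deriv ψ) (fun r hr θ => hval r hr.1 θ) ?_ ?_
  · rw [this]; simp [Ψ, hψ0 0 hδ]
  · intro r hr θ
    have h1 : HasDerivAt (fun r : ℝ => (r:ℂ) * cis θ) (1 * cis θ) r :=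
      (Complex.ofRealCLM.hasDerivAt).mul_const _
    rw [one_mul] at h1
    have h2 := (hdiff (r * cis θ)).hasFDerivAt.comp_hasDerivAt r h1
    have h3 : HasDerivAt (fun r => ψ r * mC a k θ) (deriv ψ r * mC a k θ) r :=
      ((hψ.differentiable (by simp)) r).hasDerivAt.mul_const _
    refine h2.unique (h3.congr_of_eventuallyEq ?_)
    filter_upwards [isOpen_Ioo.mem_nhds hr] with s hs using hval s hs.1 θ
  · intro r hr θ
    have h1 : HasDerivAt (fun θ : ℝ => (r:ℂ) * cis θ) (r * (Complex.I * cis θ)) θ :=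
      (hasDerivAt_cis θ).const_mul _
    have h2 := (hdiff (r * cis θ)).hasFDerivAt.comp_hasDerivAt θ h1
    have h4 : (r:ℂ) * (Complex.I * cis θ) = r • (Complex.I * cis θ) := by simp
    rw [h4, map_smul] at h2
    have h3 := (hasDerivAt_mC a k θ).const_mul (ψ r)
    refine h2.unique (h3.congr_of_eventuallyEq ?_)
    filter_upwards with s using hval r hr.1 s

end Green
end AG

namespace AG

lemma dbr (G p : ℝ → ℝ) (hG : ContinuousOn G (Set.Ioo 0 100)) (hp : ContinuousOn p (Set.Ioo 0 100))
    (hI : ∀ r ∈ Set.Ioo (0:ℝ) 100, IntervalIntegrable p volume r 100)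
    (hw : ∀ ψ : ℝ → ℝ, ContDiff ℝ (⊤ : ℕ∞) ψ → ∀ δ > 0, (∀ r < δ, ψ r = 0) →
      ∫ r in Set.Ioo (0:ℝ) 100, (deriv ψ r * G r + p r * ψ r) = 0) :
    ∀ r ∈ Set.Ioo (0:ℝ) 100, G r = - ∫ τ in r..100, p τ := by
  set P : ℝ → ℝ := fun r => ∫ τ in r..100, p τ with hP
  have hPd : ∀ r ∈ Set.Ioo (0:ℝ) 100, HasDerivAt P (-p r) r := by
    intro r hr
    exact intervalIntegral.integral_hasDerivAt_left (hI r hr)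
      (hp.stronglyMeasurableAtFilter isOpen_Ioo r hr) (hp.continuousAt (isOpen_Ioo.mem_nhds hr))
  have hPc : ContinuousOn P (Set.Ioo 0 100) := fun r hr => (hPd r hr).continuousAt.continuousWithinAt
  have hWc : ContinuousOn (fun r => G r + P r) (Set.Ioo 0 100) := hG.add hPc
  have key : ∀ᵐ x : ℝ, x ∈ Set.Ioo (0:ℝ) 100 → (fun r => G r + P r) x = 0 := by
    apply isOpen_Ioo.ae_eq_zero_of_integral_contDiff_smul_eq_zero
    · exact hWc.locallyIntegrableOn measurableSet_Ioo
    intro h hh hc hs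
    -- support in [a,b]
    obtain ⟨a, b, ha, hab, hb, hsub⟩ : ∃ a b : ℝ, 0 < a ∧ a ≤ b ∧ b < 100 ∧
        tsupport h ⊆ Set.Icc a b := by
      rcases (tsupport h).eq_empty_or_nonempty with he | hne
      · exact ⟨1, 1, by norm_num, le_rfl, by norm_num, by rw [he]; exact Set.empty_subset _⟩
      · have hcK : IsCompact (tsupport h) := hc
        have h1 := hcK.sInf_mem hne
        have h2 := hcK.sSup_mem hne
        refine ⟨sInf (tsupport h), sSup (tsupport h), (hs h1).1, csInf_le hcK.bddBelow h2,
          (hs h2).2, fun x hx => ⟨csInf_le hcK.bddBelow hx, le_csSup hcK.bddAbove hx⟩⟩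
    have hz : ∀ x, x ∉ Set.Icc a b → h x = 0 := fun x hx =>
      image_eq_zero_of_notMem_tsupport (fun hx2 => hx (hsub hx2))
    set ψ : ℝ → ℝ := fun r => ∫ τ in a..r, h τ with hψ
    have hhc : Continuous h := hh.continuous
    have hψd : ∀ r, HasDerivAt ψ (h r) r := fun r =>
      intervalIntegral.integral_hasDerivAt_right (hhc.intervalIntegrable _ _)
        (hhc.stronglyMeasurableAtFilter _ _) hhc.continuousAt
    have hψder : deriv ψ = h := funext fun r => (hψd r).deriv
    have hψs : ContDiff ℝ (⊤ : ℕ∞) ψ := by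
      apply contDiff_infty_iff_deriv.2
      exact ⟨fun r => (hψd r).differentiableAt, by rw [hψder]; exact hh⟩
    have hψa : ∀ r ≤ a, ψ r = 0 := by
      intro r hr
      rw [hψ]
      have : ∫ τ in a..r, h τ = ∫ τ in a..r, (0:ℝ) := by
        rw [intervalIntegral.integral_symm, intervalIntegral.integral_symm r a]
        congr 1
        apply intervalIntegral.integral_congr_ae
        have : ∀ᵐ x : ℝ, x ≠ a := by simp [ae_iff]
        filter_upwards [this] with x hx hx2
        rw [Set.uIoc_of_le hr] at hx2
        exact hz x (fun h3 => hx (le_antisymm hx2.2 h3.1))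
      simpa using this
    have hψb : ∀ r, b ≤ r → ψ r = ψ b := by
      intro r hr
      have h1 : ψ r = ψ b + ∫ τ in b..r, h τ :=
        (intervalIntegral.integral_add_adjacent_intervals
          (hhc.intervalIntegrable _ _) (hhc.intervalIntegrable _ _)).symm
      have h2 : ∫ τ in b..r, h τ = ∫ τ in b..r, (0:ℝ) := by
        apply intervalIntegral.integral_congr_ae
        filter_upwards with x hx2
        rw [Set.uIoc_of_le hr] at hx2
        exact hz x (fun h3 => not_lt.2 h3.2 hx2.1)
      rw [h1, h2]; simp
    have hw1 := hw ψ hψs a ha (fun r hr => hψa r hr.le)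
    rw [hψder] at hw1
    have hab1 : Set.Icc a b ⊆ Set.Ioo 0 100 := fun x hx => ⟨ha.trans_le hx.1, hx.2.trans_lt hb⟩
    have haI : a ∈ Set.Ioo (0:ℝ) 100 := hab1 ⟨le_rfl, hab⟩
    have hbI : b ∈ Set.Ioo (0:ℝ) 100 := hab1 ⟨hab, le_rfl⟩
    have hsplit : ∫ r in Set.Ioo (0:ℝ) 100, (h r * G r + p r * ψ r)
        = ∫ r in a..100, (h r * G r + p r * ψ r) := by
      rw [intervalIntegral.integral_of_le haI.2.le, integral_Ioc_eq_integral_Ioo]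
      refine setIntegral_eq_of_subset_of_ae_sdiff_eq_zero measurableSet_Ioo.nullMeasurableSet
        (Set.Ioo_subset_Ioo_left ha.le) ?_
      have : ∀ᵐ x : ℝ, x ≠ a := by simp [ae_iff]
      filter_upwards [this] with x hx hx2
      have hxa : x ≤ a := by
        by_contra h3
        exact hx2.2 ⟨not_le.1 h3, hx2.1.2⟩
      rw [hψa x hxa, hz x (fun h3 => hx (le_antisymm hxa h3.1))]; ring
    have hpab : IntervalIntegrable p volume a b := by
      refine ContinuousOn.intervalIntegrable ?_
      rw [Set.uIcc_of_le hab]; exact hp.mono hab1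
    have hGab : IntervalIntegrable (fun r => h r * G r) volume a b := by
      refine ContinuousOn.intervalIntegrable ?_
      rw [Set.uIcc_of_le hab]; exact hhc.continuousOn.mul (hG.mono hab1)
    have hψc : Continuous ψ := hψs.continuous
    have hpψab : IntervalIntegrable (fun r => p r * ψ r) volume a b :=
      hpab.mul_continuousOn hψc.continuousOn
    have hpψb : IntervalIntegrable (fun r => p r * ψ r) volume b 100 :=
      (hI b hbI).mul_continuousOn hψc.continuousOn
    have hb2 : ∀ x ∈ Set.uIoc b 100, h x * G x + p x * ψ x = p x * ψ b := by
      intro x hx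
      rw [Set.uIoc_of_le hbI.2.le] at hx
      rw [hz x (fun h3 => not_lt.2 h3.2 hx.1), hψb x hx.1.le]; ring
    have hint2 : IntervalIntegrable (fun r => h r * G r + p r * ψ r) volume b 100 := by
      refine ((hI b hbI).mul_const (ψ b)).congr ?_
      intro x hx
      exact (hb2 x hx).symm
    have e1 : ∫ r in a..100, (h r * G r + p r * ψ r) =
        (∫ r in a..b, h r * G r) + (∫ r in a..b, p r * ψ r) + P b * ψ b := by
      rw [← intervalIntegral.integral_add_adjacent_intervals (hGab.add hpψab) hint2,
        intervalIntegral.integral_add hGab hpψab]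
      congr 1
      rw [hP, ← intervalIntegral.integral_mul_const]
      apply intervalIntegral.integral_congr_ae
      filter_upwards with x hx using hb2 x hx
    have e2 := intervalIntegral.integral_mul_deriv_eq_deriv_mul (a := a) (b := b) (u := P) (v := ψ)
      (u' := fun r => - p r) (v' := h)
      (fun x hx => hPd x (hab1 (by rwa [Set.uIcc_of_le hab] at hx))) (fun x _ => hψd x)
      hpab.neg (hhc.intervalIntegrable _ _)
    have e3 : ∫ r in a..b, -p r * ψ r = - ∫ r in a..b, p r * ψ r := by
      rw [← intervalIntegral.integral_neg]; congr 1; ext x; ring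
    rw [e3, hψa a le_rfl] at e2
    have hPh : IntervalIntegrable (fun r => P r * h r) volume a b := by
      refine ContinuousOn.intervalIntegrable ?_
      rw [Set.uIcc_of_le hab]; exact (hPc.mono hab1).mul hhc.continuousOn
    have e4 : ∫ x, h x • (G x + P x) = ∫ x in a..b, (h x * G x + P x * h x) := by
      rw [intervalIntegral.integral_of_le hab, ← integral_Icc_eq_integral_Ioc]
      rw [← setIntegral_eq_integral_of_forall_compl_eq_zero (s := Set.Icc a b)]
      · refine setIntegral_congr_fun measurableSet_Icc ?_
        intro x _
        simp only [smul_eq_mul]; ring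
      · intro x hx; rw [hz x hx]; simp
    rw [e4, intervalIntegral.integral_add hGab hPh, e2]
    rw [hsplit, e1] at hw1
    linarith
  have := Measure.eqOn_open_of_ae_eq (μ := (volume : Measure ℝ)) (U := Set.Ioo (0:ℝ) 100)
    (f := fun r => G r + P r) (g := fun _ => 0)
    (by
      rw [Filter.EventuallyEq, ae_restrict_iff' measurableSet_Ioo]
      exact key) isOpen_Ioo hWc continuousOn_const
  intro r hr
  have := this hr
  simp only [] at this
  linarith

lemma mS_eq (k : ℕ) (θ : ℝ) : mS 1 k θ = mC (-Complex.I) k θ := by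
  simp [mS, mC]

lemma fourier_const (w : ℝ → ℝ) (hw : Continuous w) (hper : Function.Periodic w (2 * Real.pi))
    (hz : ∀ k : ℕ, 1 ≤ k → ∀ a, ∫ θ in (-Real.pi)..Real.pi, w θ * mC a k θ = 0) (θ : ℝ) :
    w θ = (1 / (2 * Real.pi)) * ∫ θ in (-Real.pi)..Real.pi, w θ := by
  have : Fact (0 < 2 * Real.pi) := ⟨by positivity⟩
  have hperC : Function.Periodic (fun x => (w x : ℂ)) (2 * Real.pi) := fun x => by simp [hper x]
  let F : C(AddCircle (2 * Real.pi), ℂ) := ⟨hperC.lift, by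
    apply continuous_coinduced_dom.2
    exact Complex.continuous_ofReal.comp hw⟩
  have hF : ∀ x : ℝ, F x = w x := fun x => rfl
  have hco : ∀ n : ℤ, n ≠ 0 → fourierCoeff F n = 0 := by
    intro n hn
    rw [fourierCoeff_eq_intervalIntegral _ _ (-Real.pi)]
    obtain ⟨s, hs⟩ : ∃ s : ℝ, ∀ x : ℝ, (fourier (-n) (x : AddCircle (2 * Real.pi)) : ℂ) =
        mC 1 n.natAbs x + s * mC (-Complex.I) n.natAbs x * Complex.I := by
      have hc : ∀ (j : ℤ) (x : ℝ), (fourier j (x : AddCircle (2 * Real.pi)) : ℂ) = cis x ^ j := by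
        intro j x
        rw [fourier_coe_apply, cis, ← Complex.exp_int_mul]
        congr 1
        have : (Real.pi : ℂ) ≠ 0 := by exact_mod_cast Real.pi_ne_zero
        push_cast
        field_simp
      have hre : ∀ (k : ℕ) (x : ℝ), (cis x ^ k : ℂ) = mC 1 k x + mC (-Complex.I) k x * Complex.I := by
        intro k x
        apply Complex.ext <;> simp [mC]
      have hinv : ∀ (k : ℕ) (x : ℝ), (cis x ^ k : ℂ)⁻¹ = mC 1 k x - mC (-Complex.I) k x * Complex.I := by
        intro k x
        rw [Complex.inv_def, Complex.normSq_eq_norm_sq]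
        simp only [norm_pow, norm_cis, one_pow, inv_one, Complex.ofReal_one, mul_one]
        generalize hq : cis x ^ k = q
        apply Complex.ext <;> simp [mC, hq]
      rcases Int.natAbs_eq n with h | h
      · refine ⟨-1, fun x => ?_⟩
        rw [hc, show -n = -(n.natAbs : ℤ) by rw [← h], zpow_neg, zpow_natCast, hinv]
        push_cast; ring
      · refine ⟨1, fun x => ?_⟩
        rw [hc, show -n = (n.natAbs : ℤ) by omega, zpow_natCast, hre]; push_cast; ring
    have hk : 1 ≤ n.natAbs := Int.natAbs_pos.2 hn
    have e : ∀ x : ℝ, (fourier (-n) (x : AddCircle (2 * Real.pi)) : ℂ) • F x =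
        ((w x * mC 1 n.natAbs x : ℝ) : ℂ) + ((w x * mC (-Complex.I) n.natAbs x : ℝ) : ℂ) * (s * Complex.I) := by
      intro x
      rw [hs, hF, smul_eq_mul]; push_cast; ring
    simp_rw [e]
    rw [show -Real.pi + 2 * Real.pi = Real.pi by ring]
    rw [intervalIntegral.integral_add, intervalIntegral.integral_mul_const,
      intervalIntegral.integral_ofReal, intervalIntegral.integral_ofReal, hz _ hk, hz _ hk]
    · simp
    · exact (Complex.continuous_ofReal.comp (hw.mul (continuous_mC _ _))).intervalIntegrable _ _
    · exact ((Complex.continuous_ofReal.comp (hw.mul (continuous_mC _ _))).mul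
        continuous_const).intervalIntegrable _ _
  have hsum : Summable (fourierCoeff F) :=
    summable_of_ne_finset_zero (s := {0}) (fun b hb => hco b (by simpa using hb))
  have h1 := has_pointwise_sum_fourier_series_of_summable hsum (θ : AddCircle (2 * Real.pi))
  have h2 : HasSum (fun i => fourierCoeff F i • (fourier i (θ : AddCircle (2 * Real.pi)) : ℂ))
      (fourierCoeff F 0 • (fourier 0 (θ : AddCircle (2 * Real.pi)) : ℂ)) :=
    hasSum_single 0 (fun b hb => by rw [hco b hb, zero_smul])
  have h3 := h1.unique h2
  rw [hF, fourierCoeff_eq_intervalIntegral _ _ (-Real.pi)] at h3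
  rw [show -Real.pi + 2 * Real.pi = Real.pi by ring] at h3
  simp only [hF, neg_zero, fourier_zero, smul_eq_mul, one_mul, mul_one,
    intervalIntegral.integral_ofReal] at h3
  apply Complex.ofReal_injective
  rw [h3]; simp

namespace Green
variable {u : ℂ → ℝ} {m0 : ℝ}

lemma hII (h : Green u m0) (a : ℂ) (k : ℕ) : ∀ r ∈ Set.Ioo (0:ℝ) 100,
    IntervalIntegrable (fun τ => ((k:ℝ)^2/τ+τ) * h.f a k τ) volume r 100 := by
  intro r hr
  have h1 : IntervalIntegrable (fun τ => τ * h.f a k τ) volume r 100 := by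
    rw [intervalIntegrable_iff, Set.uIoc_of_le hr.2.le, integrableOn_Ioc_iff_integrableOn_Ioo]
    exact (h.int_rf a k).mono_set (Set.Ioo_subset_Ioo_left hr.1.le)
  have h2 : ContinuousOn (fun τ : ℝ => (k:ℝ)^2/τ^2 + 1) (Set.uIcc r 100) := by
    rw [Set.uIcc_of_le hr.2.le]
    intro x hx
    have : x ≠ 0 := (hr.1.trans_le hx.1).ne'
    apply ContinuousAt.continuousWithinAt
    fun_prop (disch := positivity)
  refine (h1.mul_continuousOn h2).congr ?_
  intro x hx
  rw [Set.uIoc_of_le hr.2.le] at hx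
  have : x ≠ 0 := (hr.1.trans hx.1).ne'
  simp only []
  field_simp

lemma flux (h : Green u m0) (a : ℂ) (k : ℕ) : ∀ r ∈ Set.Ioo (0:ℝ) 100,
    r * h.g a k r = -∫ τ in r..100, ((k:ℝ)^2/τ+τ) * h.f a k τ := by
  apply dbr (fun r => r * h.g a k r) (fun τ => ((k:ℝ)^2/τ+τ) * h.f a k τ)
  · exact continuousOn_id.mul (h.g_cont a k)
  · refine ContinuousOn.mul ?_ (h.f_cont a k)
    intro x hx
    have : x ≠ 0 := hx.1.ne'
    apply ContinuousAt.continuousWithinAt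
    fun_prop (disch := positivity)
  · exact h.hII a k
  · intro ψ hψ δ hδ h0
    exact h.weak_mode a k ψ hψ hδ h0

lemma mode_zero (h : Green u m0) (a : ℂ) (k : ℕ) (hk : 1 ≤ k) :
    ∀ r ∈ Set.Ioo (0:ℝ) 100, h.f a k r = 0 :=
  ode_k_zero k hk _ _ (h.f_deriv a k) (h.hII a k) (h.flux a k) (h.f_bdd a k)
    ((h.int_rg a k).sub (h.int_kf a k))

lemma radial (h : Green u m0) : ∀ r ∈ Set.Ioo (0:ℝ) 100, ∀ θ,
    u (r * cis θ) = (1 / (2 * Real.pi)) * h.f 1 0 r := by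
  intro r hr θ
  have := fourier_const (fun θ => u (r * cis θ))
    (slice_cont (Φ := fun r θ => u (r * cis θ)) (polar_cont h.contu) hr)
    (fun x => by
      have : cis (x + 2 * Real.pi) = cis x := by
        rw [cis_eq, cis_eq]; simp
      simp [this])
    (fun k hk a => h.mode_zero a k hk r hr) θ
  rw [this, Green.f]
  simp [mC]

end Green
end AG

namespace AG

/-- Properties of the radial profile (as a function of the squared distance). -/
structure QF (q q1 q2 : ℝ → ℝ) (m : ℝ) : Prop where
  mpos : 0 < m
  d0 : ∀ s ∈ Set.Ioo (0:ℝ) 10000, HasDerivAt q (q1 s) s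
  d1 : ∀ s ∈ Set.Ioo (0:ℝ) 10000, HasDerivAt q1 (q2 s) s
  eqn : ∀ s ∈ Set.Ioo (0:ℝ) 10000, 4 * (s * q2 s + q1 s) = q s
  nonneg : ∀ s ∈ Set.Ioo (0:ℝ) 10000, 0 ≤ q s
  b1 : ∀ s ∈ Set.Ioo (0:ℝ) 10000, |s * q1 s| ≤ m
  b0 : ∀ s ∈ Set.Ioo (0:ℝ) 10000, s * q s ≤ 4 * m
  b2 : ∀ s ∈ Set.Ioo (0:ℝ) 10000, |s ^ 2 * q2 s| ≤ 2 * m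
  b0' : ∀ s ∈ Set.Ioo (0:ℝ) 10000, √s * q s ≤ 6 * m
  lim : Filter.Tendsto (fun s => s * q1 s) (nhdsWithin 0 (Set.Ioi 0)) (nhds (-m))

lemma Green.profile {u : ℂ → ℝ} {m0 : ℝ} (h : Green u m0) (hm : 0 < m0) :
    ∃ q q1 q2 : ℝ → ℝ, QF q q1 q2 (m0 / (4 * Real.pi)) ∧
      ∀ y : ℂ, 0 < ‖y‖ → ‖y‖ < 100 → u y = q (‖y‖ ^ 2) := by
  have hpi := Real.pi_pos
  have hII : ∀ r ∈ Set.Ioo (0:ℝ) 100, r * h.g 1 0 r = -∫ τ in r..100, τ * h.f 1 0 τ := by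
    intro r hr
    have := h.flux 1 0 r hr
    simpa using this
  have hM : ∫ τ in (0:ℝ)..100, τ * h.f 1 0 τ = m0 := by
    rw [intervalIntegral.integral_of_le (by norm_num), integral_Ioc_eq_integral_Ioo]
    exact h.mass
  obtain ⟨f0, hg, hf2, hfl, hlim⟩ := ode_zero (h.f 1 0) (h.g 1 0) m0 hm (h.f_deriv 1 0)
    (h.int_rf 1 0) hII (h.f_bdd 1 0) hM
  set f := h.f 1 0 with hf
  set g := h.g 1 0 with hg'
  set c := 1 / (2 * Real.pi) with hc
  have hc0 : 0 < c := by positivity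
  have hmc : m0 / (4 * Real.pi) = c * m0 / 2 := by rw [hc]; field_simp; norm_num
  rw [hmc]
  set m := c * m0 / 2 with hmdef
  have hm' : 0 < m := by positivity
  let q : ℝ → ℝ := fun s => c * f √s
  let q1 : ℝ → ℝ := fun s => c * (√s * g √s) / (2 * s)
  let q2 : ℝ → ℝ := fun s => (q s / 4 - q1 s) / s
  have hsq : ∀ s ∈ Set.Ioo (0:ℝ) 10000, √s ∈ Set.Ioo (0:ℝ) 100 := by
    intro s hs
    refine ⟨Real.sqrt_pos.2 hs.1, ?_⟩
    rw [Real.sqrt_lt' (by norm_num)]; linarith [hs.2]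
  have hd0 : ∀ s ∈ Set.Ioo (0:ℝ) 10000, HasDerivAt q (q1 s) s := by
    intro s hs
    have h1 := ((h.f_deriv 1 0 √s (hsq s hs)).comp s (Real.hasDerivAt_sqrt hs.1.ne')).const_mul c
    convert! h1 using 1
    have := (hsq s hs).1
    have h2 := Real.sq_sqrt hs.1.le
    have hs0 := hs.1
    simp only [q1]
    rw [hg']
    field_simp
    rw [h2]
    ring
  have hd1 : ∀ s ∈ Set.Ioo (0:ℝ) 10000, HasDerivAt q1 (q2 s) s := by
    intro s hs
    have h1 := ((hfl √s (hsq s hs)).comp s (Real.hasDerivAt_sqrt hs.1.ne')).const_mul c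
    have h2 := h1.fun_div ((hasDerivAt_id s).const_mul 2) (by simpa using hs.1.ne')
    convert! h2 using 1
    have := (hsq s hs).1
    have h3 := Real.sq_sqrt hs.1.le
    have hs0 := hs.1
    simp only [q2, q1, q, id, Function.comp]
    field_simp
    ring
  have hb1 : ∀ s ∈ Set.Ioo (0:ℝ) 10000, |s * q1 s| ≤ m := by
    intro s hs
    have h1 := hg √s (hsq s hs)
    have hs0 := hs.1
    have h2 : s * q1 s = c / 2 * (√s * g √s) := by simp only [q1]; field_simp
    rw [h2, abs_le]
    constructor
    · nlinarith [h1.2]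
    · nlinarith [h1.1]
  have hb0 : ∀ s ∈ Set.Ioo (0:ℝ) 10000, s * q s ≤ 4 * m := by
    intro s hs
    have h1 := hf2 √s (hsq s hs)
    rw [Real.sq_sqrt hs.1.le] at h1
    have : s * q s = c * (s * f √s) := by simp only [q]; ring
    rw [this]
    nlinarith
  have hn : ∀ s ∈ Set.Ioo (0:ℝ) 10000, 0 ≤ q s := fun s hs =>
    mul_nonneg hc0.le (f0 _ (hsq s hs))
  refine ⟨q, q1, q2, ⟨hm', hd0, hd1, ?_, hn, hb1, hb0, ?_, ?_, ?_⟩, ?_⟩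
  · intro s hs
    have := hs.1
    simp only [q2]; field_simp; ring
  · intro s hs
    have h1 : s ^ 2 * q2 s = s * q s / 4 - s * q1 s := by
      have := hs.1
      simp only [q2]; field_simp
    rw [h1]
    have h2 := hb0 s hs
    have h3 := abs_le.1 (hb1 s hs)
    have h4 := mul_nonneg hs.1.le (hn s hs)
    rw [abs_le]
    constructor <;> linarith
  · intro s hs
    have hs1 := (hsq s hs).1
    by_cases h1 : 1 ≤ s
    · have h2 : √s ≤ s := by
        rw [Real.sqrt_le_left (by linarith)]; nlinarith
      calc √s * q s ≤ s * q s := mul_le_mul_of_nonneg_right h2 (hn s hs)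
        _ ≤ 6 * m := by linarith [hb0 s hs]
    · push Not at h1
      have hmono : MonotoneOn (fun t => q t + m * Real.log t) (Set.Icc s 1) := by
        apply monotoneOn_of_deriv_nonneg (convex_Icc s 1)
        · intro t ht
          have ht' : t ∈ Set.Ioo (0:ℝ) 10000 := ⟨hs.1.trans_le ht.1, by linarith [ht.2]⟩
          exact ((hd0 t ht').add ((Real.hasDerivAt_log ht'.1.ne').const_mul m)).continuousAt.continuousWithinAt
        · intro t ht
          rw [interior_Icc] at ht
          have ht' : t ∈ Set.Ioo (0:ℝ) 10000 := ⟨hs.1.trans ht.1, by linarith [ht.2]⟩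
          exact ((hd0 t ht').add ((Real.hasDerivAt_log ht'.1.ne').const_mul m)).differentiableAt.differentiableWithinAt
        · intro t ht
          rw [interior_Icc] at ht
          have ht' : t ∈ Set.Ioo (0:ℝ) 10000 := ⟨hs.1.trans ht.1, by linarith [ht.2]⟩
          have hD : HasDerivAt (fun t => q t + m * Real.log t) (q1 t + m * t⁻¹) t :=
            (hd0 t ht').add ((Real.hasDerivAt_log ht'.1.ne').const_mul m)
          rw [hD.deriv]
          have h3 := (abs_le.1 (hb1 t ht')).1
          have ht0 := ht'.1
          have : q1 t + m * t⁻¹ = (t * q1 t + m) / t := by field_simp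
          rw [this]
          apply div_nonneg _ ht0.le
          linarith
      have h2 := hmono ⟨le_rfl, h1.le⟩ ⟨h1.le, le_rfl⟩ h1.le
      simp only [Real.log_one, mul_zero, add_zero] at h2
      have h3 := hb0 1 (by norm_num)
      rw [one_mul] at h3
      have h4 : Real.log s = -(2 * Real.log (√s)⁻¹) := by
        rw [Real.log_inv, Real.log_sqrt hs.1.le]; ring
      have h5 : Real.log (√s)⁻¹ ≤ (√s)⁻¹ := Real.log_le_self (by positivity)
      have h6 : √s ≤ 1 := by rw [Real.sqrt_le_left (by norm_num)]; linarith
      have h7 : q s ≤ 4 * m + m * (2 * (√s)⁻¹) := by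
        rw [h4] at h2
        nlinarith
      calc √s * q s ≤ √s * (4 * m + m * (2 * (√s)⁻¹)) := by gcongr
        _ = √s * (4 * m) + 2 * m := by field_simp
        _ ≤ 1 * (4 * m) + 2 * m := by gcongr
        _ = 6 * m := by ring
  · have h1 : Filter.Tendsto (fun s : ℝ => √s) (nhdsWithin 0 (Set.Ioi 0)) (nhdsWithin 0 (Set.Ioi 0)) := by
      apply tendsto_nhdsWithin_of_tendsto_nhds_of_eventually_within
      · have : Filter.Tendsto (fun s : ℝ => √s) (nhds 0) (nhds √0) := Real.continuous_sqrt.tendsto 0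
        rw [Real.sqrt_zero] at this
        exact this.mono_left nhdsWithin_le_nhds
      · filter_upwards [self_mem_nhdsWithin] with s hs using Real.sqrt_pos.2 hs
    have h2 := (hlim.comp h1).const_mul (c / 2)
    rw [show -m = c / 2 * -m0 by rw [hmdef]; ring]
    refine h2.congr' ?_
    filter_upwards [self_mem_nhdsWithin] with s hs
    have hs0 : 0 < s := hs
    simp only [Function.comp, q1]; field_simp
  · intro y hy0 hy1
    have := h.radial ‖y‖ ⟨hy0, hy1⟩ (Complex.arg y)
    rw [cis, Complex.norm_mul_exp_arg_mul_I] at this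
    rw [this]
    simp only [q]
    rw [Real.sqrt_sq hy0.le]

end AG

namespace AG

/-- `L` is a linear isometry of the model plane onto the orthogonal complement of `n`. -/
def IsFrame (n : E3) (L : ℂ →ₗᵢ[ℝ] E3) : Prop := ∀ x : E3, x ∈ (ℝ ∙ n)ᗮ ↔ ∃ y, L y = x

lemma exists_frame {n : E3} (hn : ‖n‖ = 1) : ∃ L, IsFrame n L := by
  have hn0 : n ≠ 0 := by
    intro h; rw [h, norm_zero] at hn; norm_num at hn
  have : Fact (Module.finrank ℝ E3 = 2 + 1) := ⟨by simp⟩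
  let e : ℂ ≃ₗᵢ[ℝ] ((ℝ ∙ n)ᗮ : Submodule ℝ E3) :=
    Complex.orthonormalBasisOneI.equiv (OrthonormalBasis.fromOrthogonalSpanSingleton 2 hn0)
      (Equiv.refl _)
  refine ⟨((ℝ ∙ n)ᗮ).subtypeₗᵢ.comp e.toLinearIsometry, fun x => ⟨fun hx => ?_, ?_⟩⟩
  · exact ⟨e.symm ⟨x, hx⟩, by simp⟩
  · rintro ⟨y, rfl⟩
    exact (e y).2

instance haarC : (μH[2] : Measure ℂ).IsAddHaarMeasure := by
  have := isAddHaarMeasure_hausdorffMeasure (E := ℂ)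
  rw [Complex.finrank_real_complex] at this
  exact_mod_cast this

/-- the measure of the unit disk -/
def Lam : ℝ := ((μH[2] : Measure ℂ) (ball 0 1)).toReal

lemma exists_kappa : ∃ κ : ℝ≥0∞, κ ≠ 0 ∧ κ ≠ ∞ ∧ (μH[2] : Measure ℂ) = κ • volume ∧
    Lam = κ.toReal * Real.pi := by
  set c := Measure.addHaarScalarFactor (μH[2] : Measure ℂ) (volume : Measure ℂ) with hc
  have h2 : (μH[2] : Measure ℂ) = (c : ℝ≥0∞) • volume :=
    Measure.isAddLeftInvariant_eq_smul (μH[2] : Measure ℂ) (volume : Measure ℂ)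
  have h0 : (c : ℝ≥0∞) ≠ 0 := by
    have := Measure.addHaarScalarFactor_pos_of_isAddHaarMeasure (μH[2] : Measure ℂ) (volume : Measure ℂ)
    exact_mod_cast this.ne'
  have h1 : (c : ℝ≥0∞) ≠ ∞ := ENNReal.coe_ne_top
  generalize (c : ℝ≥0∞) = κ at h0 h1 h2
  refine ⟨κ, h0, h1, h2, ?_⟩
  rw [Lam, h2, Measure.smul_apply, smul_eq_mul, ENNReal.toReal_mul]
  congr 1
  rw [Complex.volume_ball]; simp

lemma Lam_pos : 0 < Lam := by
  obtain ⟨κ, h0, h1, _, h3⟩ := exists_kappa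
  rw [h3]
  exact mul_pos (ENNReal.toReal_pos h0 h1) Real.pi_pos

section frame
variable {n : E3} {L : ℂ →ₗᵢ[ℝ] E3}

lemma IsFrame.inner_n (hL : IsFrame n L) (y : ℂ) : ⟪n, L y⟫ = 0 := by
  have := (hL (L y)).2 ⟨y, rfl⟩
  exact Submodule.mem_orthogonal_singleton_iff_inner_right.1 this

lemma IsFrame.proj (hL : IsFrame n L) (x : E3) :
    ∃ y, L y = (Submodule.orthogonalProjectionOnto (ℝ ∙ n)ᗮ x : E3) ∧ ∀ e, ⟪x, L e⟫ = ⟪y, e⟫ := by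
  obtain ⟨y, hy⟩ := (hL _).1 (Submodule.orthogonalProjectionOnto (ℝ ∙ n)ᗮ x).2
  refine ⟨y, hy, fun e => ?_⟩
  have h1 : L e ∈ (ℝ ∙ n)ᗮ := (hL _).2 ⟨e, rfl⟩
  rw [← L.inner_map_map y e, hy]
  have h2 := Submodule.inner_orthogonalProjectionOnto_eq_of_mem_right (K := (ℝ ∙ n)ᗮ) ⟨L e, h1⟩ x
  exact h2.symm

lemma inner_eq_dirs (a b : ℂ) : (⟪a, b⟫ : ℝ) = ⟪a, 1⟫ * ⟪b, 1⟫ + ⟪a, Complex.I⟫ * ⟪b, Complex.I⟫ := by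
  simp [Complex.inner]; ring

lemma tGrad_inner (hL : IsFrame n L) (A : Set E3) (f g : E3 → ℝ) (x : E3) :
    ⟪tGrad A (ℝ ∙ n)ᗮ f x, tGrad A (ℝ ∙ n)ᗮ g x⟫ =
      fderivWithin ℝ f A x (L 1) * fderivWithin ℝ g A x (L 1) +
      fderivWithin ℝ f A x (L Complex.I) * fderivWithin ℝ g A x (L Complex.I) := by
  unfold tGrad
  obtain ⟨a, ha, ha'⟩ := hL.proj ((InnerProductSpace.toDual ℝ E3).symm (fderivWithin ℝ f A x))
  obtain ⟨b, hb, hb'⟩ := hL.proj ((InnerProductSpace.toDual ℝ E3).symm (fderivWithin ℝ g A x))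
  rw [← ha, ← hb, L.inner_map_map, inner_eq_dirs, ← ha', ← ha', ← hb', ← hb']
  simp only [InnerProductSpace.toDual_symm_apply]

end frame

section transfer
variable {Srf : SmoothSurface} {z₀ : E3} {L : ℂ →ₗᵢ[ℝ] E3}

lemma isoJ (z₀ : E3) (L : ℂ →ₗᵢ[ℝ] E3) : Isometry (fun y => z₀ + L y) :=
  (IsometryEquiv.addLeft z₀).isometry.comp L.isometry

lemma mem_disk (hL : IsFrame (Srf.n z₀) L) (y : ℂ) :
    z₀ + L y ∈ Srf.disk100 z₀ ↔ y ∈ closedBall (0:ℂ) 100 := by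
  have h1 : L y ∈ (ℝ ∙ Srf.n z₀)ᗮ := (hL _).2 ⟨y, rfl⟩
  simp [SmoothSurface.disk100, SmoothSurface.tplane, SmoothSurface.tangent, h1]

lemma disk_integral (hL : IsFrame (Srf.n z₀) L) (F : E3 → ℝ) :
    ∫ x in Srf.disk100 z₀, F x ∂μH[2] = ∫ y in ball (0:ℂ) 100, F (z₀ + L y) ∂μH[2] := by
  have hJ := isoJ z₀ L
  have hsub : Srf.disk100 z₀ ⊆ Set.range (fun y => z₀ + L y) := by
    intro x hx
    obtain ⟨y, hy⟩ := (hL _).1 hx.1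
    exact ⟨y, by simp [hy]⟩
  have hD : MeasurableSet (Srf.disk100 z₀) := by
    have : Srf.disk100 z₀ = (fun y => z₀ + L y) '' closedBall (0:ℂ) 100 := by
      ext x; constructor
      · intro hx
        obtain ⟨y, rfl⟩ := hsub hx
        exact ⟨y, (mem_disk hL y).1 hx, rfl⟩
      · rintro ⟨y, hy, rfl⟩
        exact (mem_disk hL y).2 hy
    rw [this]
    exact ((isCompact_closedBall (0:ℂ) 100).image hJ.continuous).isClosed.measurableSet
  have hm : Measure.map (fun y => z₀ + L y) (μH[2] : Measure ℂ)
      = (μH[2] : Measure E3).restrict (Set.range (fun y => z₀ + L y)) :=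
    hJ.map_hausdorffMeasure (Or.inl (by norm_num))
  have h1 : (μH[2] : Measure E3).restrict (Srf.disk100 z₀)
      = (Measure.map (fun y => z₀ + L y) (μH[2] : Measure ℂ)).restrict (Srf.disk100 z₀) := by
    rw [hm, Measure.restrict_restrict hD, Set.inter_eq_left.2 hsub]
  rw [h1, (hJ.isClosedEmbedding.measurableEmbedding).setIntegral_map]
  have h2 : (fun y => z₀ + L y) ⁻¹' Srf.disk100 z₀ = closedBall (0:ℂ) 100 := by
    ext y; exact mem_disk hL y
  rw [h2]
  refine setIntegral_congr_set ?_
  have h3 : (μH[2] : Measure ℂ) (sphere 0 100) = 0 := Measure.addHaar_sphere _ _ _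
  have : closedBall (0:ℂ) 100 = ball 0 100 ∪ sphere 0 100 := (ball_union_sphere).symm
  rw [this]
  exact union_ae_eq_left_of_ae_eq_empty (ae_eq_empty.2 h3)

lemma fderiv_J (hL : IsFrame (Srf.n z₀) L) {v : E3 → ℝ} {y : ℂ} (hy : y ∈ ball (0:ℂ) 100)
    (hv : DifferentiableWithinAt ℝ v (Srf.disk100 z₀) (z₀ + L y)) (e : ℂ) :
    fderiv ℝ (fun y => v (z₀ + L y)) y e
      = fderivWithin ℝ v (Srf.disk100 z₀) (z₀ + L y) (L e) := by
  have h1 : HasFDerivWithinAt (fun y => z₀ + L y) L.toContinuousLinearMap (ball (0:ℂ) 100) y :=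
    (L.toContinuousLinearMap.hasFDerivAt.const_add z₀).hasFDerivWithinAt
  have h2 := hv.hasFDerivWithinAt.comp y h1
    (fun y' hy' => (mem_disk hL y').2 (ball_subset_closedBall hy'))
  have h3 := h2.hasFDerivAt (isOpen_ball.mem_nhds hy)
  have h4 := h3.fderiv
  change fderiv ℝ (v ∘ fun y => z₀ + L y) y e = _
  rw [h4]; rfl

lemma green_weak0 (hL : IsFrame (Srf.n z₀) L) {CG : ℝ} {v : E3 → ℝ} (h : Srf.IsGreen z₀ CG v)
    {ψ : ℂ → ℝ} (hψ : ContDiff ℝ (⊤ : ℕ∞) ψ) :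
    ∫ y in ball (0:ℂ) 100, (fderiv ℝ (fun y => v (z₀ + L y)) y 1 * fderiv ℝ ψ y 1 +
      fderiv ℝ (fun y => v (z₀ + L y)) y Complex.I * fderiv ℝ ψ y Complex.I
        + v (z₀ + L y) * ψ y) ∂μH[2] = ψ 0 := by
  set A : E3 →L[ℝ] ℂ := ContinuousLinearMap.adjoint L.toContinuousLinearMap with hA
  have hAL : ∀ y, A (L y) = y := by
    intro y
    refine ext_inner_right ℝ fun e => ?_
    rw [hA, ContinuousLinearMap.adjoint_inner_left]
    exact L.inner_map_map y e
  set φ : E3 → ℝ := fun x => ψ (A (x - z₀)) with hφ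
  have hφs : ContDiff ℝ (⊤ : ℕ∞) φ := hψ.comp (A.contDiff.comp (contDiff_id.sub contDiff_const))
  have hφJ : ∀ y, φ (z₀ + L y) = ψ y := by intro y; simp [hφ, hAL]
  have h1 := h.2.1 φ hφs
  rw [disk_integral hL] at h1
  have h0 : φ z₀ = ψ 0 := by simp [hφ]
  rw [← h0, ← h1]
  have hne : ∀ᵐ y ∂(μH[2] : Measure ℂ), y ≠ 0 := by
    rw [ae_iff]; simp
  refine setIntegral_congr_ae measurableSet_ball ?_
  filter_upwards [hne] with y hy hyb
  have hmem := (mem_disk hL y).2 (ball_subset_closedBall hyb)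
  have hne' : z₀ + L y ≠ z₀ := by
    intro h; apply hy
    have : L y = 0 := by simpa using h
    exact (map_eq_zero_iff L L.injective).1 this
  have hvd : DifferentiableWithinAt ℝ v (Srf.disk100 z₀) (z₀ + L y) := by
    have h2 : DifferentiableWithinAt ℝ v (Srf.disk100 z₀ \ {z₀}) (z₀ + L y) :=
      (h.1 _ ⟨hmem, hne'⟩).differentiableWithinAt (by simp)
    refine h2.mono_of_mem_nhdsWithin ?_
    rw [Set.sdiff_eq]
    exact Filter.inter_mem self_mem_nhdsWithin (mem_nhdsWithin_of_mem_nhds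
      (isOpen_compl_singleton.mem_nhds hne'))
  have hφd : DifferentiableWithinAt ℝ φ (Srf.disk100 z₀) (z₀ + L y) :=
    (hφs.differentiable (by simp)).differentiableAt.differentiableWithinAt
  have e1 := fun e => fderiv_J hL hyb hvd e
  have e2 := fun e => fderiv_J hL hyb hφd e
  simp only [hφJ] at e2
  unfold SmoothSurface.tangent
  rw [tGrad_inner hL, e1, e1]
  have e3 : (fun y => ψ y) = ψ := rfl
  rw [← e2, ← e2, hφJ]

lemma green_of_isGreen (hL : IsFrame (Srf.n z₀) L) {CG : ℝ} {v : E3 → ℝ}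
    (h : Srf.IsGreen z₀ CG v) {κ : ℝ≥0∞} (h0 : κ ≠ 0) (h1 : κ ≠ ∞)
    (h2 : (μH[2] : Measure ℂ) = κ • volume) :
    Green (fun y => v (z₀ + L y)) (1 / κ.toReal) := by
  set u : ℂ → ℝ := fun y => v (z₀ + L y) with hu
  have hκ : 0 < κ.toReal := ENNReal.toReal_pos h0 h1
  have hweak : ∀ ψ : ℂ → ℝ, ContDiff ℝ (⊤ : ℕ∞) ψ →
    ∫ y in ball 0 100, (fderiv ℝ u y 1 * fderiv ℝ ψ y 1 +
      fderiv ℝ u y Complex.I * fderiv ℝ ψ y Complex.I + u y * ψ y) = (1 / κ.toReal) * ψ 0 := by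
    intro ψ hψ
    have h3 := green_weak0 hL h hψ
    rw [h2, Measure.restrict_smul, integral_smul_measure, smul_eq_mul] at h3
    rw [← h3]; field_simp; rfl
  have hIntg : ∀ ψ : ℂ → ℝ, ContDiff ℝ (⊤ : ℕ∞) ψ → ψ 0 = 1 →
    IntegrableOn (fun y => fderiv ℝ u y 1 * fderiv ℝ ψ y 1 +
      fderiv ℝ u y Complex.I * fderiv ℝ ψ y Complex.I + u y * ψ y) (ball 0 100) := by
    intro ψ hψ h0
    by_contra hc
    have := hweak ψ hψ
    rw [integral_undef hc, h0] at this
    have : 0 < 1 / κ.toReal := by positivity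
    linarith
  have i0 : IntegrableOn u (ball 0 100) := by
    have := hIntg (fun _ => 1) contDiff_const rfl
    simpa using this
  have hb : ∀ b : ℂ → ℝ, Continuous b → IntegrableOn (fun y => u y * b y) (ball 0 100) := by
    intro b hb
    obtain ⟨C, hC⟩ := (isCompact_closedBall (0:ℂ) 100).exists_bound_of_continuousOn hb.continuousOn
    refine Integrable.mul_bdd (c := C) i0 hb.aestronglyMeasurable ?_
    refine (ae_restrict_iff' measurableSet_ball).2 (Filter.Eventually.of_forall fun y hy => ?_)
    exact hC y (ball_subset_closedBall hy)
  have dre : ∀ y : ℂ, HasFDerivAt (fun y : ℂ => 1 + y.re) Complex.reCLM y := fun y =>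
    Complex.reCLM.hasFDerivAt.const_add 1
  have dim : ∀ y : ℂ, HasFDerivAt (fun y : ℂ => 1 + y.im) Complex.imCLM y := fun y =>
    Complex.imCLM.hasFDerivAt.const_add 1
  have i1 : IntegrableOn (fun y => fderiv ℝ u y 1) (ball 0 100) := by
    have h3 := hIntg (fun y => 1 + y.re) (contDiff_const.add Complex.reCLM.contDiff) (by simp)
    have h4 := h3.sub (hb (fun y => 1 + y.re) (by fun_prop))
    refine h4.congr (Filter.Eventually.of_forall fun y => ?_)
    simp only [Pi.sub_apply, (dre y).fderiv]
    simp
  have iI : IntegrableOn (fun y => fderiv ℝ u y Complex.I) (ball 0 100) := by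
    have h3 := hIntg (fun y => 1 + y.im) (contDiff_const.add Complex.imCLM.contDiff) (by simp)
    have h4 := h3.sub (hb (fun y => 1 + y.im) (by fun_prop))
    refine h4.congr (Filter.Eventually.of_forall fun y => ?_)
    simp only [Pi.sub_apply, (dim y).fderiv]
    simp
  have hmaps : Set.MapsTo (fun y : ℂ => z₀ + L y) (closedBall 0 100 \ {0})
      (Srf.disk100 z₀ \ {z₀}) := by
    intro y hy
    refine ⟨(mem_disk hL y).2 hy.1, fun h => hy.2 ?_⟩
    have : L y = 0 := by simpa using h
    exact (map_eq_zero_iff L L.injective).1 this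
  have hJs : ContDiff ℝ (⊤ : ℕ∞) (fun y : ℂ => z₀ + L y) :=
    contDiff_const.add L.toContinuousLinearMap.contDiff
  have hus : ContDiffOn ℝ (⊤ : ℕ∞) u (closedBall 0 100 \ {0}) :=
    h.1.comp hJs.contDiffOn hmaps
  refine ⟨hus.mono (Set.sdiff_subset_sdiff_left ball_subset_closedBall), i0, i1, iI, ?_, hweak⟩
  have hK : IsCompact (closedBall (0:ℂ) 100 \ ball 0 50) :=
    (isCompact_closedBall _ _).diff isOpen_ball
  have hKs : closedBall (0:ℂ) 100 \ ball 0 50 ⊆ closedBall 0 100 \ {0} := by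
    intro y hy
    refine ⟨hy.1, fun h => hy.2 ?_⟩
    rw [h]; simp
  obtain ⟨C, hC⟩ := hK.exists_bound_of_continuousOn (hus.continuousOn.mono hKs)
  refine ⟨C, fun y hy hy' => hC y ⟨ball_subset_closedBall hy, ?_⟩⟩
  simpa using hy'

lemma green_profile (hL : IsFrame (Srf.n z₀) L) {CG : ℝ} {v : E3 → ℝ}
    (h : Srf.IsGreen z₀ CG v) :
    ∃ q q1 q2 : ℝ → ℝ, QF q q1 q2 (1 / (4 * Lam)) ∧
      ∀ y : ℂ, 0 < ‖y‖ → ‖y‖ < 100 → v (z₀ + L y) = q (‖y‖ ^ 2) := by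
  obtain ⟨κ, h0, h1, h2, h3⟩ := exists_kappa
  have hκ : 0 < κ.toReal := ENNReal.toReal_pos h0 h1
  obtain ⟨q, q1, q2, hq, hq'⟩ := (green_of_isGreen hL h h0 h1 h2).profile (by positivity)
  refine ⟨q, q1, q2, ?_, hq'⟩
  have : 1 / (4 * Lam) = 1 / κ.toReal / (4 * Real.pi) := by
    rw [h3]; have := Real.pi_pos; field_simp
  rw [this]; exact hq

end transfer

end AG

namespace AG

/-- orthogonal projection onto a frame, in coordinates -/
def fr (L : ℂ →ₗᵢ[ℝ] E3) : E3 →L[ℝ] ℂ := ContinuousLinearMap.adjoint L.toContinuousLinearMap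

lemma fr_inner (L : ℂ →ₗᵢ[ℝ] E3) (x : E3) (e : ℂ) : ⟪fr L x, e⟫ = ⟪x, L e⟫ := by
  rw [fr, ContinuousLinearMap.adjoint_inner_left]; rfl

lemma fr_L (L : ℂ →ₗᵢ[ℝ] E3) (y : ℂ) : fr L (L y) = y := by
  refine ext_inner_right ℝ fun e => ?_
  rw [fr_inner]
  exact L.inner_map_map y e

lemma IsFrame.L_fr {n : E3} {L : ℂ →ₗᵢ[ℝ] E3} (hL : IsFrame n L) (x : E3) :
    L (fr L x) = (Submodule.orthogonalProjectionOnto (ℝ ∙ n)ᗮ x : E3) := by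
  obtain ⟨y, hy, hy'⟩ := hL.proj x
  have : fr L x = y := by
    refine ext_inner_right ℝ fun e => ?_
    rw [fr_inner, hy']
  rw [this, hy]

lemma IsFrame.decomp {n : E3} {L : ℂ →ₗᵢ[ℝ] E3} (hL : IsFrame n L) (hn : ‖n‖ = 1) (x : E3) :
    x = L (fr L x) + ⟪n, x⟫ • n := by
  rw [hL.L_fr]
  have h1 := Submodule.starProjection_add_starProjection_orthogonal (K := ℝ ∙ n) x
  rw [Submodule.starProjection_unit_singleton ℝ hn] at h1
  rw [add_comm]
  exact h1.symm

lemma IsFrame.norm_sq {n : E3} {L : ℂ →ₗᵢ[ℝ] E3} (hL : IsFrame n L) (hn : ‖n‖ = 1) (x : E3) :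
    ‖x‖ ^ 2 = ‖fr L x‖ ^ 2 + ⟪n, x⟫ ^ 2 := by
  conv_lhs => rw [hL.decomp hn x]
  rw [@norm_add_sq_real, L.norm_map, norm_smul, hn, inner_smul_right,
    real_inner_comm n (L (fr L x)), hL.inner_n, Real.norm_eq_abs]
  simp

lemma IsFrame.norm_fr_le {n : E3} {L : ℂ →ₗᵢ[ℝ] E3} (hL : IsFrame n L) (hn : ‖n‖ = 1) (x : E3) :
    ‖fr L x‖ ≤ ‖x‖ := by
  have := hL.norm_sq hn x
  have h2 := sq_nonneg (⟪n, x⟫ : ℝ)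
  exact le_of_sq_le_sq (by linarith) (norm_nonneg _)

attribute [irreducible] fr

/-- a graph chart of the surface around `x0`, over the plane with frame `L` -/
structure IsChart (Srf : SmoothSurface) (x0 : E3) (L : ℂ →ₗᵢ[ℝ] E3) (δ : ℝ) (V : Set E3)
    (φ : ℂ → E3) : Prop where
  frame : IsFrame (Srf.n x0) L
  mem0 : x0 ∈ Srf.S
  pos : 0 < δ
  isOpen : IsOpen V
  mem : x0 ∈ V
  smooth : ContDiffOn ℝ 2 φ (ball 0 δ)
  zero : φ 0 = x0
  maps : ∀ y ∈ ball (0:ℂ) δ, φ y ∈ Srf.S ∩ V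
  left : ∀ y ∈ ball (0:ℂ) δ, fr L (φ y - x0) = y
  right : ∀ x ∈ Srf.S ∩ V, fr L (x - x0) ∈ ball (0:ℂ) δ ∧ φ (fr L (x - x0)) = x
  normal : ∀ y ∈ ball (0:ℂ) δ, ∀ e, ⟪Srf.n (φ y), fderiv ℝ φ y e⟫ = 0

lemma exists_chart (Srf : SmoothSurface) {x0 : E3} (hx : x0 ∈ Srf.S) {L : ℂ →ₗᵢ[ℝ] E3}
    (hL : IsFrame (Srf.n x0) L) : ∃ δ V φ, IsChart Srf x0 L δ V φ := by
  obtain ⟨U, F, hU, hxU, hF, hSU, hne, hgrad⟩ := Srf.localLevel x0 hx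
  have hn := Srf.n_unit x0 hx
  have hFd : ∀ x, DifferentiableAt ℝ F x := fun x => hF.differentiable (by simp) x
  have hFx : ∀ x h, fderiv ℝ F x h = ⟪gradient F x, h⟫ := by
    intro x h
    rw [← toDual_gradient]; rfl
  obtain ⟨t, ht⟩ := hgrad x0 ⟨hx, hxU⟩
  have ht0 : t ≠ 0 := by
    intro h; apply hne x0 hxU; rw [ht, h, zero_smul]
  set Ψ : E3 → ℂ × ℝ := fun x => (fr L (x - x0), F x) with hΨ
  have hΨs : ContDiff ℝ 2 Ψ :=
    ((fr L).contDiff.comp (contDiff_id.sub contDiff_const)).prodMk (contDiff_infty.1 hF 2)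
  set D : E3 →L[ℝ] ℂ × ℝ := (fr L).prod (fderiv ℝ F x0) with hD
  have hΨd : HasFDerivAt Ψ D x0 := by
    have h1 : HasFDerivAt (fun x : E3 => fr L (x - x0)) (fr L) x0 := by
      have h2 := (fr L).hasFDerivAt (x := x0)
      have h3 : (fun x : E3 => fr L (x - x0)) = fun x => fr L x - fr L x0 := by
        funext x; rw [map_sub]
      rw [h3]; exact h2.sub_const _
    exact h1.prodMk (hFd x0).hasFDerivAt
  have hinj : Function.Injective D := by
    rw [injective_iff_map_eq_zero]
    intro h hh
    have h1 : fr L h = 0 := congrArg Prod.fst hh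
    have h2 : fderiv ℝ F x0 h = 0 := congrArg Prod.snd hh
    rw [hFx, ht, inner_smul_left] at h2
    have h3 : ⟪Srf.n x0, h⟫ = 0 := by
      have := mul_eq_zero.1 h2
      rcases this with h | h
      · exact absurd h (by simpa using ht0)
      · exact h
    rw [hL.decomp hn h, h1, h3]; simp
  have hfin : Module.finrank ℝ E3 = Module.finrank ℝ (ℂ × ℝ) := by
    simp [Module.finrank_prod, Complex.finrank_real_complex]
  set Deq : E3 ≃L[ℝ] ℂ × ℝ :=
    (LinearMap.linearEquivOfInjective (D : E3 →ₗ[ℝ] ℂ × ℝ) hinj hfin).toContinuousLinearEquiv with hDeq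
  have hDe : (Deq : E3 →L[ℝ] ℂ × ℝ) = D := by ext1 x; rfl
  rw [← hDe] at hΨd
  set e := hΨs.contDiffAt.toOpenPartialHomeomorph Ψ hΨd (by norm_num) with he
  have hsrc : x0 ∈ e.source :=
    ContDiffAt.mem_toOpenPartialHomeomorph_source hΨs.contDiffAt hΨd (by norm_num)
  have hecoe : ∀ x, e x = Ψ x := fun x => rfl
  have hF0 : F x0 = 0 := by
    have : x0 ∈ Srf.S ∩ U := ⟨hx, hxU⟩
    rw [hSU] at this; exact this.2
  have hΨ0 : Ψ x0 = (0, 0) := by simp [hΨ, hF0]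
  have htgt : ((0:ℂ), (0:ℝ)) ∈ e.target := by
    have := e.map_source hsrc
    rwa [hecoe, hΨ0] at this
  have hsymm0 : e.symm ((0:ℂ), (0:ℝ)) = x0 := by
    rw [← hΨ0, ← hecoe]; exact e.left_inv hsrc
  have hcd : ContDiffAt ℝ 2 e.symm ((0:ℂ), (0:ℝ)) := by
    have := ContDiffAt.to_localInverse hΨs.contDiffAt hΨd (by norm_num)
    rw [hΨ0] at this
    exact this
  have hev1 := hcd.eventually (by norm_num)
  have hev2 : ∀ᶠ p in nhds ((0:ℂ), (0:ℝ)), e.symm p ∈ U := by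
    refine hcd.continuousAt.eventually_mem ?_
    rw [hsymm0]; exact hU.mem_nhds hxU
  have hev3 : ∀ᶠ p in nhds ((0:ℂ), (0:ℝ)), p ∈ e.target := e.open_target.mem_nhds htgt
  obtain ⟨δ, hδ, hball⟩ := Metric.eventually_nhds_iff_ball.1 (hev1.and (hev2.and hev3))
  have hb : ∀ y ∈ ball (0:ℂ) δ, ((y, (0:ℝ)) : ℂ × ℝ) ∈ ball ((0:ℂ), (0:ℝ)) δ := by
    intro y hy
    rw [← ball_prod_same]
    exact ⟨hy, mem_ball_self hδ⟩
  have hmaps : ∀ y ∈ ball (0:ℂ) δ, F (e.symm (y, 0)) = 0 ∧ fr L (e.symm (y, 0) - x0) = y := by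
    intro y hy
    have h1 := e.right_inv (hball _ (hb y hy)).2.2
    rw [hecoe] at h1
    exact ⟨congrArg Prod.snd h1, congrArg Prod.fst h1⟩
  have hsm : ContDiffOn ℝ 2 (fun y : ℂ => e.symm (y, (0:ℝ))) (ball 0 δ) := by
    intro y hy
    refine ContDiffAt.contDiffWithinAt ?_
    exact (hball _ (hb y hy)).1.comp y (contDiffAt_id.prodMk contDiffAt_const)
  have hS : ∀ y ∈ ball (0:ℂ) δ, e.symm (y, 0) ∈ Srf.S ∩ U := by
    intro y hy
    rw [hSU]
    exact ⟨(hball _ (hb y hy)).2.1, (hmaps y hy).1⟩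
  refine ⟨δ, e.source ∩ Ψ ⁻¹' ball ((0:ℂ), (0:ℝ)) δ, fun y => e.symm (y, 0), hL, hx, hδ,
    e.open_source.inter (isOpen_ball.preimage hΨs.continuous), ⟨hsrc, ?_⟩, hsm, hsymm0, ?_,
    fun y hy => (hmaps y hy).2, ?_, ?_⟩
  · rw [Set.mem_preimage, hΨ0]; exact mem_ball_self hδ
  · intro y hy
    refine ⟨(hS y hy).1, e.map_target (hball _ (hb y hy)).2.2, ?_⟩
    rw [Set.mem_preimage, ← hecoe, e.right_inv (hball _ (hb y hy)).2.2]
    exact hb y hy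
  · rintro x ⟨hxS, hxs, hxb⟩
    have h1 : e.symm (Ψ x) = x := by rw [← hecoe]; exact e.left_inv hxs
    have h2 : x ∈ U := by
      have := (hball _ hxb).2.1
      rwa [h1] at this
    have h3 : F x = 0 := by
      have : x ∈ Srf.S ∩ U := ⟨hxS, h2⟩
      rw [hSU] at this; exact this.2
    have h4 : Ψ x = (fr L (x - x0), 0) := by simp [hΨ, h3]
    rw [Set.mem_preimage, h4, ← ball_prod_same] at hxb
    refine ⟨hxb.1, ?_⟩
    rw [← h4, h1]
  · intro y hy v
    obtain ⟨t, ht⟩ := hgrad _ (hS y hy)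
    have ht0 : t ≠ 0 := by
      intro h; apply hne _ (hS y hy).2; rw [ht, h, zero_smul]
    have hd : HasFDerivAt (fun y : ℂ => e.symm (y, (0:ℝ))) (fderiv ℝ (fun y : ℂ => e.symm (y, (0:ℝ))) y) y :=
      ((hsm.contDiffAt (isOpen_ball.mem_nhds hy)).differentiableAt (by norm_num)).hasFDerivAt
    have h1 := (hFd (e.symm (y, 0))).hasFDerivAt.comp y hd
    have h2 : HasFDerivAt (F ∘ fun y : ℂ => e.symm (y, (0:ℝ))) (0 : ℂ →L[ℝ] ℝ) y := by
      refine (hasFDerivAt_const (0:ℝ) y).congr_of_eventuallyEq ?_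
      filter_upwards [isOpen_ball.mem_nhds hy] with y' hy'
      exact (hmaps y' hy').1
    have h3 := congrArg (fun M => M v) (h1.unique h2)
    simp only [ContinuousLinearMap.comp_apply, hFx, ht, inner_smul_left] at h3
    rcases mul_eq_zero.1 h3 with h | h
    · exact absurd h (by simpa using ht0)
    · exact h

end AG

namespace AG

/-- the cross product -/
def cr (a b : E3) : E3 := !₂[a 1 * b 2 - a 2 * b 1, a 2 * b 0 - a 0 * b 2, a 0 * b 1 - a 1 * b 0]

lemma cr_0 (a b : E3) : cr a b 0 = a 1 * b 2 - a 2 * b 1 := rfl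
lemma cr_1 (a b : E3) : cr a b 1 = a 2 * b 0 - a 0 * b 2 := rfl
lemma cr_2 (a b : E3) : cr a b 2 = a 0 * b 1 - a 1 * b 0 := rfl

lemma inner_E3 (a b : E3) : (⟪a, b⟫ : ℝ) = a 0 * b 0 + a 1 * b 1 + a 2 * b 2 := by
  simp [PiLp.inner_apply, Fin.sum_univ_three]; ring

lemma cr_inner (a b c d : E3) : (⟪cr a b, cr c d⟫ : ℝ) = ⟪a, c⟫ * ⟪b, d⟫ - ⟪a, d⟫ * ⟪b, c⟫ := by
  simp only [inner_E3, cr_0, cr_1, cr_2]; ring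

lemma cr_left (a b : E3) : (⟪a, cr a b⟫ : ℝ) = 0 := by
  simp only [inner_E3, cr_0, cr_1, cr_2]; ring

lemma cr_right (a b : E3) : (⟪b, cr a b⟫ : ℝ) = 0 := by
  simp only [inner_E3, cr_0, cr_1, cr_2]; ring

lemma cr_cr (a b c : E3) : cr (cr a b) c = (⟪a, c⟫ : ℝ) • b - (⟪b, c⟫ : ℝ) • a := by
  ext i
  fin_cases i <;> simp [inner_E3, cr_0, cr_1, cr_2] <;> ring

lemma cr_norm_sq (a b : E3) : ‖cr a b‖ ^ 2 = ‖a‖ ^ 2 * ‖b‖ ^ 2 - ⟪a, b⟫ ^ 2 := by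
  rw [← real_inner_self_eq_norm_sq, cr_inner, real_inner_self_eq_norm_sq,
    real_inner_self_eq_norm_sq, real_inner_comm a b]; ring

lemma det_sq (M : ℂ →L[ℝ] ℂ) :
    M.det ^ 2 = ‖M 1‖ ^ 2 * ‖M Complex.I‖ ^ 2 - ⟪M 1, M Complex.I⟫ ^ 2 := by
  have h : M.det = (M 1).re * (M Complex.I).im - (M Complex.I).re * (M 1).im := by
    rw [ContinuousLinearMap.det, ← LinearMap.det_toMatrix Complex.basisOneI, Matrix.det_fin_two]
    simp [LinearMap.toMatrix_apply]
  rw [h, Complex.sq_norm, Complex.sq_norm, Complex.normSq_apply, Complex.normSq_apply, Complex.inner]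
  simp
  ring

/-- normal vector of a parametrisation -/
def NN (φ : ℂ → E3) (y : ℂ) : E3 := cr (fderiv ℝ φ y 1) (fderiv ℝ φ y Complex.I)

/-- area element of a parametrisation -/
def JJ (φ : ℂ → E3) (y : ℂ) : ℝ := ‖NN φ y‖

lemma continuous_cr : Continuous (fun p : E3 × E3 => cr p.1 p.2) := by
  unfold cr
  refine (PiLp.continuous_toLp 2 _).comp ?_
  refine continuous_pi fun i => ?_
  fin_cases i <;> simp <;> fun_prop

section
variable {Srf : SmoothSurface} {x0 : E3} {L : ℂ →ₗᵢ[ℝ] E3} {δ : ℝ} {V : Set E3} {φ : ℂ → E3}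

lemma IsChart.inj (h : IsChart Srf x0 L δ V φ) : Set.InjOn φ (ball 0 δ) := by
  intro y hy y' hy' e
  rw [← h.left y hy, e, h.left y' hy']

lemma IsChart.image (h : IsChart Srf x0 L δ V φ) : φ '' ball 0 δ = Srf.S ∩ V := by
  ext x; constructor
  · rintro ⟨y, hy, rfl⟩; exact h.maps y hy
  · intro hx; exact ⟨_, (h.right x hx).1, (h.right x hx).2⟩

lemma IsChart.cda (h : IsChart Srf x0 L δ V φ) {y : ℂ} (hy : y ∈ ball 0 δ) :
    ContDiffAt ℝ 2 φ y := h.smooth.contDiffAt (isOpen_ball.mem_nhds hy)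

lemma IsChart.hd (h : IsChart Srf x0 L δ V φ) {y : ℂ} (hy : y ∈ ball 0 δ) :
    HasFDerivAt φ (fderiv ℝ φ y) y := ((h.cda hy).differentiableAt (by norm_num)).hasFDerivAt

lemma IsChart.cont_fderiv (h : IsChart Srf x0 L δ V φ) :
    ContinuousOn (fderiv ℝ φ) (ball 0 δ) :=
  h.smooth.continuousOn_fderiv_of_isOpen isOpen_ball (by norm_num)

lemma IsChart.nx0 (h : IsChart Srf x0 L δ V φ) : ‖Srf.n x0‖ = 1 := Srf.n_unit _ h.mem0

lemma IsChart.fr_fderiv (h : IsChart Srf x0 L δ V φ) {y : ℂ} (hy : y ∈ ball 0 δ) (e : ℂ) :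
    fr L (fderiv ℝ φ y e) = e := by
  have h1 := (fr L).hasFDerivAt.comp y ((h.hd hy).sub_const x0)
  have h2 : HasFDerivAt ((fr L) ∘ fun y => φ y - x0) (ContinuousLinearMap.id ℝ ℂ) y := by
    refine (hasFDerivAt_id y).congr_of_eventuallyEq ?_
    filter_upwards [isOpen_ball.mem_nhds hy] with y' hy'
    exact h.left y' hy'
  exact congrArg (fun M => M e) (h1.unique h2)

lemma IsChart.norm_sub_le (h : IsChart Srf x0 L δ V φ) {y y' : ℂ} (hy : y ∈ ball 0 δ)
    (hy' : y' ∈ ball 0 δ) : ‖y - y'‖ ≤ ‖φ y - φ y'‖ := by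
  have h1 : y - y' = fr L (φ y - φ y') := by
    conv_lhs => rw [← h.left y hy, ← h.left y' hy', ← map_sub]
    congr 1; abel
  rw [h1]; exact h.frame.norm_fr_le h.nx0 _

lemma IsChart.flat_at (h : IsChart Srf x0 L δ V φ) {y0 : ℂ} (hy0 : y0 ∈ ball 0 δ) {ε : ℝ}
    (hε : 0 < ε) : ∀ᶠ ρ in nhdsWithin (0:ℝ) (Set.Ioi 0), ball y0 ρ ⊆ ball 0 δ ∧
      ∀ y ∈ ball y0 ρ, ∀ y' ∈ ball y0 ρ,
        |⟪Srf.n (φ y0), φ y - φ y'⟫| ≤ ε * ‖φ y - φ y'‖ := by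
  have hs : HasStrictFDerivAt φ (fderiv ℝ φ y0) y0 := (h.cda hy0).hasStrictFDerivAt (by norm_num)
  have h1 := hs.isLittleO.bound hε
  have h2 : ∀ᶠ p : ℂ × ℂ in nhds (y0, y0), p.1 ∈ ball (0:ℂ) δ :=
    continuousAt_fst.eventually_mem (isOpen_ball.mem_nhds hy0)
  obtain ⟨ρ0, hρ0, hρ⟩ := Metric.eventually_nhds_iff_ball.1 (h1.and h2)
  filter_upwards [Ioo_mem_nhdsGT hρ0] with ρ hρm
  have hin : ∀ y ∈ ball y0 ρ, ∀ y' ∈ ball y0 ρ, (y, y') ∈ ball (y0, y0) ρ0 := by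
    intro y hy y' hy'
    rw [← ball_prod_same]
    exact ⟨ball_subset_ball hρm.2.le hy, ball_subset_ball hρm.2.le hy'⟩
  refine ⟨fun y hy => (hρ _ (hin y hy y hy)).2, fun y hy y' hy' => ?_⟩
  have h3 := (hρ _ (hin y hy y' hy')).1
  have h4 := (hρ _ (hin y hy y hy)).2
  have h5 := (hρ _ (hin y' hy' y hy)).2
  simp only at h3 h4 h5
  have h6 : (⟪Srf.n (φ y0), φ y - φ y'⟫ : ℝ)
      = ⟪Srf.n (φ y0), φ y - φ y' - fderiv ℝ φ y0 (y - y')⟫ := by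
    rw [inner_sub_right _ (φ y - φ y'), h.normal y0 hy0, sub_zero]
  rw [h6]
  refine (abs_real_inner_le_norm _ _).trans ?_
  rw [Srf.n_unit _ (h.maps y0 hy0).1, one_mul]
  refine h3.trans ?_
  gcongr
  exact h.norm_sub_le h4 h5

lemma IsChart.JJ_cont (h : IsChart Srf x0 L δ V φ) : ContinuousOn (JJ φ) (ball 0 δ) := by
  have h1 := h.cont_fderiv
  have h2 : ContinuousOn (fun y => (fderiv ℝ φ y 1, fderiv ℝ φ y Complex.I)) (ball 0 δ) :=
    (h1.clm_apply continuousOn_const).prodMk (h1.clm_apply continuousOn_const)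
  exact (continuous_cr.comp_continuousOn h2).norm

/-- comparison of the area element with a Jacobian determinant at the base point -/
lemma IsChart.det_eq (h : IsChart Srf x0 L δ V φ) {y0 : ℂ} (hy0 : y0 ∈ ball 0 δ)
    {L1 : ℂ →ₗᵢ[ℝ] E3} (hL1 : IsFrame (Srf.n (φ y0)) L1) :
    |((fr L1).comp (fderiv ℝ φ y0)).det| = JJ φ y0 := by
  have hn := Srf.n_unit _ (h.maps y0 hy0).1
  have h1 : ∀ a b : ℂ, (⟪fr L1 (fderiv ℝ φ y0 a), fr L1 (fderiv ℝ φ y0 b)⟫ : ℝ)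
      = ⟪fderiv ℝ φ y0 a, fderiv ℝ φ y0 b⟫ := by
    intro a b
    have h2 := hL1.decomp hn (fderiv ℝ φ y0 b)
    rw [h.normal y0 hy0, zero_smul, add_zero] at h2
    rw [fr_inner, ← h2]
  rw [JJ, NN, ← abs_of_nonneg (norm_nonneg (cr _ _)), ← sq_eq_sq_iff_abs_eq_abs, det_sq, cr_norm_sq]
  simp only [ContinuousLinearMap.comp_apply, ← real_inner_self_eq_norm_sq, h1]

lemma IsChart.JJ_pos (h : IsChart Srf x0 L δ V φ) {y0 : ℂ} (hy0 : y0 ∈ ball 0 δ) :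
    0 < JJ φ y0 := by
  have h1 : ‖fderiv ℝ φ y0 1‖ ^ 2 * ‖fderiv ℝ φ y0 Complex.I‖ ^ 2
      - ⟪fderiv ℝ φ y0 1, fderiv ℝ φ y0 Complex.I⟫ ^ 2 ≠ 0 := by
    intro h0
    have h2 : |(⟪fderiv ℝ φ y0 1, fderiv ℝ φ y0 Complex.I⟫ : ℝ)|
        = ‖fderiv ℝ φ y0 1‖ * ‖fderiv ℝ φ y0 Complex.I‖ := by
      rw [← abs_of_nonneg (a := ‖fderiv ℝ φ y0 1‖ * ‖fderiv ℝ φ y0 Complex.I‖) (by positivity),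
        ← sq_eq_sq_iff_abs_eq_abs]
      linarith [mul_pow ‖fderiv ℝ φ y0 1‖ ‖fderiv ℝ φ y0 Complex.I‖ 2]
    have hne : fderiv ℝ φ y0 1 ≠ 0 := by
      intro h3
      have := h.fr_fderiv hy0 1
      rw [h3] at this; simp at this
    have hne2 : fderiv ℝ φ y0 Complex.I ≠ 0 := by
      intro h3
      have := h.fr_fderiv hy0 Complex.I
      rw [h3, map_zero] at this
      exact Complex.I_ne_zero this.symm
    have h3 : ‖(inner ℝ (fderiv ℝ φ y0 1) (fderiv ℝ φ y0 Complex.I) : ℝ)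
       / (‖fderiv ℝ φ y0 1‖ * ‖fderiv ℝ φ y0 Complex.I‖)‖ = 1 := by
      rw [norm_div, Real.norm_eq_abs, h2]
      simp [hne, hne2]
    obtain ⟨_, r, hr, hr2⟩ := (abs_real_inner_div_norm_mul_norm_eq_one_iff _ _).1 h3
    have h4 := h.fr_fderiv hy0 Complex.I
    rw [hr2, map_smul, h.fr_fderiv hy0] at h4
    have := congrArg Complex.im h4
    simp at this
  have h5 : JJ φ y0 ≠ 0 := by
    intro h6
    rw [← cr_norm_sq] at h1
    apply h1
    change (JJ φ y0) ^ 2 = 0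
    rw [h6]; norm_num
  exact lt_of_le_of_ne (norm_nonneg _) h5.symm

end

end AG

namespace AG

section
variable {Srf : SmoothSurface} {x0 : E3} {L : ℂ →ₗᵢ[ℝ] E3} {δ : ℝ} {V : Set E3} {φ : ℂ → E3}

lemma IsChart.area_local (h : IsChart Srf x0 L δ V φ) {y0 : ℂ} (hy0 : y0 ∈ ball 0 δ) {ε : ℝ}
    (hε : 0 < ε) (hε1 : ε ≤ 1) : ∃ ρ > 0, ball y0 ρ ⊆ ball 0 δ ∧
      ∀ A ⊆ ball y0 ρ, MeasurableSet A →
        (μH[2] : Measure E3) (φ '' A) ≤ ENNReal.ofReal (1 + ε) * ∫⁻ y in A, ENNReal.ofReal (JJ φ y) ∂μH[2] ∧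
        ∫⁻ y in A, ENNReal.ofReal (JJ φ y) ∂μH[2] ≤ ENNReal.ofReal (1 + ε) * (μH[2] : Measure E3) (φ '' A) := by
  set η : ℝ := ε / 7 with hη
  have hη0 : 0 < η := by positivity
  have hη1 : (1 + η) ^ 2 * (1 + η) ≤ 1 + ε := by
    have : ε = 7 * η := by rw [hη]; ring
    have h7 : η ≤ 1 := by linarith
    nlinarith [mul_pos hη0 hη0, mul_le_mul_of_nonneg_left h7 hη0.le,
      mul_le_mul_of_nonneg_left h7 (mul_pos hη0 hη0).le]
  have hn := Srf.n_unit _ (h.maps y0 hy0).1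
  obtain ⟨L1, hL1⟩ := exists_frame hn
  set M : ℂ → ℝ := fun y => |((fr L1).comp (fderiv ℝ φ y)).det| with hM
  have hMc : ContinuousOn M (ball 0 δ) := by
    have h1 : ContinuousOn (fun y => (fr L1).comp (fderiv ℝ φ y)) (ball 0 δ) :=
      continuousOn_const.clm_comp h.cont_fderiv
    exact (ContinuousLinearMap.continuous_det.comp_continuousOn h1).abs
  have hM0 : M y0 = JJ φ y0 := h.det_eq hy0 hL1
  have hJ0 := h.JJ_pos hy0
  have hnb := isOpen_ball.mem_nhds hy0
  have hev1 : ∀ᶠ y in nhds y0, M y < (1 + η) * JJ φ y := by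
    refine (hMc.continuousAt hnb).eventually_lt (continuousAt_const.mul (h.JJ_cont.continuousAt hnb)) ?_
    rw [hM0]; nlinarith
  have hev2 : ∀ᶠ y in nhds y0, JJ φ y < (1 + η) * M y := by
    refine (h.JJ_cont.continuousAt hnb).eventually_lt (continuousAt_const.mul (hMc.continuousAt hnb)) ?_
    rw [hM0]; nlinarith
  obtain ⟨ρ0, hρ0, hb⟩ := Metric.eventually_nhds_iff_ball.1 (hev1.and hev2)
  have hε0 : 0 < η / (1 + η) := by positivity
  obtain ⟨ρ, ⟨hsub, hflat⟩, hρ⟩ := ((h.flat_at hy0 hε0).and (Ioo_mem_nhdsGT hρ0)).exists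
  refine ⟨ρ, hρ.1, hsub, fun A hA hAm => ?_⟩
  set g : ℂ → ℂ := fun y => fr L1 (φ y) with hg
  have hkey : ∀ y ∈ A, ∀ y' ∈ A, ‖φ y - φ y'‖ ≤ (1 + η) * ‖g y - g y'‖ := by
    intro y hy y' hy'
    have h1 := hflat y (hA hy) y' (hA hy')
    have h2 := hL1.decomp hn (φ y - φ y')
    have h3 : ‖φ y - φ y'‖ ≤ ‖g y - g y'‖ + |⟪Srf.n (φ y0), φ y - φ y'⟫| := by
      conv_lhs => rw [h2]
      refine (norm_add_le _ _).trans ?_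
      rw [L1.norm_map, norm_smul, hn, mul_one, Real.norm_eq_abs, map_sub]
    have h4 : ‖φ y - φ y'‖ ≤ ‖g y - g y'‖ + η / (1 + η) * ‖φ y - φ y'‖ := by linarith
    have h5 : ‖φ y - φ y'‖ * (1 + η) ≤ ‖g y - g y'‖ * (1 + η) + η * ‖φ y - φ y'‖ := by
      have := mul_le_mul_of_nonneg_right h4 (by positivity : 0 ≤ 1 + η)
      calc _ ≤ _ := this
        _ = _ := by field_simp
    linarith
  have hginj : Set.InjOn g A := by
    intro y hy y' hy' e
    have h1 := hkey y hy y' hy'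
    rw [e, sub_self, norm_zero, mul_zero] at h1
    exact h.inj (hsub (hA hy)) (hsub (hA hy')) (sub_eq_zero.1 (norm_le_zero_iff.1 h1))
  have hchg : ∫⁻ y in A, ENNReal.ofReal (M y) ∂μH[2] = (μH[2] : Measure ℂ) (g '' A) := by
    refine lintegral_abs_det_fderiv_eq_addHaar_image (μH[2] : Measure ℂ) hAm
      (f' := fun y => (fr L1).comp (fderiv ℝ φ y)) (fun y hy => ?_) hginj
    exact ((fr L1).hasFDerivAt.comp y (h.hd (hsub (hA hy)))).hasFDerivWithinAt
  have hle1 : (μH[2] : Measure ℂ) (g '' A) ≤ (μH[2] : Measure E3) (φ '' A) := by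
    have h1 : g '' A = fr L1 '' (φ '' A) := by rw [Set.image_image]
    have h2 : LipschitzOnWith 1 (fr L1) (φ '' A) := by
      refine LipschitzWith.lipschitzOnWith (LipschitzWith.of_dist_le_mul fun a b => ?_)
      rw [dist_eq_norm, dist_eq_norm, ← map_sub, NNReal.coe_one, one_mul]
      exact hL1.norm_fr_le hn _
    rw [h1]
    have := h2.hausdorffMeasure_image_le (d := 2) (by norm_num)
    simpa using this
  have hle2 : (μH[2] : Measure E3) (φ '' A) ≤ ENNReal.ofReal ((1 + η) ^ 2) * (μH[2] : Measure ℂ) (g '' A) := by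
    have h1 : φ '' A = (fun t => φ (Function.invFunOn g A t)) '' (g '' A) := by
      rw [Set.image_image]
      refine Set.image_congr fun y hy => ?_
      rw [hginj.leftInvOn_invFunOn hy]
    have h2 : LipschitzOnWith (1 + η).toNNReal (fun t => φ (Function.invFunOn g A t)) (g '' A) := by
      refine LipschitzOnWith.of_dist_le_mul ?_
      rintro _ ⟨y, hy, rfl⟩ _ ⟨y', hy', rfl⟩
      rw [hginj.leftInvOn_invFunOn hy, hginj.leftInvOn_invFunOn hy', dist_eq_norm, dist_eq_norm,
        Real.coe_toNNReal _ (by positivity)]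
      exact hkey y hy y' hy'
    rw [h1]
    refine (h2.hausdorffMeasure_image_le (d := 2) (by norm_num)).trans_eq ?_
    congr 1
    rw [ENNReal.ofReal_pow (by positivity)]
    norm_num
    rfl
  have hi1 : ∫⁻ y in A, ENNReal.ofReal (M y) ∂μH[2] ≤ ENNReal.ofReal (1 + η) * ∫⁻ y in A, ENNReal.ofReal (JJ φ y) ∂μH[2] := by
    rw [← lintegral_const_mul' _ _ ENNReal.ofReal_ne_top]
    refine setLIntegral_mono' hAm fun y hy => ?_
    rw [← ENNReal.ofReal_mul (by positivity)]
    exact ENNReal.ofReal_le_ofReal (hb y (ball_subset_ball hρ.2.le (hA hy))).1.le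
  have hi2 : ∫⁻ y in A, ENNReal.ofReal (JJ φ y) ∂μH[2] ≤ ENNReal.ofReal (1 + η) * ∫⁻ y in A, ENNReal.ofReal (M y) ∂μH[2] := by
    rw [← lintegral_const_mul' _ _ ENNReal.ofReal_ne_top]
    refine setLIntegral_mono' hAm fun y hy => ?_
    rw [← ENNReal.ofReal_mul (by positivity)]
    exact ENNReal.ofReal_le_ofReal (hb y (ball_subset_ball hρ.2.le (hA hy))).2.le
  constructor
  · calc _ ≤ _ := hle2
      _ ≤ ENNReal.ofReal ((1 + η) ^ 2) * (ENNReal.ofReal (1 + η) * ∫⁻ y in A, ENNReal.ofReal (JJ φ y) ∂μH[2]) := by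
        rw [← hchg]; gcongr
      _ = ENNReal.ofReal ((1 + η) ^ 2 * (1 + η)) * ∫⁻ y in A, ENNReal.ofReal (JJ φ y) ∂μH[2] := by
        rw [← mul_assoc, ← ENNReal.ofReal_mul (by positivity)]
      _ ≤ _ := by gcongr
  · calc _ ≤ _ := hi2
      _ ≤ ENNReal.ofReal (1 + η) * (μH[2] : Measure E3) (φ '' A) := by rw [hchg]; gcongr
      _ ≤ _ := by gcongr; linarith

lemma IsChart.meas_image (h : IsChart Srf x0 L δ V φ) {A : Set ℂ} (hA : A ⊆ ball 0 δ)
    (hAm : MeasurableSet A) : MeasurableSet (φ '' A) :=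
  hAm.image_of_continuousOn_injOn (h.smooth.continuousOn.mono hA) (h.inj.mono hA)

lemma IsChart.area_eps (h : IsChart Srf x0 L δ V φ) {ε : ℝ}
    (hε : 0 < ε) (hε1 : ε ≤ 1) {A : Set ℂ} (hA : A ⊆ ball 0 δ) (hAm : MeasurableSet A) :
        (μH[2] : Measure E3) (φ '' A) ≤ ENNReal.ofReal (1 + ε) * ∫⁻ y in A, ENNReal.ofReal (JJ φ y) ∂μH[2] ∧
        ∫⁻ y in A, ENNReal.ofReal (JJ φ y) ∂μH[2] ≤ ENNReal.ofReal (1 + ε) * (μH[2] : Measure E3) (φ '' A) := by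
  choose! ρ hρ hsub hloc using fun (y0 : ℂ) (hy0 : y0 ∈ ball 0 δ) => h.area_local hy0 hε hε1
  obtain ⟨T, hT, hTc, hcov⟩ := TopologicalSpace.countable_cover_nhdsWithin (s := A)
    (f := fun y => ball y (ρ y)) (fun y hy => mem_nhdsWithin_of_mem_nhds (ball_mem_nhds y (hρ y (hA hy))))
  rcases T.eq_empty_or_nonempty with hTe | hTne
  · rw [hTe] at hcov
    have : A = ∅ := by simpa using hcov
    rw [this]; simp
  obtain ⟨t, ht⟩ := hTc.exists_eq_range hTne
  have hcov' : A ⊆ ⋃ k, ball (t k) (ρ (t k)) := by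
    rw [ht, Set.biUnion_range] at hcov
    exact hcov
  set B : ℕ → Set ℂ := fun k => A ∩ disjointed (fun k => ball (t k) (ρ (t k))) k with hB
  have hBm : ∀ k, MeasurableSet (B k) := fun k =>
    hAm.inter (MeasurableSet.disjointed (fun k => measurableSet_ball) k)
  have hBd : Pairwise (Function.onFun Disjoint B) := fun i j hij =>
    ((disjoint_disjointed _) hij).mono Set.inter_subset_right Set.inter_subset_right
  have hBu : A = ⋃ k, B k := by
    rw [hB, ← Set.inter_iUnion, iUnion_disjointed]
    exact (Set.inter_eq_left.2 hcov').symm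
  have htA : ∀ k, t k ∈ ball (0:ℂ) δ := fun k => hA (hT (by rw [ht]; exact ⟨k, rfl⟩))
  have hBs : ∀ k, B k ⊆ ball 0 δ := fun k => Set.inter_subset_left.trans hA
  have hk := fun k => hloc (t k) (htA k) (B k)
    (Set.inter_subset_right.trans (disjointed_subset _ k)) (hBm k)
  have hm1 : (μH[2] : Measure E3) (φ '' A) = ∑' k, (μH[2] : Measure E3) (φ '' (B k)) := by
    conv_lhs => rw [hBu, Set.image_iUnion]
    refine measure_iUnion (fun i j hij => ?_) (fun k => h.meas_image (hBs k) (hBm k))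
    refine Set.disjoint_left.2 ?_
    rintro _ ⟨y, hy, rfl⟩ ⟨y', hy', e⟩
    have hyy := h.inj (hBs j hy') (hBs i hy) e
    rw [hyy] at hy'
    exact Set.disjoint_left.1 (hBd hij) hy hy'
  have hm2 : ∫⁻ y in A, ENNReal.ofReal (JJ φ y) ∂μH[2] = ∑' k, ∫⁻ y in B k, ENNReal.ofReal (JJ φ y) ∂μH[2] := by
    conv_lhs => rw [hBu]
    exact lintegral_iUnion hBm hBd _
  rw [hm1, hm2, ← ENNReal.tsum_mul_left, ← ENNReal.tsum_mul_left]
  exact ⟨ENNReal.tsum_le_tsum fun k => (hk k).1, ENNReal.tsum_le_tsum fun k => (hk k).2⟩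

lemma le_of_eps {a b : ℝ≥0∞} (h : ∀ ε : ℝ, 0 < ε → ε ≤ 1 → a ≤ ENNReal.ofReal (1 + ε) * b) : a ≤ b := by
  have h1 : Filter.Tendsto (fun ε : ℝ => ENNReal.ofReal (1 + ε) * b) (nhdsWithin 0 (Set.Ioi 0))
      (nhds (ENNReal.ofReal (1 + 0) * b)) := by
    refine ENNReal.Tendsto.mul_const ?_ (Or.inl (by simp))
    refine (ENNReal.continuous_ofReal.tendsto _).comp ?_
    exact ((continuous_const.add continuous_id).tendsto (0:ℝ)).mono_left nhdsWithin_le_nhds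
  rw [add_zero, ENNReal.ofReal_one, one_mul] at h1
  refine ge_of_tendsto h1 ?_
  filter_upwards [Ioo_mem_nhdsGT (zero_lt_one (α := ℝ))] with ε hε
  exact h ε hε.1 hε.2.le

lemma IsChart.area (h : IsChart Srf x0 L δ V φ) {A : Set ℂ} (hA : A ⊆ ball 0 δ)
    (hAm : MeasurableSet A) :
    (μH[2] : Measure E3) (φ '' A) = ∫⁻ y in A, ENNReal.ofReal (JJ φ y) ∂μH[2] :=
  le_antisymm (le_of_eps fun _ h0 h1 => (h.area_eps h0 h1 hA hAm).1)
    (le_of_eps fun _ h0 h1 => (h.area_eps h0 h1 hA hAm).2)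

/-- area formula on the level of measures -/
lemma IsChart.map_eq (h : IsChart Srf x0 L δ V φ) :
    Measure.map ((ball (0:ℂ) δ).domRestrict φ) (Measure.comap (Subtype.val)
      ((μH[2] : Measure ℂ).withDensity (fun y => ENNReal.ofReal (JJ φ y))))
      = (μH[2] : Measure E3).restrict (Srf.S ∩ V) := by
  have hme : MeasurableEmbedding ((ball (0:ℂ) δ).domRestrict φ) :=
    h.smooth.continuousOn.measurableEmbedding measurableSet_ball h.inj
  ext s hs
  rw [Measure.map_apply hme.measurable hs, Measure.restrict_apply hs,
    (MeasurableEmbedding.subtype_coe measurableSet_ball).comap_apply]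
  have h1 : Subtype.val '' ((ball (0:ℂ) δ).domRestrict φ ⁻¹' s) = ball 0 δ ∩ φ ⁻¹' s := by
    ext y; simp [Set.domRestrict, and_comm]
  have h2 : MeasurableSet (ball (0:ℂ) δ ∩ φ ⁻¹' s) := by
    rw [← h1]
    exact (MeasurableEmbedding.subtype_coe measurableSet_ball).measurableSet_image.2 (hme.measurable hs)
  rw [h1, withDensity_apply _ h2, ← h.area Set.inter_subset_left h2, Set.image_inter_preimage,
    h.image, Set.inter_comm]

lemma IsChart.jac_meas (h : IsChart Srf x0 L δ V φ) :
    AEMeasurable (fun y => ENNReal.ofReal (JJ φ y)) ((μH[2] : Measure ℂ).restrict (ball 0 δ)) :=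
  (h.JJ_cont.aemeasurable measurableSet_ball).ennreal_ofReal

lemma IsChart.integral_eq (h : IsChart Srf x0 L δ V φ) (f : E3 → ℝ) :
    ∫ x in Srf.S ∩ V, f x ∂μH[2] = ∫ y in ball (0:ℂ) δ, JJ φ y * f (φ y) ∂μH[2] := by
  have hme : MeasurableEmbedding ((ball (0:ℂ) δ).domRestrict φ) :=
    h.smooth.continuousOn.measurableEmbedding measurableSet_ball h.inj
  rw [← h.map_eq, hme.integral_map]
  have h1 : ∀ y : ball (0:ℂ) δ, f ((ball (0:ℂ) δ).domRestrict φ y) = (fun y => f (φ y)) (y : ℂ) := fun y => rfl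
  rw [integral_congr_ae (Filter.Eventually.of_forall h1),
    ← (MeasurableEmbedding.subtype_coe measurableSet_ball).integral_map (fun y => f (φ y)),
    map_comap_subtype_coe measurableSet_ball,
    restrict_withDensity measurableSet_ball]
  have h2 : (fun y => ENNReal.ofReal (JJ φ y)) = fun y => ((JJ φ y).toNNReal : ℝ≥0∞) := rfl
  rw [h2, integral_withDensity_eq_integral_smul₀ (h.JJ_cont.aemeasurable measurableSet_ball).real_toNNReal]
  refine integral_congr_ae (Filter.Eventually.of_forall fun y => ?_)
  simp only [NNReal.smul_def, smul_eq_mul]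
  rw [Real.coe_toNNReal (JJ φ y) (norm_nonneg _)]

lemma IsChart.integrable_iff (h : IsChart Srf x0 L δ V φ) (f : E3 → ℝ) :
    IntegrableOn f (Srf.S ∩ V) μH[2] ↔ IntegrableOn (fun y => JJ φ y * f (φ y)) (ball (0:ℂ) δ) μH[2] := by
  have hme : MeasurableEmbedding ((ball (0:ℂ) δ).domRestrict φ) :=
    h.smooth.continuousOn.measurableEmbedding measurableSet_ball h.inj
  rw [IntegrableOn, ← h.map_eq, hme.integrable_map_iff]
  have h1 : f ∘ (ball (0:ℂ) δ).domRestrict φ = (fun y => f (φ y)) ∘ (Subtype.val) := rfl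
  rw [h1, ← (MeasurableEmbedding.subtype_coe measurableSet_ball).integrable_map_iff,
    map_comap_subtype_coe measurableSet_ball,
    restrict_withDensity measurableSet_ball]
  have h2 : (fun y => ENNReal.ofReal (JJ φ y)) = fun y => ((JJ φ y).toNNReal : ℝ≥0∞) := rfl
  rw [h2, integrable_withDensity_iff_integrable_smul₀ (h.JJ_cont.aemeasurable measurableSet_ball).real_toNNReal]
  refine integrable_congr (Filter.Eventually.of_forall fun y => ?_)
  simp only [NNReal.smul_def, smul_eq_mul]
  rw [Real.coe_toNNReal (JJ φ y) (norm_nonneg _)]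

end

end AG

namespace AG

lemma n_contDiffAt (Srf : SmoothSurface) {x : E3} (hx : x ∈ Srf.S) : ContDiffAt ℝ (⊤ : ℕ∞) Srf.n x := by
  obtain ⟨U, hU, hS, hn⟩ := Srf.n_smooth
  exact hn.contDiffAt (hU.mem_nhds (hS hx))

lemma n_continuousOn (Srf : SmoothSurface) : ContinuousOn Srf.n Srf.S := fun _ hx =>
  (n_contDiffAt Srf hx).continuousAt.continuousWithinAt

lemma inner_gradient (f : E3 → ℝ) (x h : E3) : ⟪gradient f x, h⟫ = fderiv ℝ f x h := by
  rw [← toDual_gradient]; rfl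

lemma integral_fderiv_eq_zero {f : ℂ → ℝ} (hf : ContDiff ℝ 1 f) (hc : HasCompactSupport f) (v : ℂ) :
    ∫ y, fderiv ℝ f y v ∂(μH[2] : Measure ℂ) = 0 := by
  have h1 : Continuous (fun y => fderiv ℝ f y v) := by
    exact (hf.continuous_fderiv (by norm_num)).clm_apply continuous_const
  have h2 : HasCompactSupport (fun y => fderiv ℝ f y v) := by
    exact hc.fderiv_apply (𝕜 := ℝ) v
  have h := integral_mul_fderiv_eq_neg_fderiv_mul_of_integrable (μ := (μH[2] : Measure ℂ))
    (f := fun _ : ℂ => (1:ℝ)) (g := f) (v := v) (by simp)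
    (by simpa using h1.integrable_of_hasCompactSupport h2)
    (by simpa using hf.continuous.integrable_of_hasCompactSupport hc)
    (fun x _ => differentiableAt_const _) (fun x _ => hf.differentiable (by norm_num) x)
  simpa using h

section
variable {Srf : SmoothSurface} {x0 : E3} {L : ℂ →ₗᵢ[ℝ] E3} {δ : ℝ} {V : Set E3} {φ : ℂ → E3}

lemma IsChart.sign (h : IsChart Srf x0 L δ V φ) :
    ∃ σ : ℝ, ∀ y ∈ ball (0:ℂ) δ, JJ φ y • Srf.n (φ y) = σ • NN φ y := by
  set c : ℂ → ℝ := fun y => ⟪NN φ y, Srf.n (φ y)⟫ with hc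
  have hcr : ∀ y ∈ ball (0:ℂ) δ, cr (NN φ y) (Srf.n (φ y)) = 0 := by
    intro y hy
    rw [NN, cr_cr, real_inner_comm, h.normal y hy, real_inner_comm, h.normal y hy]; simp
  have hsq : ∀ y ∈ ball (0:ℂ) δ, c y ^ 2 = JJ φ y ^ 2 := by
    intro y hy
    have h1 := cr_norm_sq (NN φ y) (Srf.n (φ y))
    rw [hcr y hy, Srf.n_unit _ (h.maps y hy).1, norm_zero] at h1
    change (⟪NN φ y, Srf.n (φ y)⟫ : ℝ) ^ 2 = ‖NN φ y‖ ^ 2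
    linarith
  have hN : ∀ y ∈ ball (0:ℂ) δ, NN φ y = c y • Srf.n (φ y) := by
    intro y hy
    have h1 : ‖NN φ y - c y • Srf.n (φ y)‖ ^ 2 = 0 := by
      rw [@norm_sub_sq_real, inner_smul_right, norm_smul, Srf.n_unit _ (h.maps y hy).1, mul_one,
        Real.norm_eq_abs, sq_abs]
      have := hsq y hy
      change ‖NN φ y‖ ^ 2 - 2 * (c y * c y) + c y ^ 2 = 0
      have h2 : JJ φ y = ‖NN φ y‖ := rfl
      rw [h2] at this
      nlinarith
    have h2 : ‖NN φ y - c y • Srf.n (φ y)‖ = 0 := by simpa using h1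
    exact sub_eq_zero.1 (norm_eq_zero.1 h2)
  have hcc : ContinuousOn c (ball 0 δ) := by
    have h1 := h.cont_fderiv
    have h2 : ContinuousOn (fun y => (fderiv ℝ φ y 1, fderiv ℝ φ y Complex.I)) (ball 0 δ) :=
      (h1.clm_apply continuousOn_const).prodMk (h1.clm_apply continuousOn_const)
    have h3 : ContinuousOn (NN φ) (ball 0 δ) := continuous_cr.comp_continuousOn h2
    exact h3.inner (𝕜 := ℝ)
      ((n_continuousOn Srf).comp h.smooth.continuousOn (fun y hy => (h.maps y hy).1))
  rcases (convex_ball (0:ℂ) δ).isPreconnected.eq_or_eq_neg_of_sq_eq hcc h.JJ_cont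
    (fun y hy => hsq y hy) (fun hy => (h.JJ_pos hy).ne') with h1 | h1
  · refine ⟨1, fun y hy => ?_⟩
    rw [hN y hy, h1 hy, one_smul]
  · refine ⟨-1, fun y hy => ?_⟩
    rw [hN y hy, h1 hy, smul_smul]; simp

lemma IsChart.stokes (h : IsChart Srf x0 L δ V φ) {α : E3 → ℝ}
    (hα : ∀ x ∈ Srf.S, ContDiffAt ℝ 1 α x) {K : Set E3} (hK : IsCompact K) (hKV : K ⊆ V)
    (hαK : ∀ x, x ∉ K → α x = 0) (j : Fin 3) :
    ∫ x in Srf.S, (cr (Srf.n x) (gradient α x)) j ∂μH[2] = 0 := by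
  -- reduction to the chart
  have hSm : MeasurableSet Srf.S := Srf.compact.isClosed.measurableSet
  have h0 : ∫ x in Srf.S, (cr (Srf.n x) (gradient α x)) j ∂μH[2]
      = ∫ x in Srf.S ∩ V, (cr (Srf.n x) (gradient α x)) j ∂μH[2] := by
    refine setIntegral_eq_of_subset_of_forall_sdiff_eq_zero hSm Set.inter_subset_left ?_
    rintro x ⟨hxS, hxV⟩
    have hxK : x ∉ K := fun hx => hxV ⟨hxS, hKV hx⟩
    have : α =ᶠ[nhds x] fun _ => 0 := by
      filter_upwards [hK.isClosed.isOpen_compl.mem_nhds hxK] with x' hx'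
      exact hαK x' hx'
    have hg : gradient α x = 0 := by
      unfold gradient
      rw [this.fderiv_eq]; simp
    rw [hg]
    fin_cases j <;> simp [cr_0, cr_1, cr_2]
  rw [h0, h.integral_eq]
  set K' : Set ℂ := (fun x => fr L (x - x0)) '' (Srf.S ∩ K) with hK'
  have hKc : IsCompact K' := (Srf.compact.inter hK).image (by fun_prop)
  have hKb : K' ⊆ ball 0 δ := by
    rintro _ ⟨x, hx, rfl⟩
    exact (h.right x ⟨hx.1, hKV hx.2⟩).1
  set a : ℂ → ℝ := (ball (0:ℂ) δ).indicator (fun y => α (φ y)) with ha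
  have ha0 : ∀ y, y ∉ K' → a y = 0 := by
    intro y hy
    by_cases hyb : y ∈ ball (0:ℂ) δ
    · rw [ha, Set.indicator_of_mem hyb]
      refine hαK _ fun hc => hy ⟨φ y, ⟨(h.maps y hyb).1, hc⟩, h.left y hyb⟩
    · rw [ha, Set.indicator_of_notMem hyb]
  have haev : ∀ y ∈ ball (0:ℂ) δ, a =ᶠ[nhds y] fun y => α (φ y) := by
    intro y hy
    filter_upwards [isOpen_ball.mem_nhds hy] with y' hy'
    rw [ha, Set.indicator_of_mem hy']
  have haC : ∀ y ∈ ball (0:ℂ) δ, ContDiffAt ℝ 1 a y := by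
    intro y hy
    refine ContDiffAt.congr_of_eventuallyEq ?_ (haev y hy)
    exact (hα _ (h.maps y hy).1).comp y ((h.cda hy).of_le (by norm_num))
  have had : ∀ y ∈ ball (0:ℂ) δ, ∀ d, fderiv ℝ a y d = ⟪fderiv ℝ φ y d, gradient α (φ y)⟫ := by
    intro y hy d
    rw [(haev y hy).fderiv_eq, real_inner_comm, inner_gradient]
    have h1 := ((hα _ (h.maps y hy).1).differentiableAt (by norm_num)).hasFDerivAt.comp y (h.hd hy)
    have h2 := h1.fderiv
    change fderiv ℝ (α ∘ φ) y d = _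
    rw [h2]; rfl
  set pj : E3 →L[ℝ] ℝ := EuclideanSpace.proj j with hpj
  set f : ℂ → ℂ → ℝ := fun e y => a y * pj (fderiv ℝ φ y e) with hf
  have hφ1 : ∀ y ∈ ball (0:ℂ) δ, ContDiffAt ℝ 1 (fderiv ℝ φ) y := fun y hy =>
    (h.cda hy).fderiv_right (by norm_num)
  have hf0 : ∀ e y, y ∉ K' → f e =ᶠ[nhds y] fun _ => 0 := by
    intro e y hy
    filter_upwards [hKc.isClosed.isOpen_compl.mem_nhds hy] with y' hy'
    rw [hf]; simp only; rw [ha0 y' hy', zero_mul]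
  have hfC : ∀ e, ContDiff ℝ 1 (f e) := by
    intro e
    rw [contDiff_iff_contDiffAt]
    intro y
    by_cases hy : y ∈ ball (0:ℂ) δ
    · exact (haC y hy).mul (pj.contDiff.contDiffAt.comp y ((hφ1 y hy).clm_apply contDiffAt_const))
    · exact contDiffAt_const.congr_of_eventuallyEq (hf0 e y fun hc => hy (hKb hc))
  have hfc : ∀ e, HasCompactSupport (f e) := by
    intro e
    refine HasCompactSupport.intro hKc fun y hy => ?_
    rw [hf]; simp only; rw [ha0 y hy, zero_mul]
  have hfd : ∀ e, ∀ y ∈ ball (0:ℂ) δ, ∀ d, fderiv ℝ (f e) y d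
      = a y * pj (fderiv ℝ (fderiv ℝ φ) y d e) + ⟪fderiv ℝ φ y d, gradient α (φ y)⟫ * pj (fderiv ℝ φ y e) := by
    intro e y hy d
    have h1 := ((haC y hy).differentiableAt (by norm_num)).hasFDerivAt
    have h2 := ((hφ1 y hy).differentiableAt (by norm_num)).hasFDerivAt
    have h3 : HasFDerivAt (fun y => pj (fderiv ℝ φ y e))
        (pj.comp ((ContinuousLinearMap.apply ℝ E3 e).comp (fderiv ℝ (fderiv ℝ φ) y))) y :=
      pj.hasFDerivAt.comp y ((ContinuousLinearMap.apply ℝ E3 e).hasFDerivAt.comp y h2)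
    have h4 := (h1.mul h3).fderiv
    change fderiv ℝ (a * fun y => pj (fderiv ℝ φ y e)) y d = _
    rw [h4]
    simp [had y hy]
    ring
  obtain ⟨σ, hσ⟩ := h.sign
  have key : ∀ y ∈ ball (0:ℂ) δ, JJ φ y * (cr (Srf.n (φ y)) (gradient α (φ y))) j
      = σ * (fderiv ℝ (f Complex.I) y 1 - fderiv ℝ (f 1) y Complex.I) := by
    intro y hy
    have h1 : ∀ (t : ℝ) (u v : E3), t * (cr u v) j = (cr (t • u) v) j := by
      intro t u v
      fin_cases j <;> simp [cr_0, cr_1, cr_2] <;> ring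
    have hsym : fderiv ℝ (fderiv ℝ φ) y 1 Complex.I = fderiv ℝ (fderiv ℝ φ) y Complex.I 1 :=
      ((h.cda hy).isSymmSndFDerivAt (by simp)).eq _ _
    rw [h1, hσ y hy, ← h1, NN, cr_cr, hfd _ y hy, hfd _ y hy, hsym]
    have h2 : ∀ u : E3, pj u = u j := fun u => rfl
    simp only [h2, PiLp.sub_apply, PiLp.smul_apply, smul_eq_mul]
    ring
  rw [setIntegral_congr_fun measurableSet_ball key]
  rw [setIntegral_eq_integral_of_forall_compl_eq_zero, integral_const_mul, integral_sub,
    integral_fderiv_eq_zero (hfC _) (hfc _), integral_fderiv_eq_zero (hfC _) (hfc _)]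
  · simp
  · exact (((hfC _).continuous_fderiv (by norm_num)).clm_apply
      continuous_const).integrable_of_hasCompactSupport ((hfc _).fderiv_apply (𝕜 := ℝ) _)
  · exact (((hfC _).continuous_fderiv (by norm_num)).clm_apply
      continuous_const).integrable_of_hasCompactSupport ((hfc _).fderiv_apply (𝕜 := ℝ) _)
  · intro y hy
    have hyK : y ∉ K' := fun hc => hy (hKb hc)
    rw [(hf0 _ y hyK).fderiv_eq, (hf0 _ y hyK).fderiv_eq]; simp

end

lemma hasChart (Srf : SmoothSurface) {x0 : E3} (hx : x0 ∈ Srf.S) :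
    ∃ L δ V φ, IsChart Srf x0 L δ V φ := by
  obtain ⟨L, hL⟩ := exists_frame (Srf.n_unit x0 hx)
  exact ⟨L, exists_chart Srf hx hL⟩

lemma measure_S_lt_top (Srf : SmoothSurface) : (μH[2] : Measure E3) Srf.S < ∞ := by
  refine Srf.compact.measure_lt_top_of_nhdsWithin fun x hx => ?_
  obtain ⟨L, δ, V, φ, h⟩ := hasChart Srf hx
  have hpos := h.pos
  set W : Set E3 := V ∩ {x' | fr L (x' - x) ∈ ball (0:ℂ) (δ / 2)} with hW
  have hWo : IsOpen W := h.isOpen.inter (isOpen_ball.preimage (by fun_prop))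
  refine ⟨Srf.S ∩ W, Filter.inter_mem self_mem_nhdsWithin (mem_nhdsWithin_of_mem_nhds
    (hWo.mem_nhds ⟨h.mem, ?_⟩)), ?_⟩
  · simp [hpos]
  have hcb : closedBall (0:ℂ) (δ / 2) ⊆ ball 0 δ := closedBall_subset_ball (by linarith)
  have hsub : Srf.S ∩ W ⊆ φ '' closedBall 0 (δ / 2) := by
    rintro x' ⟨h1, h2, h3⟩
    exact ⟨_, ball_subset_closedBall h3, (h.right x' ⟨h1, h2⟩).2⟩
  refine (measure_mono hsub).trans_lt ?_
  rw [h.area hcb measurableSet_closedBall]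
  have h1 : IntegrableOn (JJ φ) (closedBall 0 (δ / 2)) (μH[2] : Measure ℂ) :=
    (h.JJ_cont.mono hcb).integrableOn_compact (isCompact_closedBall _ _)
  exact h1.lintegral_lt_top

lemma gradient_continuousOn {S : Set E3} {α : E3 → ℝ} (hα : ∀ x ∈ S, ContDiffAt ℝ 1 α x) :
    ContinuousOn (gradient α) S := by
  intro x hx
  have h1 : ContDiffAt ℝ 0 (fderiv ℝ α) x := (hα x hx).fderiv_right (by norm_num)
  exact ((InnerProductSpace.toDual ℝ E3).symm.continuous.continuousAt.comp
    h1.continuousAt).continuousWithinAt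

lemma cr_continuousOn {S : Set E3} {u v : E3 → E3} (hu : ContinuousOn u S) (hv : ContinuousOn v S) :
    ContinuousOn (fun x => cr (u x) (v x)) S :=
  continuous_cr.comp_continuousOn (hu.prodMk hv)

lemma stokes_integrable (Srf : SmoothSurface) {α : E3 → ℝ}
    (hα : ∀ x ∈ Srf.S, ContDiffAt ℝ 1 α x) (j : Fin 3) :
    IntegrableOn (fun x => (cr (Srf.n x) (gradient α x)) j) Srf.S μH[2] := by
  have h1 : ContinuousOn (fun x => (cr (Srf.n x) (gradient α x)) j) Srf.S :=
    (EuclideanSpace.proj j : E3 →L[ℝ] ℝ).continuous.comp_continuousOn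
      (cr_continuousOn (n_continuousOn Srf) (gradient_continuousOn hα))
  exact h1.integrableOn_of_subset_isCompact Srf.compact Srf.compact.isClosed.measurableSet subset_rfl
    (measure_S_lt_top Srf).ne

lemma gradient_add_at {f g : E3 → ℝ} {x : E3} (hf : DifferentiableAt ℝ f x) (hg : DifferentiableAt ℝ g x) :
    gradient (fun x => f x + g x) x = gradient f x + gradient g x := by
  unfold gradient
  rw [fderiv_fun_add hf hg, map_add]

lemma stokes_global (Srf : SmoothSurface) {α : E3 → ℝ}
    (hα : ∀ x ∈ Srf.S, ContDiffAt ℝ 1 α x) (j : Fin 3) :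
    ∫ x in Srf.S, (cr (Srf.n x) (gradient α x)) j ∂μH[2] = 0 := by
  have hSm : MeasurableSet Srf.S := Srf.compact.isClosed.measurableSet
  choose! L δ V φ hch using fun (x : E3) (hx : x ∈ Srf.S) => hasChart Srf hx
  have hr : ∀ x ∈ Srf.S, ∃ r > 0, closedBall x (2 * r) ⊆ V x := by
    intro x hx
    obtain ⟨r, hr, hr'⟩ := Metric.nhds_basis_closedBall.mem_iff.1 ((hch x hx).isOpen.mem_nhds (hch x hx).mem)
    exact ⟨r / 2, by positivity, by rw [mul_div_cancel₀ r (two_ne_zero)]; exact hr'⟩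
  choose! r hr0 hrV using hr
  obtain ⟨T, hT, hcov⟩ := Srf.compact.elim_nhds_subcover (fun x => ball x (r x))
    (fun x hx => ball_mem_nhds x (hr0 x hx))
  have hχ : ∀ x ∈ Srf.S, ∃ χ : E3 → ℝ, ContDiff ℝ 1 χ ∧ (∀ x' ∈ closedBall x (r x), χ x' = 1) ∧
      ∀ x', x' ∉ closedBall x (2 * r x) → χ x' = 0 := by
    intro x hx
    have := hr0 x hx
    let b : ContDiffBump x := ⟨r x, 2 * r x, this, by linarith⟩
    refine ⟨b, b.contDiff, fun x' hx' => b.one_of_mem_closedBall hx', fun x' hx' => ?_⟩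
    refine b.zero_of_le_dist ?_
    rw [mem_closedBall, not_le] at hx'
    exact hx'.le
  choose! χ hχs hχ1 hχ0 using hχ
  have main : ∀ T' : Finset E3, (∀ x ∈ T', x ∈ Srf.S) →
      (∀ x ∈ Srf.S, ContDiffAt ℝ 1 (fun x => α x * ∏ k ∈ T', (1 - χ k x)) x) ∧
      ∫ x in Srf.S, (cr (Srf.n x) (gradient α x)) j ∂μH[2]
      = ∫ x in Srf.S, (cr (Srf.n x) (gradient (fun x => α x * ∏ k ∈ T', (1 - χ k x)) x)) j ∂μH[2] := by
    classical
    intro T'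
    induction T' using Finset.induction_on with
    | empty => intro _; simpa using hα
    | insert k T' hk ih =>
      intro hT'
      obtain ⟨ih1, ih2⟩ := ih fun x hx => hT' x (Finset.mem_insert_of_mem hx)
      have hkS := hT' k (Finset.mem_insert_self _ _)
      set β : E3 → ℝ := fun x => α x * ∏ k ∈ T', (1 - χ k x) with hβ
      have e1 : (fun x => α x * ∏ k ∈ insert k T', (1 - χ k x)) = fun x => β x * (1 - χ k x) := by
        funext x; rw [Finset.prod_insert hk, hβ]; ring
      have c1 : ∀ x ∈ Srf.S, ContDiffAt ℝ 1 (fun x => β x * (1 - χ k x)) x := fun x hx =>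
        (ih1 x hx).mul (contDiffAt_const.sub (hχs k hkS).contDiffAt)
      have c2 : ∀ x ∈ Srf.S, ContDiffAt ℝ 1 (fun x => β x * χ k x) x := fun x hx =>
        (ih1 x hx).mul (hχs k hkS).contDiffAt
      rw [e1]
      refine ⟨c1, ?_⟩
      have h0 := (hch k hkS).stokes c2 (isCompact_closedBall k (2 * r k)) (hrV k hkS)
        (fun x hx => by rw [hχ0 k hkS x hx, mul_zero]) j
      rw [ih2, ← add_zero (∫ x in Srf.S, (cr (Srf.n x) (gradient (fun x => β x * (1 - χ k x)) x)) j ∂μH[2]),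
        ← h0, ← integral_add (stokes_integrable Srf c1 j) (stokes_integrable Srf c2 j)]
      refine setIntegral_congr_fun hSm fun x hx => ?_
      have e2 : β = fun x => β x * (1 - χ k x) + β x * χ k x := by funext x; ring
      have e3 : gradient β x = gradient (fun x => β x * (1 - χ k x)) x + gradient (fun x => β x * χ k x) x := by
        conv_lhs => rw [e2]
        exact gradient_add_at ((c1 x hx).differentiableAt (by norm_num))
          ((c2 x hx).differentiableAt (by norm_num))
      simp only [e3]
      fin_cases j <;> simp [cr_0, cr_1, cr_2] <;> ring
  rw [(main T hT).2]
  refine setIntegral_eq_zero_of_forall_eq_zero fun x hx => ?_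
  have hz : (fun x => α x * ∏ k ∈ T, (1 - χ k x)) =ᶠ[nhds x] fun _ => 0 := by
    obtain ⟨k, hk, hxk⟩ := Set.mem_iUnion₂.1 (hcov hx)
    filter_upwards [isOpen_ball.mem_nhds hxk] with x' hx'
    rw [Finset.prod_eq_zero hk, mul_zero]
    rw [hχ1 k (hT k hk) x' (ball_subset_closedBall hx'), sub_self]
  have hg : gradient (fun x => α x * ∏ k ∈ T, (1 - χ k x)) x = 0 := by
    unfold gradient
    rw [hz.fderiv_eq]; simp
  rw [hg]
  fin_cases j <;> simp [cr_0, cr_1, cr_2]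

end AG

namespace AG

lemma n_lipschitz (Srf : SmoothSurface) : ∃ Λ : ℝ, 0 ≤ Λ ∧ ∀ x ∈ Srf.S, ∀ z ∈ Srf.S,
    ‖Srf.n x - Srf.n z‖ ≤ Λ * ‖x - z‖ := by
  have h : LocallyLipschitzOn Srf.S Srf.n := by
    intro x hx
    obtain ⟨K, t, ht, hK⟩ := ((n_contDiffAt Srf hx).of_le (m := 1)
      (by exact_mod_cast le_top)).exists_lipschitzOnWith
    exact ⟨K, t, mem_nhdsWithin_of_mem_nhds ht, hK⟩
  obtain ⟨K, hK⟩ := h.exists_lipschitzOnWith_of_compact Srf.compact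
  refine ⟨K, K.2, fun x hx z hz => ?_⟩
  have := hK.dist_le_mul x hx z hz
  rwa [dist_eq_norm, dist_eq_norm] at this

lemma n_fderiv_bound (Srf : SmoothSurface) : ∃ C : ℝ, 0 ≤ C ∧ ∀ x ∈ Srf.S,
    ‖fderiv ℝ Srf.n x‖ ≤ C := by
  have h : ContinuousOn (fderiv ℝ Srf.n) Srf.S := by
    intro x hx
    have h1 : ContDiffAt ℝ 0 (fderiv ℝ Srf.n) x :=
      ((n_contDiffAt Srf hx).of_le (m := 1) (by exact_mod_cast le_top)).fderiv_right (by norm_num)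
    exact h1.continuousAt.continuousWithinAt
  obtain ⟨C, hC⟩ := Srf.compact.exists_bound_of_continuousOn h
  obtain ⟨x, hx⟩ := Srf.nonempty
  exact ⟨C, (norm_nonneg _).trans (hC x hx), hC⟩

section
variable {Srf : SmoothSurface} {x0 : E3} {L : ℂ →ₗᵢ[ℝ] E3} {δ : ℝ} {V : Set E3} {φ : ℂ → E3}

lemma IsChart.fderiv_zero (h : IsChart Srf x0 L δ V φ) (e : ℂ) : fderiv ℝ φ 0 e = L e := by
  have h0 : (0:ℂ) ∈ ball (0:ℂ) δ := mem_ball_self h.pos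
  have h1 := h.frame.decomp h.nx0 (fderiv ℝ φ 0 e)
  have h2 := h.normal 0 h0 e
  rw [h.zero] at h2
  rw [h1, h.fr_fderiv h0, h2]; simp

lemma IsChart.JJ_zero (h : IsChart Srf x0 L δ V φ) : JJ φ 0 = 1 := by
  have h1 : JJ φ 0 ^ 2 = 1 := by
    change ‖cr (fderiv ℝ φ 0 1) (fderiv ℝ φ 0 Complex.I)‖ ^ 2 = 1
    rw [cr_norm_sq, h.fderiv_zero, h.fderiv_zero, L.norm_map, L.norm_map, L.inner_map_map]
    simp [Complex.inner]
  have h2 := h.JJ_pos (mem_ball_self h.pos)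
  nlinarith

lemma IsChart.hd0 (h : IsChart Srf x0 L δ V φ) : HasFDerivAt φ L.toContinuousLinearMap 0 := by
  have h1 := h.hd (mem_ball_self h.pos)
  have h2 : fderiv ℝ φ 0 = L.toContinuousLinearMap := by
    ext1 e; exact h.fderiv_zero e
  rwa [h2] at h1

lemma n_deriv_tangent (h : IsChart Srf x0 L δ V φ) (e : ℂ) :
    ⟪Srf.n x0, fderiv ℝ Srf.n x0 (L e)⟫ = 0 := by
  have hn : HasFDerivAt Srf.n (fderiv ℝ Srf.n x0) (φ 0) := by
    rw [h.zero]
    exact ((n_contDiffAt Srf h.mem0).differentiableAt (by simp)).hasFDerivAt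
  have h1 := (hn.comp 0 h.hd0)
  have h2 := h1.inner ℝ h1
  have h3 : HasFDerivAt (fun y => ⟪(Srf.n ∘ φ) y, (Srf.n ∘ φ) y⟫) (0 : ℂ →L[ℝ] ℝ) 0 := by
    refine (hasFDerivAt_const (1:ℝ) (0:ℂ)).congr_of_eventuallyEq ?_
    filter_upwards [ball_mem_nhds (0:ℂ) h.pos] with y hy
    simp only [Function.comp_apply]
    rw [real_inner_self_eq_norm_sq, Srf.n_unit _ (h.maps y hy).1]; norm_num
  have h4 := congrArg (fun T => T e) (h2.unique h3)
  simp [fderivInnerCLM_apply, h.zero] at h4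
  rw [real_inner_comm (Srf.n x0)] at h4
  linarith

lemma fderivWithin_tangent (h : IsChart Srf x0 L δ V φ) {f : E3 → ℝ} (hf : DifferentiableAt ℝ f x0)
    (e : ℂ) : fderivWithin ℝ f Srf.S x0 (L e) = fderiv ℝ f x0 (L e) := by
  have h1 : HasFDerivWithinAt f (fderivWithin ℝ f Srf.S x0) Srf.S (φ 0) := by
    rw [h.zero]; exact hf.differentiableWithinAt.hasFDerivWithinAt
  have h1' : HasFDerivAt f (fderiv ℝ f x0) (φ 0) := by
    rw [h.zero]; exact hf.hasFDerivAt
  have hS : Set.MapsTo φ (ball 0 δ) Srf.S := fun y hy => (h.maps y hy).1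
  have h2 := (h1.comp 0 (h.hd0.hasFDerivWithinAt (s := ball 0 δ)) hS).hasFDerivAt
    (ball_mem_nhds (0:ℂ) h.pos)
  have h3 := h1'.comp 0 h.hd0
  exact congrArg (fun T => T e) (h2.unique h3)

end

lemma grad_inner (Srf : SmoothSurface) {x : E3} (hx : x ∈ Srf.S) {f g : E3 → ℝ}
    (hf : DifferentiableAt ℝ f x) (hg : DifferentiableAt ℝ g x) :
    ⟪Srf.grad f x, Srf.grad g x⟫ = ⟪cr (Srf.n x) (gradient f x), cr (Srf.n x) (gradient g x)⟫ := by
  obtain ⟨L, δ, V, φ, h⟩ := hasChart Srf hx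
  have hn := Srf.n_unit x hx
  unfold SmoothSurface.grad SmoothSurface.tangent
  rw [tGrad_inner h.frame, fderivWithin_tangent h hf, fderivWithin_tangent h hf,
    fderivWithin_tangent h hg, fderivWithin_tangent h hg, cr_inner, real_inner_self_eq_norm_sq, hn]
  rw [← inner_gradient, ← inner_gradient, ← inner_gradient, ← inner_gradient]
  have h1 : (⟪gradient f x, gradient g x⟫ : ℝ) = ⟪fr L (gradient f x), fr L (gradient g x)⟫
      + ⟪Srf.n x, gradient f x⟫ * ⟪Srf.n x, gradient g x⟫ := by
    rw [fr_inner]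
    conv_lhs => rw [h.frame.decomp hn (gradient g x), inner_add_right, inner_smul_right]
    rw [real_inner_comm (Srf.n x) (gradient f x)]
    ring
  rw [h1, inner_eq_dirs, fr_inner, fr_inner, fr_inner, fr_inner, real_inner_comm (Srf.n x) (gradient f x)]
  ring

lemma flat_near (Srf : SmoothSurface) : ∃ ρ > 0, ∀ z ∈ Srf.S, ∀ x ∈ Srf.S, ‖x - z‖ < ρ →
    |⟪Srf.n z, x - z⟫| ≤ 1 / 2 * ‖x - z‖ := by
  have hloc : ∀ x0 : Srf.S, ∃ U : Set E3, IsOpen U ∧ (x0 : E3) ∈ U ∧ ∀ z ∈ Srf.S ∩ U, ∀ x ∈ Srf.S ∩ U,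
      |⟪Srf.n z, x - z⟫| ≤ 1 / 2 * ‖x - z‖ := by
    rintro ⟨x0, hx0⟩
    obtain ⟨L, δ, V, φ, h⟩ := hasChart Srf hx0
    obtain ⟨ρ, ⟨hb, hρ⟩, hρ0⟩ := ((h.flat_at (mem_ball_self h.pos) (ε := 1 / 4) (by norm_num)).and
      self_mem_nhdsWithin).exists
    have hρ0 : 0 < ρ := hρ0
    obtain ⟨Λ, hΛ, hlip⟩ := n_lipschitz Srf
    refine ⟨V ∩ (fun x => fr L (x - x0)) ⁻¹' ball 0 ρ ∩ ball x0 (1 / (4 * (Λ + 1))),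
      (h.isOpen.inter (isOpen_ball.preimage (by fun_prop))).inter isOpen_ball,
      ⟨⟨h.mem, by simpa using hρ0⟩, mem_ball_self (by positivity)⟩, ?_⟩
    rintro z ⟨hzS, ⟨hzV, hzb⟩, hzr⟩ x ⟨hxS, ⟨hxV, hxb⟩, hxr⟩
    have h1 := hρ _ hxb _ hzb
    rw [(h.right x ⟨hxS, hxV⟩).2, (h.right z ⟨hzS, hzV⟩).2, h.zero] at h1
    have h2 : ‖Srf.n z - Srf.n x0‖ ≤ 1 / 4 := by
      refine (hlip z hzS x0 hx0).trans ?_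
      rw [mem_ball, dist_eq_norm] at hzr
      calc Λ * ‖z - x0‖ ≤ (Λ + 1) * (1 / (4 * (Λ + 1))) := by gcongr; linarith
        _ = 1 / 4 := by field_simp
    have h3 : (⟪Srf.n z, x - z⟫ : ℝ) = ⟪Srf.n x0, x - z⟫ + ⟪Srf.n z - Srf.n x0, x - z⟫ := by
      rw [← inner_add_left]; congr 1; abel
    rw [h3]
    have h4 := abs_real_inner_le_norm (Srf.n z - Srf.n x0) (x - z)
    have h5 : ‖Srf.n z - Srf.n x0‖ * ‖x - z‖ ≤ 1 / 4 * ‖x - z‖ := by gcongr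
    refine (abs_add_le _ _).trans ?_
    linarith
  choose U hUo hUm hU using hloc
  obtain ⟨ρ, hρ, hL⟩ := lebesgue_number_lemma_of_metric Srf.compact hUo
    (fun x hx => Set.mem_iUnion.2 ⟨⟨x, hx⟩, hUm _⟩)
  refine ⟨ρ, hρ, fun z hz x hx hxz => ?_⟩
  obtain ⟨i, hi⟩ := hL z hz
  exact hU i z ⟨hz, hi (mem_ball_self hρ)⟩ x ⟨hx, hi (by rwa [mem_ball, dist_eq_norm])⟩

lemma proj_lower (Srf : SmoothSurface) {r₁ : ℝ} (hr₁ : Srf.IsGraphRadius r₁) :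
    ∃ C : ℝ, 1 ≤ C ∧ ∀ z ∈ Srf.S, ∀ x ∈ Srf.S, ‖x - z‖ ≤ 3 / 2 * r₁ →
      ∀ L : ℂ →ₗᵢ[ℝ] E3, IsFrame (Srf.n z) L → ‖x - z‖ ≤ C * ‖fr L (x - z)‖ := by
  obtain ⟨hr0, hr1, hinj⟩ := hr₁
  obtain ⟨ρ, hρ, hflat⟩ := flat_near Srf
  set K : Set (E3 × E3) := (Srf.S ×ˢ Srf.S) ∩ {p | ρ ≤ ‖p.2 - p.1‖ ∧ ‖p.2 - p.1‖ ≤ 3 / 2 * r₁} with hK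
  have hKc : IsCompact K := (Srf.compact.prod Srf.compact).inter_right
    (IsClosed.inter (s₁ := {p : E3 × E3 | ρ ≤ ‖p.2 - p.1‖}) (s₂ := {p | ‖p.2 - p.1‖ ≤ 3 / 2 * r₁})
      (isClosed_le (by fun_prop) (by fun_prop)) (isClosed_le (by fun_prop) (by fun_prop)))
  have hcont : ContinuousOn (fun p : E3 × E3 => ‖p.2 - p.1‖ ^ 2 - ⟪Srf.n p.1, p.2 - p.1⟫ ^ 2) K := by
    have h1 : ContinuousOn (fun p : E3 × E3 => Srf.n p.1) K :=
      (n_continuousOn Srf).comp continuousOn_fst (fun p hp => hp.1.1)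
    have h2 : ContinuousOn (fun p : E3 × E3 => p.2 - p.1) K := by fun_prop
    exact (h2.norm.pow 2).sub ((h1.inner (𝕜 := ℝ) h2).pow 2)
  have hpos : ∀ p ∈ K, 0 < ‖p.2 - p.1‖ ^ 2 - ⟪Srf.n p.1, p.2 - p.1⟫ ^ 2 := by
    rintro ⟨z, x⟩ ⟨⟨hz, hx⟩, h1, h2⟩
    simp only at hz hx h1 h2 ⊢
    have hn := Srf.n_unit z hz
    obtain ⟨L, hL⟩ := exists_frame hn
    rw [hL.norm_sq hn, add_sub_cancel_right]
    have : fr L (x - z) ≠ 0 := by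
      intro h0
      have h3 : Srf.P0 z x = Srf.P0 z z := by
        unfold SmoothSurface.P0 SmoothSurface.tangent
        rw [← hL.L_fr, ← hL.L_fr, h0, sub_self, map_zero, map_zero, map_zero]
      have h4 : x = z := hinj z hz ⟨hx, by rw [mem_closedBall, dist_eq_norm]; linarith⟩
        ⟨hz, mem_closedBall_self (by linarith)⟩ h3
      rw [h4, sub_self, norm_zero] at h1
      linarith
    positivity
  obtain ⟨c, hc, hcK⟩ := hKc.exists_forall_le' hcont hpos
  have hs : 0 < Real.sqrt c := Real.sqrt_pos.2 hc
  refine ⟨2 + 3 / 2 * r₁ / Real.sqrt c, ?_, fun z hz x hx hxz L hL => ?_⟩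
  · have : 0 ≤ 3 / 2 * r₁ / Real.sqrt c := by positivity
    linarith
  have hn := Srf.n_unit z hz
  have h1 := hL.norm_sq hn (x - z)
  by_cases h2 : ‖x - z‖ < ρ
  · have h3 := hflat z hz x hx h2
    have h4 : (⟪Srf.n z, x - z⟫ : ℝ) ^ 2 ≤ (1 / 2 * ‖x - z‖) ^ 2 := by
      rw [← sq_abs]; gcongr
    have h5 : ‖x - z‖ ≤ 2 * ‖fr L (x - z)‖ := by
      refine le_of_sq_le_sq ?_ (by positivity)
      nlinarith [sq_nonneg ‖x - z‖]
    refine h5.trans ?_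
    gcongr
    have : 0 ≤ 3 / 2 * r₁ / Real.sqrt c := by positivity
    linarith
  · have h3 := hcK (z, x) ⟨⟨hz, hx⟩, not_lt.1 h2, hxz⟩
    simp only at h3
    rw [h1, add_sub_cancel_right] at h3
    have h4 : Real.sqrt c ≤ ‖fr L (x - z)‖ := Real.sqrt_le_iff.2 ⟨norm_nonneg _, h3⟩
    calc ‖x - z‖ ≤ 3 / 2 * r₁ := hxz
      _ = 3 / 2 * r₁ / Real.sqrt c * Real.sqrt c := by field_simp
      _ ≤ (2 + 3 / 2 * r₁ / Real.sqrt c) * ‖fr L (x - z)‖ := by gcongr; linarith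

end AG

namespace AG

/-- cross product as a continuous bilinear map -/
def crL : E3 →L[ℝ] E3 →L[ℝ] E3 :=
  LinearMap.toContinuousLinearMap ((LinearMap.toContinuousLinearMap : (E3 →ₗ[ℝ] E3) ≃ₗ[ℝ] _).toLinearMap.comp
    (LinearMap.mk₂ ℝ cr
      (by intro a b c; ext i; fin_cases i <;> simp [cr_0, cr_1, cr_2] <;> ring)
      (by intro a b c; ext i; fin_cases i <;> simp [cr_0, cr_1, cr_2] <;> ring)
      (by intro a b c; ext i; fin_cases i <;> simp [cr_0, cr_1, cr_2] <;> ring)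
      (by intro a b c; ext i; fin_cases i <;> simp [cr_0, cr_1, cr_2] <;> ring)))

lemma crL_apply (a b : E3) : crL a b = cr a b := rfl

lemma cr_hasFDerivAt {u v : E3 → E3} {u' v' : E3 →L[ℝ] E3} {x : E3} (hu : HasFDerivAt u u' x)
    (hv : HasFDerivAt v v' x) : ∃ T : E3 →L[ℝ] E3, HasFDerivAt (fun x => cr (u x) (v x)) T x ∧
      ∀ h, T h = cr (u x) (v' h) + cr (u' h) (v x) := by
  refine ⟨_, crL.hasFDerivAt_of_bilinear hu hv, fun h => ?_⟩
  simp [crL_apply]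

lemma cr_contDiffAt {u v : E3 → E3} {x : E3} (hu : ContDiffAt ℝ 1 u x)
    (hv : ContDiffAt ℝ 1 v x) : ContDiffAt ℝ 1 (fun x => cr (u x) (v x)) x :=
  crL.isBoundedBilinearMap.contDiff.contDiffAt.comp x (hu.prodMk hv)

/-- standard basis vector -/
def bv (i : Fin 3) : E3 := EuclideanSpace.single i (1:ℝ)

lemma bv_decomp (h : E3) : h = h 0 • bv 0 + h 1 • bv 1 + h 2 • bv 2 := by
  ext i; fin_cases i <;> simp [bv]

lemma bv_norm (i : Fin 3) : ‖bv i‖ = 1 := by simp [bv]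

/-- normal component of the curl -/
def tw (n : E3) (T : E3 →L[ℝ] E3) : ℝ :=
  n 0 * (T (bv 1) 2 - T (bv 2) 1) + n 1 * (T (bv 2) 0 - T (bv 0) 2) + n 2 * (T (bv 0) 1 - T (bv 1) 0)

/-- trace -/
def tr (T : E3 →L[ℝ] E3) : ℝ := T (bv 0) 0 + T (bv 1) 1 + T (bv 2) 2

lemma map_bv (T : E3 →L[ℝ] E3) (h : E3) (i : Fin 3) :
    T h i = h 0 * T (bv 0) i + h 1 * T (bv 1) i + h 2 * T (bv 2) i := by
  conv_lhs => rw [bv_decomp h]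
  simp

lemma abs_apply_le (x : E3) (i : Fin 3) : |x i| ≤ ‖x‖ := by
  have := PiLp.norm_apply_le x i
  rwa [Real.norm_eq_abs] at this

lemma abs_tr_le (T : E3 →L[ℝ] E3) : |tr T| ≤ 3 * ‖T‖ := by
  have h : ∀ i, |T (bv i) i| ≤ ‖T‖ := fun i =>
    (abs_apply_le _ _).trans (by simpa [bv_norm] using T.le_opNorm (bv i))
  unfold tr
  refine (abs_add_le _ _).trans ?_
  have := abs_add_le (T (bv 0) 0) (T (bv 1) 1)
  linarith [h 0, h 1, h 2]

lemma tw_formula {n Y g : E3} {D N T : E3 →L[ℝ] E3} {Φ : ℝ}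
    (hT : ∀ h, T h = Φ • (cr n (D h) + cr (N h) Y) + (⟪g, h⟫ : ℝ) • cr n Y) :
    tw n T = Φ * (⟪n, n⟫ * tr D - ⟪n, D n⟫ + ⟪n, N Y⟫ - ⟪n, Y⟫ * tr N) + ⟪cr n g, cr n Y⟫ := by
  have hb : ∀ i, (⟪g, bv i⟫ : ℝ) = g i := by
    intro i; rw [inner_E3]; fin_cases i <;> simp [bv]
  simp only [tw, tr, hT, hb, inner_E3, map_bv D n, map_bv N Y, cr_0, cr_1, cr_2, PiLp.add_apply,
    PiLp.smul_apply, smul_eq_mul]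
  ring

lemma stokes_vec (Srf : SmoothSurface) {X : E3 → E3} (hX : ∀ x ∈ Srf.S, ContDiffAt ℝ 1 X x) :
    IntegrableOn (fun x => tw (Srf.n x) (fderiv ℝ X x)) Srf.S μH[2] ∧
    ∫ x in Srf.S, tw (Srf.n x) (fderiv ℝ X x) ∂μH[2] = 0 := by
  have hXj : ∀ j, ∀ x ∈ Srf.S, ContDiffAt ℝ 1 (fun x => X x j) x := fun j x hx =>
    (EuclideanSpace.proj j : E3 →L[ℝ] ℝ).contDiff.contDiffAt.comp x (hX x hx)
  have hg : ∀ j, ∀ x ∈ Srf.S, ∀ l, gradient (fun x => X x j) x l = fderiv ℝ X x (bv l) j := by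
    intro j x hx l
    have h1 : gradient (fun x => X x j) x l = ⟪gradient (fun x => X x j) x, bv l⟫ := by
      rw [inner_E3]; fin_cases l <;> simp [bv]
    have h2 := (EuclideanSpace.proj j : E3 →L[ℝ] ℝ).hasFDerivAt.comp x
      ((hX x hx).differentiableAt (by norm_num)).hasFDerivAt
    rw [h1, inner_gradient]
    have h3 : fderiv ℝ (fun x => X x j) x = _ := h2.fderiv
    rw [h3]; rfl
  have he : ∀ x ∈ Srf.S, tw (Srf.n x) (fderiv ℝ X x) =
      ∑ j, (cr (Srf.n x) (gradient (fun x => X x j) x)) j := by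
    intro x hx
    simp only [Fin.sum_univ_three, cr_0, cr_1, cr_2, hg _ x hx, tw]
    ring
  have hSm : MeasurableSet Srf.S := Srf.compact.isClosed.measurableSet
  have hi : ∀ j ∈ Finset.univ, IntegrableOn (fun x => (cr (Srf.n x) (gradient (fun x => X x j) x)) j) Srf.S μH[2] :=
    fun j _ => stokes_integrable Srf (hXj j) j
  constructor
  · refine IntegrableOn.congr_fun ?_ (fun x hx => (he x hx).symm) hSm
    exact integrable_finsetSum _ hi
  · rw [setIntegral_congr_fun hSm he, integral_finsetSum _ hi]
    exact Finset.sum_eq_zero fun j _ => stokes_global Srf (hXj j) j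

end AG

namespace AG

lemma QF.contDiffOn {q q1 q2 : ℝ → ℝ} {m : ℝ} (hq : QF q q1 q2 m) :
    ContDiffOn ℝ 1 q (Set.Ioo 0 10000) ∧ ContDiffOn ℝ 1 q1 (Set.Ioo 0 10000) := by
  have hcq : ContinuousOn q (Set.Ioo 0 10000) := fun s hs => (hq.d0 s hs).continuousAt.continuousWithinAt
  have hcq1 : ContinuousOn q1 (Set.Ioo 0 10000) := fun s hs => (hq.d1 s hs).continuousAt.continuousWithinAt
  have hcq2 : ContinuousOn q2 (Set.Ioo 0 10000) := by
    have h1 : ContinuousOn (fun s => (q s / 4 - q1 s) / s) (Set.Ioo 0 10000) :=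
      ((hcq.div_const 4).sub hcq1).div continuousOn_id (fun s hs => hs.1.ne')
    refine h1.congr fun s hs => ?_
    have := hq.eqn s hs
    have hs0 := hs.1.ne'
    field_simp
    linarith
  have key : ∀ f f' : ℝ → ℝ, (∀ s ∈ Set.Ioo (0:ℝ) 10000, HasDerivAt f (f' s) s) →
      ContinuousOn f' (Set.Ioo 0 10000) → ContDiffOn ℝ 1 f (Set.Ioo 0 10000) := by
    intro f f' hf hf'
    rw [show (1 : WithTop ℕ∞) = 0 + 1 by norm_num, contDiffOn_succ_iff_deriv_of_isOpen isOpen_Ioo]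
    refine ⟨fun s hs => (hf s hs).differentiableAt.differentiableWithinAt, by simp, ?_⟩
    rw [contDiffOn_zero]
    exact hf'.congr fun s hs => (hf s hs).deriv
  exact ⟨key _ _ hq.d0 hcq1, key _ _ hq.d1 hcq2⟩

/-- squared tangential distance -/
def sf (L : ℂ →ₗᵢ[ℝ] E3) (z₀ x : E3) : ℝ := ‖fr L (x - z₀)‖ ^ 2
/-- tangential displacement -/
def pf (L : ℂ →ₗᵢ[ℝ] E3) (z₀ x : E3) : E3 := L (fr L (x - z₀))
/-- projection onto the tangent plane as a continuous linear map -/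
def Pm (L : ℂ →ₗᵢ[ℝ] E3) : E3 →L[ℝ] E3 := L.toContinuousLinearMap.comp (fr L)
/-- gradient of the approximate Green function -/
def Yf (L : ℂ →ₗᵢ[ℝ] E3) (z₀ : E3) (ζ : E3 → ℝ) (q q1 : ℝ → ℝ) (x : E3) : E3 :=
  (2 * ζ x * q1 (sf L z₀ x)) • pf L z₀ x + q (sf L z₀ x) • gradient ζ x
/-- the Riesz isomorphism as a real-linear continuous map -/
def rz : (E3 →L[ℝ] ℝ) →L[ℝ] E3 := LinearMap.toContinuousLinearMap
  { toFun := fun f => (InnerProductSpace.toDual ℝ E3).symm f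
    map_add' := fun f g => map_add _ f g
    map_smul' := fun c f => by simp }

lemma rz_apply (f : E3 →L[ℝ] ℝ) : rz f = (InnerProductSpace.toDual ℝ E3).symm f := rfl

/-- Hessian of the cutoff -/
def Zf (ζ : E3 → ℝ) (x : E3) : E3 →L[ℝ] E3 :=
  rz.comp (fderiv ℝ (fderiv ℝ ζ) x)

lemma Pm_apply (L : ℂ →ₗᵢ[ℝ] E3) (h : E3) : Pm L h = L (fr L h) := rfl

lemma norm_pf (L : ℂ →ₗᵢ[ℝ] E3) (z₀ x : E3) : ‖pf L z₀ x‖ ^ 2 = sf L z₀ x := by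
  rw [pf, L.norm_map, sf]

lemma sf_nonneg (L : ℂ →ₗᵢ[ℝ] E3) (z₀ x : E3) : 0 ≤ sf L z₀ x := by unfold sf; positivity

lemma pf_inner (L : ℂ →ₗᵢ[ℝ] E3) (z₀ x h : E3) : (⟪pf L z₀ x, h⟫ : ℝ) = ⟪fr L (x - z₀), fr L h⟫ := by
  rw [pf, real_inner_comm, ← fr_inner, real_inner_comm]

lemma sf_contDiff (L : ℂ →ₗᵢ[ℝ] E3) (z₀ : E3) : ContDiff ℝ (⊤ : ℕ∞) (sf L z₀) := by
  have h1 : ContDiff ℝ (⊤ : ℕ∞) (fun x => fr L (x - z₀)) :=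
    (fr L).contDiff.comp (contDiff_id.sub contDiff_const)
  exact h1.norm_sq ℝ

lemma pf_contDiff (L : ℂ →ₗᵢ[ℝ] E3) (z₀ : E3) : ContDiff ℝ (⊤ : ℕ∞) (pf L z₀) := by
  exact (Pm L).contDiff.comp (contDiff_id.sub contDiff_const)

lemma sf_hasFDerivAt (L : ℂ →ₗᵢ[ℝ] E3) (z₀ x : E3) :
    HasFDerivAt (sf L z₀) ((2:ℝ) • innerSL ℝ (pf L z₀ x)) x := by
  have h1 : HasFDerivAt (fun x => fr L (x - z₀)) (fr L) x :=
    (fr L).hasFDerivAt.comp x ((hasFDerivAt_id x).sub_const z₀)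
  have h2 := h1.norm_sq
  refine h2.congr_fderiv ?_
  ext1 h
  simp only [smul_apply, innerSL_apply_apply, ContinuousLinearMap.comp_apply, pf_inner]
  first | rfl | simp

lemma pf_hasFDerivAt (L : ℂ →ₗᵢ[ℝ] E3) (z₀ x : E3) : HasFDerivAt (pf L z₀) (Pm L) x :=
  (Pm L).hasFDerivAt.comp x ((hasFDerivAt_id x).sub_const z₀)

section
variable {L : ℂ →ₗᵢ[ℝ] E3} {z₀ : E3} {ζ : E3 → ℝ} {q q1 q2 : ℝ → ℝ} {m : ℝ}

lemma gradient_contDiff (hζ : ContDiff ℝ (⊤ : ℕ∞) ζ) : ContDiff ℝ (⊤ : ℕ∞) (gradient ζ) := by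
  have h1 : ContDiff ℝ (⊤ : ℕ∞) (fderiv ℝ ζ) := hζ.fderiv_right (by simp)
  exact rz.contDiff.comp h1

lemma gradient_hasFDerivAt (hζ : ContDiff ℝ (⊤ : ℕ∞) ζ) (x : E3) :
    HasFDerivAt (gradient ζ) (Zf ζ x) x := by
  have h1 : ContDiff ℝ (⊤ : ℕ∞) (fderiv ℝ ζ) := hζ.fderiv_right (by simp)
  have h2 : HasFDerivAt (fderiv ℝ ζ) (fderiv ℝ (fderiv ℝ ζ) x) x :=
    (h1.differentiable (by simp) x).hasFDerivAt
  exact rz.hasFDerivAt.comp x h2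

lemma norm_Zf (x : E3) : ‖Zf ζ x‖ ≤ ‖fderiv ℝ (fderiv ℝ ζ) x‖ := by
  refine ContinuousLinearMap.opNorm_le_bound _ (norm_nonneg (fderiv ℝ (fderiv ℝ ζ) x)) fun h => ?_
  have : ‖Zf ζ x h‖ = ‖fderiv ℝ (fderiv ℝ ζ) x h‖ :=
    (InnerProductSpace.toDual ℝ E3).symm.norm_map _
  rw [this]
  exact ContinuousLinearMap.le_opNorm _ _

lemma norm_gradient (x : E3) : ‖gradient ζ x‖ = ‖fderiv ℝ ζ x‖ :=
  (InnerProductSpace.toDual ℝ E3).symm.norm_map _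

lemma g_hasFDerivAt (hq : QF q q1 q2 m) (hζ : ContDiff ℝ (⊤ : ℕ∞) ζ) {x : E3}
    (hs : sf L z₀ x ∈ Set.Ioo (0:ℝ) 10000) :
    HasFDerivAt (fun x => ζ x * q (sf L z₀ x)) (innerSL ℝ (Yf L z₀ ζ q q1 x)) x := by
  have h1 := (hq.d0 _ hs).comp_hasFDerivAt x (sf_hasFDerivAt L z₀ x)
  have h2 : HasFDerivAt ζ (fderiv ℝ ζ x) x := (hζ.differentiable (by simp) x).hasFDerivAt
  refine (h2.mul h1).congr_fderiv ?_
  ext h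
  simp only [Yf, add_apply, smul_apply, innerSL_apply_apply,
    inner_add_left, inner_smul_left, inner_gradient, smul_eq_mul, Function.comp_apply]
  simp only [conj_trivial]
  ring

lemma Y_contDiffAt (hq : QF q q1 q2 m) (hζ : ContDiff ℝ (⊤ : ℕ∞) ζ) {x : E3}
    (hs : sf L z₀ x ∈ Set.Ioo (0:ℝ) 10000) : ContDiffAt ℝ 1 (Yf L z₀ ζ q q1) x := by
  have hle : (1 : WithTop ℕ∞) ≤ ((⊤ : ℕ∞) : WithTop ℕ∞) := by exact_mod_cast le_top
  have hsx := ((sf_contDiff L z₀).of_le hle).contDiffAt (x := x)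
  have h1 : ContDiffAt ℝ 1 (fun x => q (sf L z₀ x)) x :=
    (hq.contDiffOn.1.contDiffAt (isOpen_Ioo.mem_nhds hs)).comp x hsx
  have h2 : ContDiffAt ℝ 1 (fun x => q1 (sf L z₀ x)) x :=
    (hq.contDiffOn.2.contDiffAt (isOpen_Ioo.mem_nhds hs)).comp x hsx
  have h3 := (hζ.of_le hle).contDiffAt (x := x)
  exact (((contDiffAt_const.mul h3).mul h2).smul ((pf_contDiff L z₀).of_le hle).contDiffAt).add
    (h1.smul ((gradient_contDiff hζ).of_le hle).contDiffAt)

lemma Y_hasFDerivAt (hq : QF q q1 q2 m) (hζ : ContDiff ℝ (⊤ : ℕ∞) ζ) {x : E3}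
    (hs : sf L z₀ x ∈ Set.Ioo (0:ℝ) 10000) :
    ∃ D : E3 →L[ℝ] E3, HasFDerivAt (Yf L z₀ ζ q q1) D x ∧ ∀ h, D h =
      (2 * ζ x * q1 (sf L z₀ x)) • Pm L h + (4 * ζ x * q2 (sf L z₀ x) * ⟪pf L z₀ x, h⟫) • pf L z₀ x
      + (2 * q1 (sf L z₀ x) * ⟪gradient ζ x, h⟫) • pf L z₀ x
      + (2 * q1 (sf L z₀ x) * ⟪pf L z₀ x, h⟫) • gradient ζ x + q (sf L z₀ x) • Zf ζ x h := by
  have h0 := (hq.d0 _ hs).comp_hasFDerivAt x (sf_hasFDerivAt L z₀ x)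
  have h1 := (hq.d1 _ hs).comp_hasFDerivAt x (sf_hasFDerivAt L z₀ x)
  have h2 : HasFDerivAt ζ (fderiv ℝ ζ x) x := (hζ.differentiable (by simp) x).hasFDerivAt
  have h3 := (((h2.const_mul 2).mul h1).smul (pf_hasFDerivAt L z₀ x)).add
    (h0.smul (gradient_hasFDerivAt hζ x))
  refine ⟨_, h3, fun h => ?_⟩
  simp only [add_apply, smul_apply, innerSL_apply_apply,
    inner_gradient, smul_eq_mul, Function.comp_apply, ContinuousLinearMap.smulRight_apply, Pi.mul_apply]
  module

lemma tr_Pm {n : E3} (hL : IsFrame n L) (hn : ‖n‖ = 1) : tr (Pm L) = 2 := by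
  have h1 : ∀ i, (Pm L (bv i)) i = 1 - (n i) ^ 2 := by
    intro i
    have h2 : (Pm L (bv i)) i = ⟪Pm L (bv i), bv i⟫ := by
      rw [inner_E3]; fin_cases i <;> simp [bv]
    have h3 := hL.norm_sq hn (bv i)
    have h4 : (⟪n, bv i⟫ : ℝ) = n i := by rw [inner_E3]; fin_cases i <;> simp [bv]
    rw [bv_norm, h4] at h3
    rw [h2, Pm_apply, real_inner_comm, ← fr_inner, real_inner_self_eq_norm_sq]
    linarith
  have h5 : (n 0) ^ 2 + (n 1) ^ 2 + (n 2) ^ 2 = 1 := by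
    have := inner_E3 n n
    rw [real_inner_self_eq_norm_sq, hn] at this
    linarith
  rw [tr, h1, h1, h1]; linarith

lemma tr_formula {D P Z : E3 →L[ℝ] E3} {p g : E3} {a b c d : ℝ}
    (hD : ∀ h, D h = a • P h + (b * ⟪p, h⟫) • p + (c * ⟪g, h⟫) • p + (c * ⟪p, h⟫) • g + d • Z h) :
    tr D = a * tr P + b * ⟪p, p⟫ + 2 * c * ⟪g, p⟫ + d * tr Z := by
  have hb : ∀ (g : E3) i, (⟪g, bv i⟫ : ℝ) = g i := by
    intro g i; rw [inner_E3]; fin_cases i <;> simp [bv]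
  simp only [tr, hD, hb, PiLp.add_apply, PiLp.smul_apply, smul_eq_mul, inner_E3]
  ring

end

end AG

namespace AG

/-- everything that is fixed in the argument at a given point `z₀` -/
structure Setup (Srf : SmoothSurface) (r₁ Cζ Λ Cn C m : ℝ) (z₀ : E3) (L : ℂ →ₗᵢ[ℝ] E3)
    (ζ : E3 → ℝ) (q q1 q2 : ℝ → ℝ) : Prop where
  hz : z₀ ∈ Srf.S
  frame : IsFrame (Srf.n z₀) L
  hq : QF q q1 q2 m
  cut : IsCutoff z₀ r₁ Cζ ζ
  r0 : 0 < r₁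
  r1 : r₁ ≤ 1
  L0 : 0 ≤ Λ
  lip : ∀ x ∈ Srf.S, ‖Srf.n x - Srf.n z₀‖ ≤ Λ * ‖x - z₀‖
  N0 : 0 ≤ Cn
  nb : ∀ x ∈ Srf.S, ‖fderiv ℝ Srf.n x‖ ≤ Cn
  C1 : 1 ≤ C
  low : ∀ x ∈ Srf.S, ‖x - z₀‖ ≤ 3 / 2 * r₁ → ‖x - z₀‖ ≤ C * ‖fr L (x - z₀)‖

section
variable {Srf : SmoothSurface} {r₁ Cζ Λ Cn C m : ℝ} {z₀ : E3} {L : ℂ →ₗᵢ[ℝ] E3}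
    {ζ : E3 → ℝ} {q q1 q2 : ℝ → ℝ}

lemma Setup.sf_mem (h : Setup Srf r₁ Cζ Λ Cn C m z₀ L ζ q q1 q2) {x : E3} (hx : x ∈ Srf.S)
    (hne : x ≠ z₀) (hr : ‖x - z₀‖ ≤ 3 / 2 * r₁) :
    0 < ‖fr L (x - z₀)‖ ∧ sf L z₀ x ∈ Set.Ioo (0:ℝ) 10000 := by
  have h1 := h.low x hx hr
  have h2 : 0 < ‖x - z₀‖ := norm_pos_iff.2 (sub_ne_zero.2 hne)
  have h3 : 0 < ‖fr L (x - z₀)‖ := by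
    by_contra h0
    have h4 : ‖fr L (x - z₀)‖ = 0 := le_antisymm (not_lt.1 h0) (norm_nonneg _)
    rw [h4] at h1; linarith
  have h4 := h.frame.norm_fr_le (Srf.n_unit _ h.hz) (x - z₀)
  have h5 : ‖fr L (x - z₀)‖ ≤ 2 := by linarith [h.r1]
  refine ⟨h3, ?_, ?_⟩
  · unfold sf; positivity
  · unfold sf; nlinarith

lemma Setup.cases (h : Setup Srf r₁ Cζ Λ Cn C m z₀ L ζ q q1 q2) (x : E3) :
    ‖x - z₀‖ ≤ 3 / 2 * r₁ ∨ ∀ᶠ x' in nhds x, ζ x' = 0 := by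
  by_cases hx : x ∈ tsupport ζ
  · left
    have := h.cut.2.1 hx
    rwa [mem_closedBall, dist_eq_norm] at this
  · right
    exact notMem_tsupport_iff_eventuallyEq.1 hx

lemma ev_zero {ζ : E3 → ℝ} {x : E3} {c : ℝ} (hx : ∀ᶠ x' in nhds x, ζ x' = c) :
    (∀ᶠ x' in nhds x, gradient ζ x' = 0) ∧ Zf ζ x = 0 := by
  have h1 : ∀ᶠ x' in nhds x, fderiv ℝ ζ x' = 0 := by
    filter_upwards [hx.eventually_nhds] with x' hx'
    have : ζ =ᶠ[nhds x'] fun _ => c := hx'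
    rw [this.fderiv_eq]; simp
  constructor
  · filter_upwards [h1] with x' hx'
    unfold gradient; rw [hx']; simp
  · have : fderiv ℝ ζ =ᶠ[nhds x] fun _ => 0 := h1
    unfold Zf; rw [this.fderiv_eq]; simp

lemma Setup.Cζ0 (h : Setup Srf r₁ Cζ Λ Cn C m z₀ L ζ q q1 q2) : 0 ≤ Cζ := by
  have := h.cut.2.2.2 z₀
  have h1 := abs_nonneg (ζ z₀)
  have h2 := norm_nonneg (fderiv ℝ ζ z₀)
  have h3 := norm_nonneg (fderiv ℝ (fderiv ℝ ζ) z₀)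
  linarith

lemma Setup.zb (h : Setup Srf r₁ Cζ Λ Cn C m z₀ L ζ q q1 q2) (x : E3) :
    |ζ x| ≤ Cζ ∧ ‖gradient ζ x‖ ≤ Cζ ∧ ‖Zf ζ x‖ ≤ Cζ := by
  have := h.cut.2.2.2 x
  have h1 := abs_nonneg (ζ x)
  have h2 := norm_nonneg (fderiv ℝ ζ x)
  have h3 := norm_nonneg (fderiv ℝ (fderiv ℝ ζ) x)
  have h4 := norm_Zf (ζ := ζ) x
  rw [norm_gradient]
  refine ⟨?_, ?_, ?_⟩ <;> linarith

lemma Setup.gb (h : Setup Srf r₁ Cζ Λ Cn C m z₀ L ζ q q1 q2) {x : E3} (hx : x ∈ Srf.S)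
    (hr : ‖x - z₀‖ ≤ 3 / 2 * r₁) :
    ‖gradient ζ x‖ ≤ Cζ * C / r₁ * ‖fr L (x - z₀)‖ ∧ ‖Zf ζ x‖ ≤ Cζ * C / r₁ * ‖fr L (x - z₀)‖ := by
  have hC := h.C1
  have hr0 := h.r0
  have hz := h.Cζ0
  by_cases hlt : ‖x - z₀‖ < r₁
  · have h1 : ∀ᶠ x' in nhds x, ζ x' = 1 := by
      have : x ∈ ball z₀ r₁ := by rwa [mem_ball, dist_eq_norm]
      filter_upwards [isOpen_ball.mem_nhds this] with x' hx'
      exact h.cut.2.2.1 x' (ball_subset_closedBall hx')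
    obtain ⟨h2, h3⟩ := ev_zero h1
    rw [h2.self_of_nhds, h3, norm_zero, norm_zero]
    constructor <;> positivity
  · have h1 := h.low x hx hr
    have h2 : Cζ ≤ Cζ * C / r₁ * ‖fr L (x - z₀)‖ := by
      have : Cζ * C / r₁ * ‖fr L (x - z₀)‖ = Cζ * ((C * ‖fr L (x - z₀)‖) / r₁) := by ring
      rw [this]
      refine le_mul_of_one_le_right hz ?_
      rw [le_div_iff₀ hr0]; linarith
    obtain ⟨-, h3, h4⟩ := h.zb x
    exact ⟨h3.trans h2, h4.trans h2⟩

lemma Setup.fn (h : Setup Srf r₁ Cζ Λ Cn C m z₀ L ζ q q1 q2) {x : E3} (hx : x ∈ Srf.S)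
    (hr : ‖x - z₀‖ ≤ 3 / 2 * r₁) : ‖fr L (Srf.n x)‖ ≤ Λ * C * ‖fr L (x - z₀)‖ := by
  have h0 : fr L (Srf.n z₀) = 0 := by
    refine ext_inner_right ℝ fun e => ?_
    rw [fr_inner, h.frame.inner_n, inner_zero_left]
  have h1 : fr L (Srf.n x) = fr L (Srf.n x - Srf.n z₀) := by rw [map_sub, h0, sub_zero]
  rw [h1]
  refine (h.frame.norm_fr_le (Srf.n_unit _ h.hz) _).trans ((h.lip x hx).trans ?_)
  rw [mul_assoc]
  exact mul_le_mul_of_nonneg_left (h.low x hx hr) h.L0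

lemma Setup.qb (h : Setup Srf r₁ Cζ Λ Cn C m z₀ L ζ q q1 q2) {x : E3} (hx : x ∈ Srf.S)
    (hne : x ≠ z₀) (hr : ‖x - z₀‖ ≤ 3 / 2 * r₁) :
    |q1 (sf L z₀ x)| * ‖fr L (x - z₀)‖ ^ 2 ≤ m ∧ |q2 (sf L z₀ x)| * ‖fr L (x - z₀)‖ ^ 4 ≤ 2 * m ∧
    0 ≤ q (sf L z₀ x) ∧ q (sf L z₀ x) * ‖fr L (x - z₀)‖ ≤ 6 * m := by
  obtain ⟨h0, hs⟩ := h.sf_mem hx hne hr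
  have h1 := h.hq.b1 _ hs
  have h2 := h.hq.b2 _ hs
  have h3 := h.hq.b0' _ hs
  have h4 := h.hq.nonneg _ hs
  rw [abs_mul, abs_of_pos hs.1] at h1
  rw [abs_mul, abs_of_nonneg (sq_nonneg _)] at h2
  have e : √(sf L z₀ x) = ‖fr L (x - z₀)‖ := by unfold sf; exact Real.sqrt_sq (norm_nonneg _)
  rw [e] at h3
  have e2 : sf L z₀ x = ‖fr L (x - z₀)‖ ^ 2 := rfl
  refine ⟨?_, ?_, h4, by linarith⟩
  · calc |q1 (sf L z₀ x)| * ‖fr L (x - z₀)‖ ^ 2 = sf L z₀ x * |q1 (sf L z₀ x)| := by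
          rw [← e2]; ring
      _ ≤ m := h1
  · calc |q2 (sf L z₀ x)| * ‖fr L (x - z₀)‖ ^ 4 = (sf L z₀ x) ^ 2 * |q2 (sf L z₀ x)| := by
          conv_rhs => rw [show (sf L z₀ x) ^ 2 = ‖fr L (x - z₀)‖ ^ 4 by rw [e2]; ring]
          ring
      _ ≤ 2 * m := h2

lemma Setup.sing (h : Setup Srf r₁ Cζ Λ Cn C m z₀ L ζ q q1 q2) {x : E3} (hx : x ∈ Srf.S)
    (hne : x ≠ z₀) :
    ‖Yf L z₀ ζ q q1 x‖ ≤ 8 * Cζ * m * C * ‖x - z₀‖⁻¹ ∧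
    |ζ x * q (sf L z₀ x)| ≤ 8 * Cζ * m * C * ‖x - z₀‖⁻¹ := by
  have hC := h.C1
  have hz := h.Cζ0
  have hm := h.hq.mpos
  have hx0 : 0 < ‖x - z₀‖ := norm_pos_iff.2 (sub_ne_zero.2 hne)
  have hR : 0 ≤ 8 * Cζ * m * C * ‖x - z₀‖⁻¹ := by positivity
  rcases h.cases x with hr | h0
  swap
  · have h1 := (ev_zero h0).1.self_of_nhds
    have h2 := h0.self_of_nhds
    unfold Yf
    rw [h1, h2]; simpa using hR
  obtain ⟨h0, hs⟩ := h.sf_mem hx hne hr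
  obtain ⟨b1, -, b0n, b0⟩ := h.qb hx hne hr
  obtain ⟨z1, z2, -⟩ := h.zb x
  have hl := h.low x hx hr
  set ρ := ‖fr L (x - z₀)‖ with hρ
  have hY : ‖Yf L z₀ ζ q q1 x‖ ≤ 2 * Cζ * (|q1 (sf L z₀ x)| * ρ) + q (sf L z₀ x) * Cζ := by
    unfold Yf
    refine (norm_add_le _ _).trans ?_
    rw [norm_smul, norm_smul, Real.norm_eq_abs, Real.norm_eq_abs, abs_mul, abs_mul, abs_of_nonneg b0n,
      pf, L.norm_map, ← hρ, abs_two]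
    have e : 2 * |ζ x| * |q1 (sf L z₀ x)| * ρ = 2 * |ζ x| * (|q1 (sf L z₀ x)| * ρ) := by ring
    rw [e]; gcongr
  have hinv : ρ⁻¹ ≤ C * ‖x - z₀‖⁻¹ := by
    rw [inv_le_iff_one_le_mul₀ h0]
    rw [mul_assoc, ← div_eq_inv_mul, ← mul_div_assoc, le_div_iff₀ hx0]; linarith
  have k1 : |q1 (sf L z₀ x)| * ρ ≤ m * ρ⁻¹ := by
    rw [← div_eq_mul_inv, le_div_iff₀ h0]; nlinarith
  have k0 : q (sf L z₀ x) ≤ 6 * m * ρ⁻¹ := by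
    rw [← div_eq_mul_inv, le_div_iff₀ h0]; exact b0
  have hfin : 8 * Cζ * m * ρ⁻¹ ≤ 8 * Cζ * m * C * ‖x - z₀‖⁻¹ := by
    rw [mul_assoc (8 * Cζ * m)]; gcongr
  constructor
  · refine hY.trans (le_trans ?_ hfin)
    calc 2 * Cζ * (|q1 (sf L z₀ x)| * ρ) + q (sf L z₀ x) * Cζ ≤ 2 * Cζ * (m * ρ⁻¹) + 6 * m * ρ⁻¹ * Cζ := by
          gcongr
      _ = 8 * Cζ * m * ρ⁻¹ := by ring
  · rw [abs_mul, abs_of_nonneg b0n]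
    refine le_trans ?_ hfin
    have hp : 0 ≤ Cζ * m * ρ⁻¹ := by positivity
    calc |ζ x| * q (sf L z₀ x) ≤ Cζ * (6 * m * ρ⁻¹) := by gcongr
      _ ≤ 8 * Cζ * m * ρ⁻¹ := by linarith

/-- constant in the pointwise estimate -/
def CE (r₁ Cζ Λ Cn C m : ℝ) : ℝ := 32 * m * (Cζ * C / r₁) + 10 * Cζ * (Λ * C) ^ 2 * m +
  (2 * Cζ * (Λ * C) * m + 6 * m * (Cζ * C / r₁)) * (4 * Cn)

lemma Setup.CE0 (h : Setup Srf r₁ Cζ Λ Cn C m z₀ L ζ q q1 q2) : 0 ≤ CE r₁ Cζ Λ Cn C m := by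
  have hC := h.C1
  have hz := h.Cζ0
  have hm := h.hq.mpos
  have := h.r0
  have := h.L0
  have := h.N0
  unfold CE; positivity

lemma num_bound {ζ q q1 q2 ρ F t u gp trZ nZ k A G Λ K m : ℝ} (hρ : 0 ≤ ρ) (hq : 0 ≤ q) (hG : 0 ≤ G)
    (hΛ : 0 ≤ Λ)
    (b1 : |q1| * ρ ^ 2 ≤ m) (b2 : |q2| * ρ ^ 4 ≤ 2 * m) (b0 : q * ρ ≤ 6 * m) (hA : |ζ| ≤ A)
    (hF0 : 0 ≤ F) (hF : F ≤ Λ * ρ) (ht : |t| ≤ ρ * F) (ht' : |t| ≤ ρ) (hu : |u| ≤ G * ρ) (hgp : |gp| ≤ G * ρ * ρ)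
    (htr : |trZ| ≤ 3 * (G * ρ)) (hnZ : |nZ| ≤ G * ρ) (hk : |k| ≤ K) :
    |(-(2 * (2 * q1) * gp) - q * trZ + 2 * ζ * q1 * F ^ 2 + 4 * ζ * q2 * t ^ 2 + 2 * (2 * q1) * u * t
      + q * nZ - (2 * ζ * q1 * t + q * u) * k)| ≤
      32 * m * G + 10 * A * Λ ^ 2 * m + (2 * A * Λ * m + 6 * m * G) * K := by
  have hA0 : 0 ≤ A := (abs_nonneg _).trans hA
  have hq1 := abs_nonneg q1
  have hq2 := abs_nonneg q2
  have htΛ : |t| ≤ Λ * ρ ^ 2 := ht.trans (by nlinarith)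
  have hm : 0 ≤ m := le_trans (by positivity) b1
  have i1 : |2 * (2 * q1) * gp| ≤ 4 * m * G := by
    rw [abs_mul, abs_mul, abs_mul, abs_two]
    calc 2 * (2 * |q1|) * |gp| ≤ 2 * (2 * |q1|) * (G * ρ * ρ) := by gcongr
      _ = 4 * G * (|q1| * ρ ^ 2) := by ring
      _ ≤ 4 * G * m := by gcongr
      _ = _ := by ring
  have i2 : |q * trZ| ≤ 18 * m * G := by
    rw [abs_mul, abs_of_nonneg hq]
    calc q * |trZ| ≤ q * (3 * (G * ρ)) := by gcongr
      _ = 3 * G * (q * ρ) := by ring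
      _ ≤ 3 * G * (6 * m) := by gcongr
      _ = _ := by ring
  have i3 : |2 * ζ * q1 * F ^ 2| ≤ 2 * A * Λ ^ 2 * m := by
    rw [abs_mul, abs_mul, abs_mul, abs_two, abs_of_nonneg (sq_nonneg F)]
    calc 2 * |ζ| * |q1| * F ^ 2 ≤ 2 * A * |q1| * (Λ * ρ) ^ 2 := by gcongr
      _ = 2 * A * Λ ^ 2 * (|q1| * ρ ^ 2) := by ring
      _ ≤ _ := by gcongr
  have i4 : |4 * ζ * q2 * t ^ 2| ≤ 8 * A * Λ ^ 2 * m := by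
    rw [abs_mul, abs_mul, abs_mul, abs_pow, abs_of_pos (by norm_num : (0:ℝ) < 4)]
    calc 4 * |ζ| * |q2| * |t| ^ 2 ≤ 4 * A * |q2| * (Λ * ρ ^ 2) ^ 2 := by gcongr
      _ = 4 * A * Λ ^ 2 * (|q2| * ρ ^ 4) := by ring
      _ ≤ 4 * A * Λ ^ 2 * (2 * m) := by gcongr
      _ = _ := by ring
  have i5 : |2 * (2 * q1) * u * t| ≤ 4 * m * G := by
    rw [abs_mul, abs_mul, abs_mul, abs_mul, abs_two]
    calc 2 * (2 * |q1|) * |u| * |t| ≤ 2 * (2 * |q1|) * (G * ρ) * ρ := by gcongr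
      _ = 4 * G * (|q1| * ρ ^ 2) := by ring
      _ ≤ 4 * G * m := by gcongr
      _ = _ := by ring
  have i6 : |q * nZ| ≤ 6 * m * G := by
    rw [abs_mul, abs_of_nonneg hq]
    calc q * |nZ| ≤ q * (G * ρ) := by gcongr
      _ = G * (q * ρ) := by ring
      _ ≤ G * (6 * m) := by gcongr
      _ = _ := by ring
  have i7 : |(2 * ζ * q1 * t + q * u) * k| ≤ (2 * A * Λ * m + 6 * m * G) * K := by
    rw [abs_mul]
    have j1 : |2 * ζ * q1 * t| ≤ 2 * A * Λ * m := by
      rw [abs_mul, abs_mul, abs_mul, abs_two]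
      calc 2 * |ζ| * |q1| * |t| ≤ 2 * A * |q1| * (Λ * ρ ^ 2) := by gcongr
        _ = 2 * A * Λ * (|q1| * ρ ^ 2) := by ring
        _ ≤ _ := by gcongr
    have j2 : |q * u| ≤ 6 * m * G := by
      rw [abs_mul, abs_of_nonneg hq]
      calc q * |u| ≤ q * (G * ρ) := by gcongr
        _ = G * (q * ρ) := by ring
        _ ≤ G * (6 * m) := by gcongr
        _ = _ := by ring
    have := abs_add_le (2 * ζ * q1 * t) (q * u)
    gcongr; linarith
  rw [abs_le] at *
  constructor <;> linarith

/-- the pointwise key estimate -/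
lemma Setup.key (h : Setup Srf r₁ Cζ Λ Cn C m z₀ L ζ q q1 q2) {x : E3} (hx : x ∈ Srf.S)
    (hne : x ≠ z₀) (hr : ‖x - z₀‖ ≤ 3 / 2 * r₁) {D : E3 →L[ℝ] E3}
    (hD : ∀ h, D h =
      (2 * ζ x * q1 (sf L z₀ x)) • Pm L h + (4 * ζ x * q2 (sf L z₀ x) * ⟪pf L z₀ x, h⟫) • pf L z₀ x
      + (2 * q1 (sf L z₀ x) * ⟪gradient ζ x, h⟫) • pf L z₀ x
      + (2 * q1 (sf L z₀ x) * ⟪pf L z₀ x, h⟫) • gradient ζ x + q (sf L z₀ x) • Zf ζ x h) :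
    |ζ x * q (sf L z₀ x) - (⟪Srf.n x, Srf.n x⟫ * tr D - ⟪Srf.n x, D (Srf.n x)⟫
      + ⟪Srf.n x, fderiv ℝ Srf.n x (Yf L z₀ ζ q q1 x)⟫
      - ⟪Srf.n x, Yf L z₀ ζ q q1 x⟫ * tr (fderiv ℝ Srf.n x))| ≤ CE r₁ Cζ Λ Cn C m := by
  have hn := Srf.n_unit x hx
  obtain ⟨h0, hs⟩ := h.sf_mem hx hne hr
  obtain ⟨b1, b2, b0n, b0⟩ := h.qb hx hne hr
  obtain ⟨z1, -, -⟩ := h.zb x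
  obtain ⟨g1, g2⟩ := h.gb hx hr
  have hF := h.fn hx hr
  have heq := h.hq.eqn _ hs
  have hC := h.C1
  have hr0 := h.r0
  have hz := h.Cζ0
  have htr := tr_formula hD
  rw [tr_Pm h.frame (Srf.n_unit _ h.hz), real_inner_self_eq_norm_sq, norm_pf] at htr
  have hpn : ‖pf L z₀ x‖ = ‖fr L (x - z₀)‖ := by rw [pf, L.norm_map]
  -- tangential part of Y does not contribute
  obtain ⟨L1, δ, V, φ, hch⟩ := hasChart Srf hx
  have hN : (⟪Srf.n x, fderiv ℝ Srf.n x (Yf L z₀ ζ q q1 x)⟫ : ℝ) =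
      ⟪Srf.n x, Yf L z₀ ζ q q1 x⟫ * ⟪Srf.n x, fderiv ℝ Srf.n x (Srf.n x)⟫ := by
    conv_lhs => rw [hch.frame.decomp hn (Yf L z₀ ζ q q1 x)]
    rw [map_add, inner_add_right, n_deriv_tangent hch, map_smul, inner_smul_right, zero_add]
  have hnD : (⟪Srf.n x, D (Srf.n x)⟫ : ℝ) = 2 * ζ x * q1 (sf L z₀ x) * ‖fr L (Srf.n x)‖ ^ 2
      + 4 * ζ x * q2 (sf L z₀ x) * ⟪pf L z₀ x, Srf.n x⟫ ^ 2
      + 2 * (2 * q1 (sf L z₀ x)) * ⟪gradient ζ x, Srf.n x⟫ * ⟪pf L z₀ x, Srf.n x⟫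
      + q (sf L z₀ x) * ⟪Srf.n x, Zf ζ x (Srf.n x)⟫ := by
    have e1 : (⟪Srf.n x, Pm L (Srf.n x)⟫ : ℝ) = ‖fr L (Srf.n x)‖ ^ 2 := by
      rw [Pm_apply, ← fr_inner, real_inner_self_eq_norm_sq]
    rw [hD]
    simp only [inner_add_right, inner_smul_right, e1]
    rw [real_inner_comm (pf L z₀ x) (Srf.n x), real_inner_comm (gradient ζ x) (Srf.n x)]
    ring
  have hnY : (⟪Srf.n x, Yf L z₀ ζ q q1 x⟫ : ℝ) = 2 * ζ x * q1 (sf L z₀ x) * ⟪pf L z₀ x, Srf.n x⟫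
      + q (sf L z₀ x) * ⟪gradient ζ x, Srf.n x⟫ := by
    unfold Yf
    simp only [inner_add_right, inner_smul_right]
    rw [real_inner_comm (pf L z₀ x) (Srf.n x), real_inner_comm (gradient ζ x) (Srf.n x)]
  have hin : ∀ a : E3, |(⟪a, Srf.n x⟫ : ℝ)| ≤ ‖a‖ := fun a => by
    have := abs_real_inner_le_norm a (Srf.n x); rwa [hn, mul_one] at this
  have hin' : ∀ T : E3 →L[ℝ] E3, |(⟪Srf.n x, T (Srf.n x)⟫ : ℝ)| ≤ ‖T‖ := fun T => by
    rw [real_inner_comm]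
    refine (hin _).trans ?_
    have := T.le_opNorm (Srf.n x); rwa [hn, mul_one] at this
  have hfin := num_bound (ζ := ζ x) (q := q (sf L z₀ x)) (q1 := q1 (sf L z₀ x)) (q2 := q2 (sf L z₀ x))
    (ρ := ‖fr L (x - z₀)‖) (F := ‖fr L (Srf.n x)‖) (t := ⟪pf L z₀ x, Srf.n x⟫)
    (u := ⟪gradient ζ x, Srf.n x⟫) (gp := ⟪gradient ζ x, pf L z₀ x⟫) (trZ := tr (Zf ζ x))
    (nZ := ⟪Srf.n x, Zf ζ x (Srf.n x)⟫) (k := ⟪Srf.n x, fderiv ℝ Srf.n x (Srf.n x)⟫ - tr (fderiv ℝ Srf.n x))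
    (A := Cζ) (G := Cζ * C / r₁) (Λ := Λ * C) (K := 4 * Cn) (m := m) (norm_nonneg _) b0n (by positivity)
    (mul_nonneg h.L0 (by linarith)) b1 b2 b0 z1 (norm_nonneg _) hF
    (by rw [pf_inner]; exact abs_real_inner_le_norm _ _)
    (by rw [← hpn]; exact hin _) ((hin _).trans g1)
    (by
      refine (abs_real_inner_le_norm _ _).trans ?_
      rw [hpn]; gcongr)
    ((abs_tr_le _).trans (by gcongr)) ((hin' _).trans g2)
    (by
      have k1 := hin' (fderiv ℝ Srf.n x)
      have k2 := abs_tr_le (fderiv ℝ Srf.n x)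
      have k3 := h.nb x hx
      have k4 := abs_sub (⟪Srf.n x, fderiv ℝ Srf.n x (Srf.n x)⟫ : ℝ) (tr (fderiv ℝ Srf.n x))
      linarith)
  unfold CE
  refine le_trans (le_of_eq ?_) hfin
  congr 1
  rw [hN, hnD, hnY, htr, real_inner_self_eq_norm_sq, hn]
  linear_combination (-ζ x) * heq

end
end AG

namespace AG

section
variable {Srf : SmoothSurface} {r₁ Cζ Λ Cn C m : ℝ} {z₀ : E3} {L : ℂ →ₗᵢ[ℝ] E3} {ζ : E3 → ℝ}
  {q q1 q2 : ℝ → ℝ}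

/-- integrand of the bilinear form -/
def Gf (Srf : SmoothSurface) (L : ℂ →ₗᵢ[ℝ] E3) (z₀ : E3) (ζ : E3 → ℝ) (q q1 : ℝ → ℝ) (w : E3 → ℝ)
    (x : E3) : ℝ :=
  ⟪cr (Srf.n x) (gradient w x), cr (Srf.n x) (Yf L z₀ ζ q q1 x)⟫ + w x * (ζ x * q (sf L z₀ x))

/-- boundary term integrand -/
def Bf (Srf : SmoothSurface) (L : ℂ →ₗᵢ[ℝ] E3) (z₀ : E3) (ζ : E3 → ℝ) (q q1 : ℝ → ℝ) (w η : E3 → ℝ)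
    (x : E3) : ℝ :=
  w x * ⟪cr (Srf.n x) (gradient η x), cr (Srf.n x) (Yf L z₀ ζ q q1 x)⟫

lemma Yf_ev_zero {x : E3} (h0 : ∀ᶠ x' in nhds x, ζ x' = 0) :
    ∀ᶠ x' in nhds x, Yf L z₀ ζ q q1 x' = 0 := by
  filter_upwards [h0, (ev_zero h0).1] with x' h1 h2
  simp [Yf, h1, h2]

lemma Setup.Yc (h : Setup Srf r₁ Cζ Λ Cn C m z₀ L ζ q q1 q2) {x : E3} (hx : x ∈ Srf.S)
    (hne : x ≠ z₀) : ContDiffAt ℝ 1 (Yf L z₀ ζ q q1) x := by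
  rcases h.cases x with hr | h0
  · exact Y_contDiffAt h.hq h.cut.1 (h.sf_mem hx hne hr).2
  · have h1 : Yf L z₀ ζ q q1 =ᶠ[nhds x] fun _ => 0 := Yf_ev_zero h0
    exact contDiffAt_const.congr_of_eventuallyEq h1

lemma Setup.gd (h : Setup Srf r₁ Cζ Λ Cn C m z₀ L ζ q q1 q2) {x : E3} (hx : x ∈ Srf.S)
    (hne : x ≠ z₀) :
    HasFDerivAt (fun x => ζ x * q (sf L z₀ x)) (innerSL ℝ (Yf L z₀ ζ q q1 x)) x := by
  rcases h.cases x with hr | h0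
  · exact g_hasFDerivAt h.hq h.cut.1 (h.sf_mem hx hne hr).2
  · have h1 : (fun x => ζ x * q (sf L z₀ x)) =ᶠ[nhds x] fun _ => 0 := by
      filter_upwards [h0] with x' h1
      simp [h1]
    have h2 : Yf L z₀ ζ q q1 x = 0 := (Yf_ev_zero h0).self_of_nhds
    rw [h2]
    simpa using (hasFDerivAt_const (0:ℝ) x).congr_of_eventuallyEq h1

lemma cr_zero_right (a : E3) : cr a 0 = 0 := by rw [← crL_apply]; simp
lemma cr_add_right (a b c : E3) : cr a (b + c) = cr a b + cr a c := by simp only [← crL_apply]; simp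
lemma cr_smul_right (a b : E3) (t : ℝ) : cr a (t • b) = t • cr a b := by simp only [← crL_apply]; simp

lemma Setup.Gc (h : Setup Srf r₁ Cζ Λ Cn C m z₀ L ζ q q1 q2) {w : E3 → ℝ} (hw : ContDiff ℝ 1 w)
    {x : E3} (hx : x ∈ Srf.S) (hne : x ≠ z₀) : ContinuousAt (Gf Srf L z₀ ζ q q1 w) x := by
  have hn := (n_contDiffAt Srf hx).continuousAt
  have hY := (h.Yc hx hne).continuousAt
  have hg := (h.gd hx hne).continuousAt
  have hwg : ContinuousAt (gradient w) x := by
    have := gradient_continuousOn (S := Set.univ) (α := w) (fun x _ => hw.contDiffAt)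
    exact this.continuousAt Filter.univ_mem
  have hcr : ∀ u v : E3 → E3, ContinuousAt u x → ContinuousAt v x →
      ContinuousAt (fun x => cr (u x) (v x)) x := fun u v hu hv =>
    continuous_cr.continuousAt.comp (f := fun x => (u x, v x)) (hu.prodMk hv)
  exact ((hcr _ _ hn hwg).inner (𝕜 := ℝ) (hcr _ _ hn hY)).add (hw.continuous.continuousAt.mul hg)

lemma Setup.Bc (h : Setup Srf r₁ Cζ Λ Cn C m z₀ L ζ q q1 q2) {w η : E3 → ℝ} (hw : ContDiff ℝ 1 w)
    (hη : ContDiff ℝ 1 η)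
    {x : E3} (hx : x ∈ Srf.S) (hne : x ≠ z₀) : ContinuousAt (Bf Srf L z₀ ζ q q1 w η) x := by
  have hn := (n_contDiffAt Srf hx).continuousAt
  have hY := (h.Yc hx hne).continuousAt
  have hwg : ContinuousAt (gradient η) x := by
    have := gradient_continuousOn (S := Set.univ) (α := η) (fun x _ => hη.contDiffAt)
    exact this.continuousAt Filter.univ_mem
  have hcr : ∀ u v : E3 → E3, ContinuousAt u x → ContinuousAt v x →
      ContinuousAt (fun x => cr (u x) (v x)) x := fun u v hu hv =>
    continuous_cr.continuousAt.comp (f := fun x => (u x, v x)) (hu.prodMk hv)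
  exact hw.continuous.continuousAt.mul ((hcr _ _ hn hwg).inner (𝕜 := ℝ) (hcr _ _ hn hY))

lemma Setup.point (h : Setup Srf r₁ Cζ Λ Cn C m z₀ L ζ q q1 q2) {w η : E3 → ℝ} (hw : ContDiff ℝ 1 w)
    (hη : ContDiff ℝ 1 η) (h0 : ∀ x, 0 ≤ η x) (h1 : ∀ x, η x ≤ 1)
    {x : E3} (hx : x ∈ Srf.S) (hne : x ≠ z₀) :
    |η x * Gf Srf L z₀ ζ q q1 w x + Bf Srf L z₀ ζ q q1 w η x
      - tw (Srf.n x) (fderiv ℝ (fun x => (w x * η x) • cr (Srf.n x) (Yf L z₀ ζ q q1 x)) x)| ≤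
      CE r₁ Cζ Λ Cn C m * |w x| := by
  have hCE := h.CE0
  rcases h.cases x with hr | hz
  · obtain ⟨D, hD, hDf⟩ := Y_hasFDerivAt h.hq h.cut.1 (h.sf_mem hx hne hr).2
    have hk := h.key hx hne hr hDf
    have hn : HasFDerivAt Srf.n (fderiv ℝ Srf.n x) x :=
      ((n_contDiffAt Srf hx).differentiableAt (by simp)).hasFDerivAt
    obtain ⟨T, hT, hTf⟩ := cr_hasFDerivAt hn hD
    have hw' := (hw.differentiable (by norm_num) x).hasFDerivAt
    have hη' := (hη.differentiable (by norm_num) x).hasFDerivAt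
    have hX := (hw'.mul hη').smul hT
    have hX2 := hX.fderiv
    have hX3 : fderiv ℝ (fun x => (w x * η x) • cr (Srf.n x) (Yf L z₀ ζ q q1 x)) x = _ := hX2
    have e1 : tw (Srf.n x) (fderiv ℝ (fun x => (w x * η x) • cr (Srf.n x) (Yf L z₀ ζ q q1 x)) x) = _ :=
      tw_formula (n := Srf.n x) (Y := Yf L z₀ ζ q q1 x) (g := w x • gradient η x + η x • gradient w x)
      (D := D) (N := fderiv ℝ Srf.n x) (Φ := w x * η x) (by
        intro e
        rw [hX3]
        simp [hTf, inner_add_left, inner_smul_left])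
    rw [e1]
    set M := (⟪Srf.n x, Srf.n x⟫ * tr D - ⟪Srf.n x, D (Srf.n x)⟫
      + ⟪Srf.n x, fderiv ℝ Srf.n x (Yf L z₀ ζ q q1 x)⟫
      - ⟪Srf.n x, Yf L z₀ ζ q q1 x⟫ * tr (fderiv ℝ Srf.n x)) with hM
    have e2 : η x * Gf Srf L z₀ ζ q q1 w x + Bf Srf L z₀ ζ q q1 w η x - (w x * η x * M +
        ⟪cr (Srf.n x) (w x • gradient η x + η x • gradient w x), cr (Srf.n x) (Yf L z₀ ζ q q1 x)⟫) =
        η x * (w x * (ζ x * q (sf L z₀ x) - M)) := by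
      rw [cr_add_right, cr_smul_right, cr_smul_right, inner_add_left, inner_smul_left, inner_smul_left]
      simp only [Gf, Bf, conj_trivial]
      ring
    rw [e2, abs_mul, abs_of_nonneg (h0 x), abs_mul]
    calc η x * (|w x| * |ζ x * q (sf L z₀ x) - M|) ≤ 1 * (|w x| * CE r₁ Cζ Λ Cn C m) := by
          gcongr
          exact h1 x
      _ = _ := by ring
  · have h2 := Yf_ev_zero (L := L) (z₀ := z₀) (q := q) (q1 := q1) hz
    have h3 : (fun x => (w x * η x) • cr (Srf.n x) (Yf L z₀ ζ q q1 x)) =ᶠ[nhds x] fun _ => 0 := by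
      filter_upwards [h2] with x' h'
      rw [h', cr_zero_right, smul_zero]
    rw [h3.fderiv_eq]
    have : η x * Gf Srf L z₀ ζ q q1 w x + Bf Srf L z₀ ζ q q1 w η x
      - tw (Srf.n x) (fderiv ℝ (fun _ => (0:E3)) x) = 0 := by
      simp [Gf, Bf, tw, h2.self_of_nhds, hz.self_of_nhds, cr_zero_right]
    rw [this, abs_zero]
    positivity

/-- The Stokes step with a cutoff near the pole. -/
lemma Setup.stokes (h : Setup Srf r₁ Cζ Λ Cn C m z₀ L ζ q q1 q2) {w η : E3 → ℝ} (hw : ContDiff ℝ 1 w)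
    (hη : ContDiff ℝ 1 η) (h0 : ∀ x, 0 ≤ η x) (h1 : ∀ x, η x ≤ 1) (hz : ∀ᶠ x in nhds z₀, η x = 0) :
    IntegrableOn (fun x => η x * Gf Srf L z₀ ζ q q1 w x) Srf.S μH[2] ∧
    IntegrableOn (Bf Srf L z₀ ζ q q1 w η) Srf.S μH[2] ∧
    |(∫ x in Srf.S, η x * Gf Srf L z₀ ζ q q1 w x ∂μH[2]) + ∫ x in Srf.S, Bf Srf L z₀ ζ q q1 w η x ∂μH[2]|
      ≤ CE r₁ Cζ Λ Cn C m * ∫ x in Srf.S, |w x| ∂μH[2] := by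
  have hSm : MeasurableSet Srf.S := Srf.compact.isClosed.measurableSet
  have hci : ∀ f : E3 → ℝ, ContinuousOn f Srf.S → IntegrableOn f Srf.S μH[2] := fun f hf =>
    hf.integrableOn_of_subset_isCompact Srf.compact hSm subset_rfl (measure_S_lt_top Srf).ne
  have hgz : ∀ᶠ x in nhds z₀, gradient η x = 0 := (ev_zero hz).1
  have hA : IntegrableOn (fun x => η x * Gf Srf L z₀ ζ q q1 w x) Srf.S μH[2] := by
    refine hci _ fun x hx => ContinuousAt.continuousWithinAt ?_
    by_cases hne : x = z₀
    · subst hne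
      have : (fun x' => η x' * Gf Srf L x ζ q q1 w x') =ᶠ[nhds x] fun _ => 0 := by
        filter_upwards [hz] with x' h'
        simp [h']
      exact continuousAt_const.congr this.symm
    · exact hη.continuous.continuousAt.mul (h.Gc hw hx hne)
  have hB : IntegrableOn (Bf Srf L z₀ ζ q q1 w η) Srf.S μH[2] := by
    refine hci _ fun x hx => ContinuousAt.continuousWithinAt ?_
    by_cases hne : x = z₀
    · subst hne
      have : (Bf Srf L x ζ q q1 w η) =ᶠ[nhds x] fun _ => 0 := by
        filter_upwards [hgz] with x' h'
        simp [Bf, h', cr_zero_right]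
      exact continuousAt_const.congr this.symm
    · exact h.Bc hw hη hx hne
  have hW : IntegrableOn (fun x => |w x|) Srf.S μH[2] := hci _ hw.continuous.abs.continuousOn
  obtain ⟨hT, hT0⟩ := stokes_vec Srf (X := fun x => (w x * η x) • cr (Srf.n x) (Yf L z₀ ζ q q1 x)) (by
    intro x hx
    by_cases hne : x = z₀
    · subst hne
      have : (fun x' => (w x' * η x') • cr (Srf.n x') (Yf L x ζ q q1 x')) =ᶠ[nhds x] fun _ => 0 := by
        filter_upwards [hz] with x' h'
        simp [h']
      exact contDiffAt_const.congr_of_eventuallyEq this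
    · exact (hw.contDiffAt.mul hη.contDiffAt).smul (cr_contDiffAt ((n_contDiffAt Srf hx).of_le
        (by exact_mod_cast le_top)) (h.Yc hx hne)))
  have e : (∫ x in Srf.S, η x * Gf Srf L z₀ ζ q q1 w x ∂μH[2]) + ∫ x in Srf.S, Bf Srf L z₀ ζ q q1 w η x ∂μH[2]
      = ∫ x in Srf.S, (η x * Gf Srf L z₀ ζ q q1 w x + Bf Srf L z₀ ζ q q1 w η x
      - tw (Srf.n x) (fderiv ℝ (fun x => (w x * η x) • cr (Srf.n x) (Yf L z₀ ζ q q1 x)) x)) ∂μH[2] := by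
    have hAB : IntegrableOn (fun x => η x * Gf Srf L z₀ ζ q q1 w x + Bf Srf L z₀ ζ q q1 w η x) Srf.S μH[2] :=
      hA.add hB
    rw [integral_sub hAB hT, hT0, sub_zero, integral_add hA hB]
  refine ⟨hA, hB, ?_⟩
  rw [e, ← integral_const_mul]
  refine (abs_integral_le_integral_abs).trans ?_
  refine setIntegral_mono_on ((hA.add hB).sub hT).abs (hW.const_mul _) hSm fun x hx => ?_
  by_cases hne : x = z₀
  · subst hne
    have h3 : (fun x' => (w x' * η x') • cr (Srf.n x') (Yf L x ζ q q1 x')) =ᶠ[nhds x] fun _ => 0 := by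
      filter_upwards [hz] with x' h'
      simp [h']
    simp only [h3.fderiv_eq]
    have : η x * Gf Srf L x ζ q q1 w x + Bf Srf L x ζ q q1 w η x
      - tw (Srf.n x) (fderiv ℝ (fun _ => (0:E3)) x) = 0 := by
      simp [Gf, Bf, tw, hz.self_of_nhds, hgz.self_of_nhds, cr_zero_right]
    rw [this, abs_zero]
    exact mul_nonneg h.CE0 (abs_nonneg _)
  · exact h.point hw hη h0 h1 hx hne

end

end AG

namespace AG

/-- smooth step from 0 (below 1) to 1 (above 2) -/
def bt (t : ℝ) : ℝ := Real.smoothTransition (t - 1)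

lemma bt_contDiff : ContDiff ℝ 1 bt := by
  have h : ContDiff ℝ 1 Real.smoothTransition := Real.smoothTransition.contDiff
  exact h.comp (contDiff_id.sub contDiff_const)

lemma bt_lo {t : ℝ} (h : t ≤ 1) : bt t = 0 := Real.smoothTransition.zero_of_nonpos (by linarith)
lemma bt_hi {t : ℝ} (h : 2 ≤ t) : bt t = 1 := Real.smoothTransition.one_of_one_le (by linarith)
lemma bt_nonneg (t : ℝ) : 0 ≤ bt t := Real.smoothTransition.nonneg _
lemma bt_le_one (t : ℝ) : bt t ≤ 1 := Real.smoothTransition.le_one _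

lemma bt_mono : Monotone bt := fun a b h => Real.smoothTransition.monotone (by linarith)

lemma bt_deriv (t : ℝ) : HasDerivAt bt (deriv bt t) t :=
  (bt_contDiff.differentiable (by norm_num) t).hasDerivAt

lemma bt_deriv_nonneg (t : ℝ) : 0 ≤ deriv bt t := bt_mono.deriv_nonneg

lemma bt_deriv_lo {t : ℝ} (h : t < 1) : deriv bt t = 0 := by
  have : bt =ᶠ[nhds t] fun _ => 0 := by
    filter_upwards [Iio_mem_nhds h] with s hs
    exact bt_lo (le_of_lt hs)
  rw [this.deriv_eq]; simp

lemma bt_deriv_hi {t : ℝ} (h : 2 < t) : deriv bt t = 0 := by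
  have : bt =ᶠ[nhds t] fun _ => 1 := by
    filter_upwards [Ioi_mem_nhds h] with s hs
    exact bt_hi (le_of_lt hs)
  rw [this.deriv_eq]; simp

lemma bt_deriv_cont : Continuous (deriv bt) := bt_contDiff.continuous_deriv (by norm_num)

/-- approximate identity -/
def kk (N : ℝ) (y : ℂ) : ℝ := deriv bt (N * ‖y‖ ^ 2) * N

lemma kk_nonneg {N : ℝ} (hN : 0 < N) (y : ℂ) : 0 ≤ kk N y := mul_nonneg (bt_deriv_nonneg _) hN.le

lemma kk_int {N : ℝ} (hN : 0 < N) : Integrable (kk N) (μH[2] : Measure ℂ) ∧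
    ∫ y, kk N y ∂(μH[2] : Measure ℂ) = Lam := by
  have hd : ∀ t : ℝ, HasDerivAt (fun t => bt (N * t ^ 2)) (2 * (t * (deriv bt (N * t ^ 2) * N))) t := by
    intro t
    have h1 : HasDerivAt (fun t : ℝ => N * t ^ 2) (N * (2 * t)) t := by
      simpa using (hasDerivAt_pow 2 t).const_mul N
    have h2 := (bt_deriv (N * t ^ 2)).comp t h1
    exact h2.congr_deriv (by ring)
  have ht : Filter.Tendsto (fun t : ℝ => bt (N * t ^ 2)) Filter.atTop (nhds 1) := by
    refine tendsto_const_nhds.congr' ?_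
    have h3 : Filter.Tendsto (fun t : ℝ => N * t ^ 2) Filter.atTop Filter.atTop :=
      (Filter.tendsto_pow_atTop (by norm_num)).const_mul_atTop hN
    filter_upwards [h3.eventually_ge_atTop 2] with t ht
    exact (bt_hi ht).symm
  have hIntg := integrableOn_Ioi_deriv_of_nonneg' (a := (0:ℝ)) (fun t _ => hd t)
    (fun t ht => by
      have := bt_deriv_nonneg (N * t ^ 2)
      have : (0:ℝ) < t := ht
      positivity) ht
  have hval := integral_Ioi_of_hasDerivAt_of_nonneg' (a := (0:ℝ)) (fun t _ => hd t)
    (fun t ht => by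
      have := bt_deriv_nonneg (N * t ^ 2)
      have : (0:ℝ) < t := ht
      positivity) ht
  have hdim : Module.finrank ℝ ℂ - 1 = 1 := by rw [Complex.finrank_real_complex]
  constructor
  · have := (integrable_fun_norm_addHaar (μ := (μH[2] : Measure ℂ))
      (f := fun t => deriv bt (N * t ^ 2) * N)).2 (by
        rw [hdim]
        have h4 : IntegrableOn (fun t => (1/2) * (2 * (t * (deriv bt (N * t ^ 2) * N)))) (Set.Ioi (0:ℝ)) :=
          hIntg.const_mul (1/2)
        refine h4.congr_fun (fun t _ => ?_) measurableSet_Ioi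
        simp only [smul_eq_mul, pow_one]; ring)
    exact this
  · have := integral_fun_norm_addHaar (μ := (μH[2] : Measure ℂ)) (fun t => deriv bt (N * t ^ 2) * N)
    rw [hdim, Complex.finrank_real_complex] at this
    unfold kk
    rw [this]
    rw [integral_const_mul] at hval
    simp only [smul_eq_mul, pow_one, nsmul_eq_mul]
    have e : bt (N * 0 ^ 2) = 0 := bt_lo (by norm_num)
    rw [e] at hval
    have e2 : (μH[2] : Measure ℂ).real (ball 0 1) = Lam := rfl
    rw [e2]
    have : ((2:ℕ):ℝ) = 2 := by norm_num
    rw [this]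
    linear_combination Lam * hval

lemma kk_supp {N ρ : ℝ} (hN : 0 < N) (hρ : 0 < ρ) (h : 2 < N * ρ ^ 2) {y : ℂ} (hy : kk N y ≠ 0) :
    y ≠ 0 ∧ ‖y‖ < ρ := by
  constructor
  · rintro rfl
    exact hy (by simp [kk, bt_deriv_lo])
  · by_contra hc
    push Not at hc
    refine hy ?_
    have : N * ρ ^ 2 ≤ N * ‖y‖ ^ 2 := by gcongr
    unfold kk
    rw [bt_deriv_hi (by linarith), zero_mul]

lemma kk_limit {δ F0 : ℝ} (hδ : 0 < δ) {F : ℂ → ℝ} (hF : Filter.Tendsto F (nhdsWithin 0 {0}ᶜ) (nhds F0))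
    {I : ℕ → ℝ}
    (hI : ∀ᶠ k : ℕ in Filter.atTop, IntegrableOn (fun y => kk k y * F y) (ball (0:ℂ) δ) μH[2] ∧
      I k = ∫ y in ball (0:ℂ) δ, kk k y * F y ∂μH[2]) :
    Filter.Tendsto I Filter.atTop (nhds (Lam * F0)) := by
  rw [Metric.tendsto_atTop']
  have hLam := Lam_pos
  intro e he
  have hev := hF (Metric.ball_mem_nhds F0 (show 0 < e / (2 * Lam) by positivity))
  rw [Filter.mem_map, Metric.mem_nhdsWithin_iff] at hev
  obtain ⟨ρ, hρ, hsub⟩ := hev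
  set ρ' := min ρ δ with hρ'
  have hρ0 : 0 < ρ' := lt_min hρ hδ
  have hlarge : ∀ᶠ k : ℕ in Filter.atTop, 2 < (k:ℝ) * ρ' ^ 2 :=
    (tendsto_natCast_atTop_atTop.atTop_mul_const (by positivity)).eventually_gt_atTop 2
  have := (hI.and (hlarge.and (Filter.eventually_gt_atTop 0))).exists_forall_of_atTop
  obtain ⟨K, hK⟩ := this
  refine ⟨K, fun k hk => ?_⟩
  obtain ⟨⟨h1, h2⟩, h3, h4⟩ := hK k hk.le
  have hk0 : (0:ℝ) < k := by exact_mod_cast h4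
  obtain ⟨k1, k2⟩ := kk_int hk0
  have e1 : ∫ y in ball (0:ℂ) δ, kk k y ∂μH[2] = Lam := by
    rw [← k2]
    refine setIntegral_eq_integral_of_forall_compl_eq_zero fun y hy => ?_
    by_contra hc
    have := (kk_supp hk0 hρ0 h3 hc).2
    refine hy ?_
    rw [mem_ball_zero_iff]
    exact this.trans_le (min_le_right _ _)
  have e2 : I k - Lam * F0 = ∫ y in ball (0:ℂ) δ, kk k y * (F y - F0) ∂μH[2] := by
    have : ∀ y, kk k y * (F y - F0) = kk k y * F y - kk k y * F0 := fun y => by ring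
    simp only [this]
    rw [integral_sub h1 (k1.integrableOn.mul_const _), integral_mul_const, e1, h2]
  rw [Real.dist_eq, e2]
  have e3 : |∫ y in ball (0:ℂ) δ, kk k y * (F y - F0) ∂μH[2]| ≤
      ∫ y in ball (0:ℂ) δ, kk k y * (e / (2 * Lam)) ∂μH[2] := by
    rw [← Real.norm_eq_abs]
    refine norm_integral_le_of_norm_le (k1.integrableOn.mul_const _) (Filter.Eventually.of_forall fun y => ?_)
    rw [Real.norm_eq_abs, abs_mul, abs_of_nonneg (kk_nonneg hk0 y)]
    by_cases hc : kk k y = 0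
    · simp [hc]
    · obtain ⟨a, b⟩ := kk_supp hk0 hρ0 h3 hc
      have : F y ∈ ball F0 (e / (2 * Lam)) := hsub ⟨by
        rw [mem_ball_zero_iff]; exact b.trans_le (min_le_left _ _), a⟩
      rw [mem_ball, Real.dist_eq] at this
      exact mul_le_mul_of_nonneg_left this.le (kk_nonneg hk0 y)
  rw [integral_mul_const, e1] at e3
  have : Lam * (e / (2 * Lam)) = e / 2 := by field_simp
  linarith

end AG

namespace AG

section
variable {Srf : SmoothSurface} {r₁ Cζ Λ Cn C m : ℝ} {z₀ : E3} {L : ℂ →ₗᵢ[ℝ] E3} {ζ : E3 → ℝ}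
  {q q1 q2 : ℝ → ℝ}

/-- cutoff vanishing near the pole -/
def et (L : ℂ →ₗᵢ[ℝ] E3) (z₀ : E3) (N : ℝ) (x : E3) : ℝ := bt (N * sf L z₀ x)

lemma et_contDiff (N : ℝ) : ContDiff ℝ 1 (et L z₀ N) :=
  bt_contDiff.comp (contDiff_const.mul ((sf_contDiff L z₀).of_le (by exact_mod_cast le_top)))

lemma et_ev (N : ℝ) : ∀ᶠ x in nhds z₀, et L z₀ N x = 0 := by
  have h1 : Continuous (fun x => N * sf L z₀ x) := continuous_const.mul (sf_contDiff L z₀).continuous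
  have h2 : N * sf L z₀ z₀ < 1 := by simp [sf]
  filter_upwards [h1.continuousAt.eventually (Iio_mem_nhds h2)] with x hx
  exact bt_lo (le_of_lt hx)

lemma et_gradient (N : ℝ) (x : E3) :
    gradient (et L z₀ N) x = (2 * (deriv bt (N * sf L z₀ x) * N)) • pf L z₀ x := by
  have h1 := (bt_deriv (N * sf L z₀ x)).comp_hasFDerivAt x ((sf_hasFDerivAt L z₀ x).const_mul N)
  have h2 : fderiv ℝ (et L z₀ N) x = _ := h1.fderiv
  refine ext_inner_right ℝ fun e => ?_
  rw [inner_gradient, h2]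
  simp [inner_smul_left]
  ring

/-- limit density in the chart -/
def Ff (Srf : SmoothSurface) (L : ℂ →ₗᵢ[ℝ] E3) (q1 : ℝ → ℝ) (w : E3 → ℝ) (φ : ℂ → E3) (y : ℂ) : ℝ :=
  JJ φ y * w (φ y) * (4 * (‖y‖ ^ 2 * q1 (‖y‖ ^ 2))) * (1 - ⟪Srf.n (φ y), L y⟫ ^ 2 / ‖y‖ ^ 2)

lemma Setup.Ff_lim (h : Setup Srf r₁ Cζ Λ Cn C m z₀ L ζ q q1 q2) {δ : ℝ} {V : Set E3} {φ : ℂ → E3}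
    (hc : IsChart Srf z₀ L δ V φ) {w : E3 → ℝ} (hw : ContDiff ℝ 1 w) :
    Filter.Tendsto (Ff Srf L q1 w φ) (nhdsWithin 0 {0}ᶜ) (nhds (-(4 * m * w z₀))) := by
  have h0 : (0:ℂ) ∈ ball (0:ℂ) δ := mem_ball_self hc.pos
  have hφ : ContinuousAt φ 0 := (hc.cda h0).continuousAt
  have hJ : ContinuousAt (JJ φ) 0 := hc.JJ_cont.continuousAt (isOpen_ball.mem_nhds h0)
  have t1 : Filter.Tendsto (JJ φ) (nhdsWithin 0 {0}ᶜ) (nhds 1) := by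
    have := hJ.tendsto; rw [hc.JJ_zero] at this; exact this.mono_left nhdsWithin_le_nhds
  have t2 : Filter.Tendsto (fun y => w (φ y)) (nhdsWithin 0 {0}ᶜ) (nhds (w z₀)) := by
    have : ContinuousAt (fun y => w (φ y)) 0 := hw.continuous.continuousAt.comp hφ
    have := this.tendsto; simp only [hc.zero] at this; exact this.mono_left nhdsWithin_le_nhds
  have t3 : Filter.Tendsto (fun y : ℂ => ‖y‖ ^ 2 * q1 (‖y‖ ^ 2)) (nhdsWithin 0 {0}ᶜ) (nhds (-m)) := by
    refine h.hq.lim.comp (f := fun y : ℂ => ‖y‖ ^ 2) ?_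
    refine tendsto_nhdsWithin_iff.2 ⟨?_, ?_⟩
    · have : Continuous (fun y : ℂ => ‖y‖ ^ 2) := by fun_prop
      have := this.tendsto 0
      simp only [norm_zero, ne_eq, OfNat.ofNat_ne_zero, not_false_eq_true, zero_pow] at this
      exact this.mono_left nhdsWithin_le_nhds
    · filter_upwards [self_mem_nhdsWithin] with y hy
      have : 0 < ‖y‖ := norm_pos_iff.2 hy
      exact Set.mem_Ioi.2 (by positivity)
  have t4 : Filter.Tendsto (fun y => ⟪Srf.n (φ y), L y⟫ ^ 2 / ‖y‖ ^ 2) (nhdsWithin 0 {0}ᶜ) (nhds 0) := by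
    have c1 : ContinuousAt (fun y => ‖Srf.n (φ y) - Srf.n z₀‖ ^ 2) 0 := by
      have hnz := (n_contDiffAt Srf h.hz).continuousAt
      rw [← hc.zero] at hnz
      have : ContinuousAt (fun y => Srf.n (φ y)) 0 := ContinuousAt.comp (g := Srf.n) hnz hφ
      exact ((this.sub continuousAt_const).norm).pow 2
    have c2 := c1.tendsto
    simp only [hc.zero, sub_self, norm_zero, ne_eq, OfNat.ofNat_ne_zero, not_false_eq_true, zero_pow] at c2
    refine squeeze_zero (fun y => by positivity) (fun y => ?_) (c2.mono_left nhdsWithin_le_nhds)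
    have e1 : (⟪Srf.n (φ y), L y⟫ : ℝ) = ⟪Srf.n (φ y) - Srf.n z₀, L y⟫ := by
      rw [inner_sub_left, h.frame.inner_n, sub_zero]
    have e2 := abs_real_inner_le_norm (Srf.n (φ y) - Srf.n z₀) (L y)
    rw [L.norm_map] at e2
    rw [e1, ← sq_abs]
    refine div_le_of_le_mul₀ (by positivity) (by positivity) ?_
    rw [← mul_pow]
    gcongr
  have := ((t1.mul t2).mul (t3.const_mul 4)).mul (t4.const_sub 1)
  have e : 1 * w z₀ * (4 * -m) * (1 - 0) = -(4 * m * w z₀) := by ring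
  rw [e] at this
  exact this

lemma Setup.B_limit (h : Setup Srf r₁ Cζ Λ Cn C m z₀ L ζ q q1 q2) {w : E3 → ℝ} (hw : ContDiff ℝ 1 w) :
    Filter.Tendsto (fun k : ℕ => ∫ x in Srf.S, Bf Srf L z₀ ζ q q1 w (et L z₀ k) x ∂μH[2])
      Filter.atTop (nhds (Lam * (-(4 * m * w z₀)))) := by
  obtain ⟨δ, V, φ, hc⟩ := exists_chart Srf h.hz h.frame
  refine kk_limit hc.pos (h.Ff_lim hc hw) ?_
  have h0 : (0:ℂ) ∈ ball (0:ℂ) δ := mem_ball_self hc.pos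
  have hSm : MeasurableSet Srf.S := Srf.compact.isClosed.measurableSet
  have hφ : ContinuousAt φ 0 := (hc.cda h0).continuousAt
  obtain ⟨ρ1, hρ1, hs1⟩ := Metric.isOpen_iff.1 hc.isOpen z₀ hc.mem
  obtain ⟨ρ2, hρ2, hs2⟩ : ∃ ρ > 0, ∀ y, ‖y‖ < ρ → ‖φ y - z₀‖ < r₁ := by
    obtain ⟨ρ, hρ, hh⟩ := Metric.continuousAt_iff.1 hφ r₁ h.r0
    refine ⟨ρ, hρ, fun y hy => ?_⟩
    have := @hh y (by rwa [dist_zero_right])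
    rwa [hc.zero, dist_eq_norm] at this
  have hC0 : 0 < C := by linarith [h.C1]
  set ρ := min (ρ1 / C) (min ρ2 δ) with hρd
  have hρ : 0 < ρ := lt_min (by positivity) (lt_min hρ2 hc.pos)
  have hlarge : ∀ᶠ k : ℕ in Filter.atTop, 2 < (k:ℝ) * ρ ^ 2 :=
    (tendsto_natCast_atTop_atTop.atTop_mul_const (by positivity)).eventually_gt_atTop 2
  filter_upwards [hlarge, Filter.eventually_gt_atTop 0] with k hk hk0
  have hk1 : (0:ℝ) < k := by exact_mod_cast hk0
  have hIntg := (h.stokes hw (et_contDiff (L := L) (z₀ := z₀) k) (fun x => bt_nonneg _) (fun x => bt_le_one _)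
    (et_ev k)).2.1
  have hout : ∀ x ∈ Srf.S \ (Srf.S ∩ V), Bf Srf L z₀ ζ q q1 w (et L z₀ k) x = 0 := by
    intro x hx
    have hxV : x ∉ V := fun hv => hx.2 ⟨hx.1, hv⟩
    rcases h.cases x with hr | hz
    · have hl := h.low x hx.1 hr
      by_cases hkk : kk k (fr L (x - z₀)) = 0
      · have : deriv bt (k * sf L z₀ x) * k = 0 := hkk
        unfold Bf
        rw [et_gradient, this, mul_zero, zero_smul, cr_zero_right, inner_zero_left, mul_zero]
      · exfalso
        have h3 := (kk_supp hk1 hρ hk hkk).2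
        have h4 : ‖fr L (x - z₀)‖ < ρ1 / C := h3.trans_le (min_le_left _ _)
        rw [lt_div_iff₀ hC0] at h4
        refine hxV (hs1 ?_)
        rw [mem_ball, dist_eq_norm]
        linarith
    · have := (Yf_ev_zero (L := L) (z₀ := z₀) (q := q) (q1 := q1) hz).self_of_nhds
      simp [Bf, this, cr_zero_right]
  have hin : ∀ y ∈ ball (0:ℂ) δ, JJ φ y * Bf Srf L z₀ ζ q q1 w (et L z₀ k) (φ y) = kk k y * Ff Srf L q1 w φ y := by
    intro y hy
    have hfr := hc.left y hy
    have hsf : sf L z₀ (φ y) = ‖y‖ ^ 2 := by unfold sf; rw [hfr]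
    have hpf : pf L z₀ (φ y) = L y := by unfold pf; rw [hfr]
    have hg : gradient (et L z₀ k) (φ y) = (2 * kk k y) • L y := by
      rw [et_gradient, hsf, hpf]; rfl
    by_cases hkk : kk k y = 0
    · unfold Bf
      rw [hg, hkk, mul_zero, zero_smul, cr_zero_right, inner_zero_left, mul_zero, mul_zero, zero_mul]
    · obtain ⟨hy0, hyρ⟩ := kk_supp hk1 hρ hk hkk
      have hlt : ‖φ y - z₀‖ < r₁ := hs2 y (hyρ.trans_le ((min_le_right _ _).trans (min_le_left _ _)))
      have h1 : ∀ᶠ x' in nhds (φ y), ζ x' = 1 := by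
        have : φ y ∈ ball z₀ r₁ := by rwa [mem_ball, dist_eq_norm]
        filter_upwards [isOpen_ball.mem_nhds this] with x' hx'
        exact h.cut.2.2.1 x' (ball_subset_closedBall hx')
      have hY : Yf L z₀ ζ q q1 (φ y) = (2 * q1 (‖y‖ ^ 2)) • L y := by
        unfold Yf
        rw [(ev_zero h1).1.self_of_nhds, h1.self_of_nhds, hsf, hpf, smul_zero, add_zero, mul_one]
      have hnn := Srf.n_unit _ (hc.maps y hy).1
      have hcr : (⟪cr (Srf.n (φ y)) (L y), cr (Srf.n (φ y)) (L y)⟫ : ℝ) =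
          ‖y‖ ^ 2 - ⟪Srf.n (φ y), L y⟫ ^ 2 := by
        rw [real_inner_self_eq_norm_sq, cr_norm_sq, hnn, L.norm_map]; ring
      have hyn : ‖y‖ ≠ 0 := norm_ne_zero_iff.2 hy0
      unfold Bf Ff
      rw [hg, hY, cr_smul_right, cr_smul_right, inner_smul_left, inner_smul_right, hcr]
      simp only [conj_trivial]
      field_simp
      ring
  constructor
  · have h5 := (hc.integrable_iff _).1 (hIntg.mono_set (Set.inter_subset_left (t := V)))
    exact h5.congr_fun hin measurableSet_ball
  · rw [← setIntegral_congr_fun measurableSet_ball hin, ← hc.integral_eq]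
    exact setIntegral_eq_of_subset_of_forall_sdiff_eq_zero hSm Set.inter_subset_left hout

end

end AG

namespace AG

section
variable {Srf : SmoothSurface} {r₁ Cζ Λ Cn C m : ℝ} {z₀ : E3} {L : ℂ →ₗᵢ[ℝ] E3} {ζ : E3 → ℝ}
  {q q1 q2 : ℝ → ℝ}

lemma inv_norm_int (ρ : ℝ) : IntegrableOn (fun y : ℂ => ‖y‖⁻¹) (ball (0:ℂ) ρ) μH[2] := by
  have hdim : Module.finrank ℝ ℂ - 1 = 1 := by rw [Complex.finrank_real_complex]
  have h1 := (integrable_fun_norm_addHaar (μ := (μH[2] : Measure ℂ))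
      (f := (Set.Iio ρ).indicator (fun t => t⁻¹))).2 (by
    rw [hdim]
    have h2 : IntegrableOn ((Set.Iio ρ).indicator (fun _ : ℝ => (1:ℝ))) (Set.Ioi (0:ℝ)) := by
      rw [IntegrableOn, integrable_indicator_iff measurableSet_Iio, IntegrableOn,
        Measure.restrict_restrict measurableSet_Iio, Set.inter_comm, Set.Ioi_inter_Iio]
      exact integrableOn_const (by simp)
    refine h2.congr_fun (fun t ht => ?_) measurableSet_Ioi
    have : (t:ℝ) ≠ 0 := (Set.mem_Ioi.1 ht).ne'
    by_cases hc : t < ρ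
    · simp [Set.indicator, hc, this]
    · simp [Set.indicator, hc])
  rw [← integrable_indicator_iff measurableSet_ball]
  refine h1.congr (Filter.Eventually.of_forall fun y => ?_)
  by_cases hc : ‖y‖ < ρ
  · simp [Set.indicator, hc]
  · simp [Set.indicator, hc]

lemma sing_int (Srf : SmoothSurface) {z₀ : E3} (hz : z₀ ∈ Srf.S) :
    IntegrableOn (fun x => ‖x - z₀‖⁻¹) Srf.S μH[2] := by
  obtain ⟨L, δ, V, φ, hc⟩ := hasChart Srf hz
  have hSm : MeasurableSet Srf.S := Srf.compact.isClosed.measurableSet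
  set W : Set E3 := V ∩ {x | fr L (x - z₀) ∈ ball (0:ℂ) (δ / 2)} with hW
  have hWo : IsOpen W := hc.isOpen.inter (isOpen_ball.preimage (by fun_prop))
  have hδ := hc.pos
  have hzW : z₀ ∈ W := ⟨hc.mem, by simp [hδ]⟩
  have hout : IntegrableOn (fun x => ‖x - z₀‖⁻¹) (Srf.S \ W) μH[2] := by
    have hK : IsCompact (Srf.S \ W) := Srf.compact.diff hWo
    refine ContinuousOn.integrableOn_of_subset_isCompact ?_ hK hK.isClosed.measurableSet subset_rfl
      ((measure_mono Set.sdiff_subset).trans_lt (measure_S_lt_top Srf)).ne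
    refine ContinuousOn.inv₀ (by fun_prop) fun x hx => ?_
    rw [norm_ne_zero_iff, sub_ne_zero]
    rintro rfl
    exact hx.2 hzW
  have hJc : ContinuousOn (JJ φ) (closedBall (0:ℂ) (δ / 2)) :=
    hc.JJ_cont.mono (closedBall_subset_ball (by linarith))
  obtain ⟨K, hK⟩ := (isCompact_closedBall (0:ℂ) (δ / 2)).exists_bound_of_continuousOn hJc
  have hin : IntegrableOn (W.indicator fun x => ‖x - z₀‖⁻¹) (Srf.S ∩ V) μH[2] := by
    rw [hc.integrable_iff]
    have hb : Integrable (fun y => K * (ball (0:ℂ) (δ / 2)).indicator (fun y => ‖y‖⁻¹) y)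
        ((μH[2] : Measure ℂ).restrict (ball 0 δ)) :=
      (((inv_norm_int (δ / 2)).integrable_indicator measurableSet_ball).integrableOn).const_mul K
    refine hb.mono' ?_ ?_
    · have m1 : Measurable (W.indicator fun x : E3 => ‖x - z₀‖⁻¹) := by
        refine Measurable.indicator ?_ hWo.measurableSet
        fun_prop
      have m2 : AEMeasurable φ ((μH[2] : Measure ℂ).restrict (ball 0 δ)) :=
        hc.smooth.continuousOn.aemeasurable measurableSet_ball
      have m3 : AEMeasurable (JJ φ) ((μH[2] : Measure ℂ).restrict (ball 0 δ)) :=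
        hc.JJ_cont.aemeasurable measurableSet_ball
      exact (m3.mul (m1.comp_aemeasurable m2)).aestronglyMeasurable
    · refine ae_restrict_of_forall_mem measurableSet_ball fun y hy => ?_
      have hfr := hc.left y hy
      by_cases hyb : y ∈ ball (0:ℂ) (δ / 2)
      · have h1 := hK y (ball_subset_closedBall hyb)
        have h2 : φ y ∈ W := ⟨(hc.maps y hy).2, by
          change fr L (φ y - z₀) ∈ ball (0:ℂ) (δ / 2)
          rwa [hfr]⟩
        rw [Set.indicator_of_mem h2, Set.indicator_of_mem hyb, norm_mul, norm_inv, norm_norm]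
        have h3 := hc.norm_sub_le hy (mem_ball_self hδ)
        rw [sub_zero, hc.zero] at h3
        by_cases hy0 : y = 0
        · subst hy0; simp [hc.zero]
        · have : 0 < ‖y‖ := norm_pos_iff.2 hy0
          gcongr
          exact (norm_nonneg _).trans h1
      · have h2 : φ y ∉ W := fun hc' => hyb (by
          have := hc'.2
          change fr L (φ y - z₀) ∈ ball (0:ℂ) (δ / 2) at this
          rwa [hfr] at this)
        rw [Set.indicator_of_notMem h2, Set.indicator_of_notMem hyb]
        simp
  rw [IntegrableOn, integrable_indicator_iff hWo.measurableSet, IntegrableOn,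
    Measure.restrict_restrict hWo.measurableSet] at hin
  have : Srf.S ⊆ (W ∩ (Srf.S ∩ V)) ∪ (Srf.S \ W) := by
    intro x hx
    by_cases hxW : x ∈ W
    · exact Or.inl ⟨hxW, hx, hxW.1⟩
    · exact Or.inr ⟨hx, hxW⟩
  exact (IntegrableOn.union hin hout).mono_set this

lemma ne_ae (S : Set E3) (z₀ : E3) : ∀ᵐ x ∂((μH[2] : Measure E3).restrict S), x ≠ z₀ := by
  have := Measure.nullSingletonClass_hausdorff E3 (d := 2) (by norm_num)
  refine ae_restrict_of_ae ?_
  rw [ae_iff]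
  simpa using measure_singleton z₀

lemma cr_norm_le (a b : E3) : ‖cr a b‖ ≤ ‖a‖ * ‖b‖ := by
  refine le_of_sq_le_sq ?_ (by positivity)
  rw [cr_norm_sq, mul_pow]
  nlinarith [sq_nonneg (⟪a, b⟫ : ℝ)]

lemma Setup.A_limit (h : Setup Srf r₁ Cζ Λ Cn C m z₀ L ζ q q1 q2) {w : E3 → ℝ} (hw : ContDiff ℝ 1 w) :
    Filter.Tendsto (fun k : ℕ => ∫ x in Srf.S, et L z₀ k x * Gf Srf L z₀ ζ q q1 w x ∂μH[2])
      Filter.atTop (nhds (∫ x in Srf.S, Gf Srf L z₀ ζ q q1 w x ∂μH[2])) := by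
  have hSm : MeasurableSet Srf.S := Srf.compact.isClosed.measurableSet
  obtain ⟨K1, hK1⟩ := Srf.compact.exists_bound_of_continuousOn
    (gradient_continuousOn (S := Srf.S) (α := w) (fun x _ => hw.contDiffAt))
  obtain ⟨K2, hK2⟩ := Srf.compact.exists_bound_of_continuousOn (f := w) hw.continuous.continuousOn
  have hmem : ∀ᵐ x ∂((μH[2] : Measure E3).restrict Srf.S), x ∈ Srf.S := ae_restrict_mem hSm
  refine tendsto_integral_of_dominated_convergence
    (fun x => (K1 + K2) * (8 * Cζ * m * C) * ‖x - z₀‖⁻¹) (fun k => ?_)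
    ((sing_int Srf h.hz).const_mul _) (fun k => ?_) ?_
  · exact (h.stokes hw (et_contDiff (L := L) (z₀ := z₀) k) (fun x => bt_nonneg _) (fun x => bt_le_one _)
      (et_ev k)).1.aestronglyMeasurable
  · filter_upwards [hmem, ne_ae Srf.S z₀] with x hx hne
    obtain ⟨s1, s2⟩ := h.sing hx hne
    have k1 := hK1 x hx
    have k2 := hK2 x hx
    rw [Real.norm_eq_abs] at k2
    set R := 8 * Cζ * m * C * ‖x - z₀‖⁻¹ with hR
    have hR0 : 0 ≤ R := (norm_nonneg _).trans s1
    have hn := Srf.n_unit x hx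
    have i1 : ‖cr (Srf.n x) (gradient w x)‖ ≤ K1 := by
      refine (cr_norm_le _ _).trans ?_; rw [hn, one_mul]; exact k1
    have i2 : ‖cr (Srf.n x) (Yf L z₀ ζ q q1 x)‖ ≤ R := by
      refine (cr_norm_le _ _).trans ?_; rw [hn, one_mul]; exact s1
    have i3 := abs_real_inner_le_norm (cr (Srf.n x) (gradient w x)) (cr (Srf.n x) (Yf L z₀ ζ q q1 x))
    have i4 : |(⟪cr (Srf.n x) (gradient w x), cr (Srf.n x) (Yf L z₀ ζ q q1 x)⟫ : ℝ)| ≤ K1 * R :=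
      i3.trans (mul_le_mul i1 i2 (norm_nonneg _) ((norm_nonneg _).trans i1))
    have i5 : |w x * (ζ x * q (sf L z₀ x))| ≤ K2 * R := by
      rw [abs_mul]
      exact mul_le_mul k2 s2 (abs_nonneg _) ((abs_nonneg _).trans k2)
    have i6 : |Gf Srf L z₀ ζ q q1 w x| ≤ K1 * R + K2 * R :=
      (abs_add_le _ _).trans (add_le_add i4 i5)
    have i7 : |et L z₀ k x| ≤ 1 := by
      unfold et; rw [abs_of_nonneg (bt_nonneg _)]; exact bt_le_one _
    rw [Real.norm_eq_abs, abs_mul]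
    calc |et L z₀ k x| * |Gf Srf L z₀ ζ q q1 w x| ≤ 1 * (K1 * R + K2 * R) :=
          mul_le_mul i7 i6 (abs_nonneg _) (by norm_num)
      _ = _ := by rw [hR]; ring
  · filter_upwards [hmem, ne_ae Srf.S z₀] with x hx hne
    rcases h.cases x with hr | hz
    · have hs := (h.sf_mem hx hne hr).2.1
      have hl : ∀ᶠ k : ℕ in Filter.atTop, 2 ≤ (k:ℝ) * sf L z₀ x :=
        (tendsto_natCast_atTop_atTop.atTop_mul_const hs).eventually_ge_atTop 2
      refine tendsto_const_nhds.congr' ?_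
      filter_upwards [hl] with k hk
      have : et L z₀ k x = 1 := bt_hi hk
      rw [this, one_mul]
    · have := (Yf_ev_zero (L := L) (z₀ := z₀) (q := q) (q1 := q1) hz).self_of_nhds
      have hG : Gf Srf L z₀ ζ q q1 w x = 0 := by simp [Gf, this, cr_zero_right, hz.self_of_nhds]
      simp [hG]

lemma Setup.aForm_eq (h : Setup Srf r₁ Cζ Λ Cn C m z₀ L ζ q q1 q2) {v : E3 → ℝ}
    (hv : ∀ y : ℂ, 0 < ‖y‖ → ‖y‖ < 100 → v (z₀ + L y) = q (‖y‖ ^ 2))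
    {w : E3 → ℝ} (hw : ContDiff ℝ 1 w) :
    Srf.aForm (approxGreen Srf z₀ ζ v) w = ∫ x in Srf.S, Gf Srf L z₀ ζ q q1 w x ∂μH[2] := by
  have hSm : MeasurableSet Srf.S := Srf.compact.isClosed.measurableSet
  refine integral_congr_ae ?_
  filter_upwards [ae_restrict_mem hSm, ne_ae Srf.S z₀] with x hx hne
  have hP : ∀ x', Srf.P0 z₀ x' = z₀ + L (fr L (x' - z₀)) := by
    intro x'; rw [h.frame.L_fr]; rfl
  have hev : approxGreen Srf z₀ ζ v =ᶠ[nhds x] fun x => ζ x * q (sf L z₀ x) := by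
    rcases h.cases x with hr | hz
    · have hs := (h.sf_mem hx hne hr).2
      have hc := (sf_contDiff L z₀).continuous.continuousAt (x := x)
      filter_upwards [hc.eventually (isOpen_Ioo.mem_nhds hs)] with x' hx'
      unfold approxGreen
      have hx1 : 0 < ‖fr L (x' - z₀)‖ ^ 2 := hx'.1
      have hx2 : ‖fr L (x' - z₀)‖ ^ 2 < 10000 := hx'.2
      rw [hP, hv]
      · rfl
      · by_contra h0
        have : ‖fr L (x' - z₀)‖ = 0 := le_antisymm (not_lt.1 h0) (norm_nonneg _)
        rw [this] at hx1; norm_num at hx1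
      · nlinarith [norm_nonneg (fr L (x' - z₀))]
    · filter_upwards [hz] with x' hx'
      simp [approxGreen, hx']
  have hd := (h.gd hx hne).congr_of_eventuallyEq hev
  have hg : gradient (approxGreen Srf z₀ ζ v) x = Yf L z₀ ζ q q1 x := by
    refine ext_inner_right ℝ fun e => ?_
    rw [inner_gradient, hd.fderiv]; rfl
  rw [grad_inner Srf hx hd.differentiableAt (hw.differentiable (by norm_num) x), hg, hev.self_of_nhds]
  unfold Gf
  rw [real_inner_comm]; ring

lemma cs_S (Srf : SmoothSurface) {w : E3 → ℝ} (hw : Continuous w) :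
    ∫ x in Srf.S, |w x| ∂μH[2] ≤
      √((μH[2] : Measure E3).real Srf.S) * √(∫ x in Srf.S, w x ^ 2 ∂μH[2]) := by
  have hSm : MeasurableSet Srf.S := Srf.compact.isClosed.measurableSet
  have hci : ∀ f : E3 → ℝ, Continuous f → IntegrableOn f Srf.S μH[2] := fun f hf =>
    hf.continuousOn.integrableOn_of_subset_isCompact Srf.compact hSm subset_rfl (measure_S_lt_top Srf).ne
  rw [← Real.sqrt_mul measureReal_nonneg]
  refine Real.le_sqrt_of_sq_le ?_
  set M := (μH[2] : Measure E3).real Srf.S with hM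
  set a := ∫ x in Srf.S, |w x| ∂μH[2] with ha
  set b := ∫ x in Srf.S, w x ^ 2 ∂μH[2] with hb
  have h1 : 0 ≤ ∫ x in Srf.S, (M * |w x| - a) ^ 2 ∂μH[2] := integral_nonneg fun x => sq_nonneg _
  have h2 : ∫ x in Srf.S, (M * |w x| - a) ^ 2 ∂μH[2] = M ^ 2 * b - 2 * M * a * a + a ^ 2 * M := by
    have e : ∀ x, (M * |w x| - a) ^ 2 = M ^ 2 * w x ^ 2 - 2 * M * a * |w x| + a ^ 2 := by
      intro x; rw [← sq_abs (w x)]; ring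
    simp only [e]
    rw [integral_add, integral_sub, integral_const_mul, integral_const_mul, setIntegral_const,
      smul_eq_mul]
    · ring
    · exact hci _ (by fun_prop)
    · exact hci _ (by fun_prop)
    · exact hci _ (by fun_prop)
    · exact hci _ (by fun_prop)
  have hM0 : 0 ≤ M := measureReal_nonneg
  rcases hM0.eq_or_lt with h0 | h0
  · have hz : (μH[2] : Measure E3) Srf.S = 0 := by
      have := h0.symm
      rw [hM, measureReal_eq_zero_iff (measure_S_lt_top Srf).ne] at this
      exact this
    have : a = 0 := by rw [ha, Measure.restrict_eq_zero.2 hz]; simp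
    rw [this, ← h0]; simp
  · rw [h2] at h1
    have h3 : 0 ≤ M * (M * b - a ^ 2) := by linarith
    have := nonneg_of_mul_nonneg_right h3 h0
    linarith

theorem main (Srf : SmoothSurface) (r₁ : ℝ) (hr₁ : Srf.IsGraphRadius r₁) (Cζ CG : ℝ) :
    ∃ c > 0, ∀ z₀ ∈ Srf.S, ∀ ζ v : E3 → ℝ, IsCutoff z₀ r₁ Cζ ζ → Srf.IsGreen z₀ CG v →
      ∀ w : E3 → ℝ, ContDiff ℝ 1 w → |Srf.aForm (approxGreen Srf z₀ ζ v) w - w z₀| ≤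
        c * Real.sqrt (∫ x in Srf.S, w x ^ 2 ∂μH[2]) := by
  obtain ⟨Λ, hΛ0, hΛ⟩ := n_lipschitz Srf
  obtain ⟨Cn, hCn0, hCn⟩ := n_fderiv_bound Srf
  obtain ⟨C, hC1, hC⟩ := proj_lower Srf hr₁
  have hLam := Lam_pos
  refine ⟨|CE r₁ Cζ Λ Cn C (1 / (4 * Lam))| * √((μH[2] : Measure E3).real Srf.S) + 1, by positivity, ?_⟩
  intro z₀ hz ζ v hζ hv w hw
  obtain ⟨L, hL⟩ := exists_frame (Srf.n_unit z₀ hz)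
  obtain ⟨q, q1, q2, hq, hqv⟩ := green_profile hL hv
  have h : Setup Srf r₁ Cζ Λ Cn C (1 / (4 * Lam)) z₀ L ζ q q1 q2 :=
    { hz := hz, frame := hL, hq := hq, cut := hζ, r0 := hr₁.1, r1 := hr₁.2.1, L0 := hΛ0,
      lip := fun x hx => hΛ x hx z₀ hz, N0 := hCn0, nb := hCn, C1 := hC1,
      low := fun x hx hr => hC z₀ hz x hx hr L hL }
  have hlim := ((h.A_limit hw).add (h.B_limit hw)).abs
  have hle := le_of_tendsto hlim (Filter.Eventually.of_forall fun k : ℕ =>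
    (h.stokes hw (et_contDiff (L := L) (z₀ := z₀) k) (fun x => bt_nonneg _) (fun x => bt_le_one _)
      (et_ev k)).2.2)
  rw [← h.aForm_eq hqv hw] at hle
  have e : Lam * (-(4 * (1 / (4 * Lam)) * w z₀)) = - w z₀ := by field_simp
  rw [e, ← sub_eq_add_neg] at hle
  have h1 := cs_S Srf hw.continuous
  have h2 := h.CE0
  have h3 : 0 ≤ Real.sqrt (∫ x in Srf.S, w x ^ 2 ∂μH[2]) := Real.sqrt_nonneg _
  rw [abs_of_nonneg h2]
  calc _ ≤ _ := hle
    _ ≤ _ := mul_le_mul_of_nonneg_left h1 h2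
    _ ≤ _ := by rw [add_mul, one_mul, mul_assoc]; linarith

end

end AG

/-- **The approximate Green's function property.** There is `c > 0` depending only on `S`
(and the uniform constants of the construction), independent of `z₀`, with
`|a(g̃, w) − w(z₀)| ≤ c ‖w‖_{L²(S)}` for every `C¹` function `w`. -/
theorem approx_green_property (Srf : SmoothSurface) (r₁ : ℝ) (hr₁ : Srf.IsGraphRadius r₁)
    (Cζ CG : ℝ) (hCζ : 0 < Cζ) (hCG : 0 < CG) :
    ∃ c > 0, ∀ z₀ ∈ Srf.S, ∀ ζ v : E3 → ℝ,
      IsCutoff z₀ r₁ Cζ ζ → Srf.IsGreen z₀ CG v →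
      ∀ w : E3 → ℝ, ContDiff ℝ 1 w →
        |Srf.aForm (approxGreen Srf z₀ ζ v) w - w z₀| ≤
          c * Real.sqrt (∫ x in Srf.S, w x ^ 2 ∂μH[2]) := by
  exact AG.main Srf r₁ hr₁ Cζ CG

end
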